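/- Let d ≥ 1, k ≥ 0, and let E : ℝ^d → ℝ^d satisfy (H0), (H1) and (H2) with p = 2. Then there exists a unique function G ∈ L²_k(ℝ^d) such that G(x) > 0 for every x ∈ ℝ^d, ∫_{ℝ^d} G(x) dx = 1, and G is a stationary solution of the Fokker–Planck equation, i.e. div(∇G + E G) = 0 in the sense of distributions: for every φ ∈ C_c^∞(ℝ^d), ∫_{ℝ^d} (∇G(x) + E(x) G(x)) · ∇φ(x) dx = 0. -/

import Mathlib

open MeasureTheory Real Filter Topology RealInnerProductSpace
open scoped BigOperators

noncomputable section

/-- The weight `⟨x⟩ᵏ = (1+|x|²)^{k/2}`. -/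
def jap {d : ℕ} (k : ℝ) (x : EuclideanSpace ℝ (Fin d)) : ℝ :=
  (1 + ‖x‖ ^ 2) ^ (k / 2)

/-- The divergence of a vector field on `ℝᵈ`. -/
def dvg {d : ℕ} (E : EuclideanSpace ℝ (Fin d) → EuclideanSpace ℝ (Fin d))
    (x : EuclideanSpace ℝ (Fin d)) : ℝ :=
  ∑ i, ⟪fderiv ℝ E x (EuclideanSpace.single i 1), EuclideanSpace.single i 1⟫

/-- The Laplacian of a scalar function on `ℝᵈ`. -/
def lap {d : ℕ} (f : EuclideanSpace ℝ (Fin d) → ℝ) (x : EuclideanSpace ℝ (Fin d)) : ℝ :=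
  dvg (gradient f) x

/-- The Fokker–Planck operator `Lf = div(∇f + E f)`. -/
def Lop {d : ℕ} (E : EuclideanSpace ℝ (Fin d) → EuclideanSpace ℝ (Fin d))
    (f : EuclideanSpace ℝ (Fin d) → ℝ) (x : EuclideanSpace ℝ (Fin d)) : ℝ :=
  dvg (fun y => gradient f y + f y • E y) x

/-- Hypothesis (H0): `E ∈ W^{1,∞}_loc(ℝᵈ; ℝᵈ)` (classical formulation:
`E` is differentiable with locally bounded values and derivative). -/
def H0 {d : ℕ} (E : EuclideanSpace ℝ (Fin d) → EuclideanSpace ℝ (Fin d)) : Prop :=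
  Differentiable ℝ E ∧ ∀ R : ℝ, ∃ C : ℝ, ∀ x, ‖x‖ ≤ R → ‖E x‖ + ‖fderiv ℝ E x‖ ≤ C

/-- Hypothesis (H1): `α|x|^γ − β ≤ x·E(x) ≤ α₂|x|^{γ₂} + β₂` with
`α, α₂ > 0` and `1 < γ ≤ γ₂ ≤ 2`. -/
def H1 {d : ℕ} (E : EuclideanSpace ℝ (Fin d) → EuclideanSpace ℝ (Fin d)) : Prop :=
  ∃ α α₂ β β₂ γ γ₂ : ℝ, 0 < α ∧ 0 < α₂ ∧ 1 < γ ∧ γ ≤ γ₂ ∧ γ₂ ≤ 2 ∧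
    ∀ x : EuclideanSpace ℝ (Fin d),
      α * ‖x‖ ^ γ - β ≤ ⟪x, E x⟫ ∧ ⟪x, E x⟫ ≤ α₂ * ‖x‖ ^ γ₂ + β₂

/-- Hypothesis (H2) with `p = 2` (so `p/p' = 1`) and constant `β₀`:
`−div E(x) + k x·E(x)/(1+|x|²) ≥ β₀` for all `x`. -/
def H2 {d : ℕ} (k β₀ : ℝ) (E : EuclideanSpace ℝ (Fin d) → EuclideanSpace ℝ (Fin d)) : Prop :=
  ∀ x : EuclideanSpace ℝ (Fin d), β₀ ≤ -dvg E x + k * ⟪x, E x⟫ / (1 + ‖x‖ ^ 2)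

/-- Hypothesis (H3) with `p = 2` and constant `ω* > 0`:
`−(kd + k(k+d−2)|x|²)/(1+|x|²)² − div E(x) + k x·E(x)/(1+|x|²) ≥ ω*` for all `x`. -/
def H3 {d : ℕ} (k ωs : ℝ) (E : EuclideanSpace ℝ (Fin d) → EuclideanSpace ℝ (Fin d)) : Prop :=
  ∀ x : EuclideanSpace ℝ (Fin d),
    ωs ≤ -(k * (d : ℝ) + k * (k + (d : ℝ) - 2) * ‖x‖ ^ 2) / (1 + ‖x‖ ^ 2) ^ 2
          - dvg E x + k * ⟪x, E x⟫ / (1 + ‖x‖ ^ 2)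

section StationarySolution

open Set Metric CompactlySupported
open scoped ContDiff Convolution

variable {d : ℕ}

/-- Euclidean space of dimension `d`. -/
abbrev Euc (d : ℕ) : Type := EuclideanSpace ℝ (Fin d)

/-- The Laplacian as the sum of the pure second partial derivatives. -/
def laplSum {d : ℕ} (φ : Euc d → ℝ) (x : Euc d) : ℝ :=
  ∑ i, fderiv ℝ (fun y => fderiv ℝ φ y (EuclideanSpace.single i 1)) x (EuclideanSpace.single i 1)

/-- The formal adjoint `Δφ - E·∇φ` of the Fokker–Planck operator. -/
def adjOp {d : ℕ} (E : Euc d → Euc d) (φ : Euc d → ℝ) (x : Euc d) : ℝ :=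
  laplSum φ x - fderiv ℝ φ x (E x)

theorem hasFDerivAt_norm_sub_sq (x0 x : Euc d) :
    HasFDerivAt (fun y => ‖y - x0‖ ^ 2) (2 • innerSL ℝ (x - x0)) x := by
  have := ((hasFDerivAt_id x).sub_const x0).norm_sq
  simpa using this

theorem fderiv_radial {h : ℝ → ℝ} {h' : ℝ} (x0 x v : Euc d)
    (hh : HasDerivAt h h' (‖x - x0‖ ^ 2)) :
    fderiv ℝ (fun y => h (‖y - x0‖ ^ 2)) x v = 2 * h' * ⟪x - x0, v⟫ := by
  have := (hh.comp_hasFDerivAt x (hasFDerivAt_norm_sub_sq x0 x)).fderiv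
  rw [show (fun y => h (‖y - x0‖ ^ 2)) = h ∘ fun y => ‖y - x0‖ ^ 2 from rfl, this]
  simp only [smul_apply, innerSL_apply_apply, smul_eq_mul, nsmul_eq_mul]
  push_cast
  ring

theorem sum_inner_single_sq (x : Euc d) :
    ∑ i, ⟪x, EuclideanSpace.single i (1 : ℝ)⟫ ^ 2 = ‖x‖ ^ 2 := by
  rw [EuclideanSpace.norm_sq_eq]
  simp [EuclideanSpace.inner_single_right]

theorem laplSum_radial {h h' h'' : ℝ → ℝ} (x0 x : Euc d)
    (hh : ∀ s, 0 ≤ s → HasDerivAt h (h' s) s) (hh' : ∀ s, 0 ≤ s → HasDerivAt h' (h'' s) s) :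
    laplSum (fun y => h (‖y - x0‖ ^ 2)) x
      = 4 * ‖x - x0‖ ^ 2 * h'' (‖x - x0‖ ^ 2) + 2 * d * h' (‖x - x0‖ ^ 2) := by
  unfold laplSum
  have key : ∀ i : Fin d, fderiv ℝ (fun y => fderiv ℝ (fun y => h (‖y - x0‖ ^ 2)) y
      (EuclideanSpace.single i 1)) x (EuclideanSpace.single i 1)
      = 4 * h'' (‖x - x0‖ ^ 2) * ⟪x - x0, EuclideanSpace.single i (1 : ℝ)⟫ ^ 2
        + 2 * h' (‖x - x0‖ ^ 2) := by
    intro i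
    have e1 : (fun y => fderiv ℝ (fun y => h (‖y - x0‖ ^ 2)) y (EuclideanSpace.single i 1))
        = fun y => (2 * h' (‖y - x0‖ ^ 2)) * ⟪y - x0, EuclideanSpace.single i (1 : ℝ)⟫ := by
      funext y
      rw [fderiv_radial x0 y _ (hh _ (by positivity))]
    rw [e1]
    have a1 := (((hh' _ (by positivity)).comp_hasFDerivAt x
      (hasFDerivAt_norm_sub_sq x0 x)).const_mul 2)
    have a2 : HasFDerivAt (fun y : Euc d => ⟪y - x0, EuclideanSpace.single i (1 : ℝ)⟫)
        (innerSL ℝ (EuclideanSpace.single i (1 : ℝ))) x := by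
      have := ((innerSL ℝ (EuclideanSpace.single i (1 : ℝ))).hasFDerivAt (x := x - x0)).comp x
        ((hasFDerivAt_id x).sub_const x0)
      refine (this.congr_of_eventuallyEq ?_)
      filter_upwards with y
      simp [real_inner_comm]
    have := (HasFDerivAt.fun_mul a1 a2).fderiv
    simp only [Function.comp_def] at this
    rw [this]
    have hs : ⟪(EuclideanSpace.single i (1 : ℝ) : Euc d), EuclideanSpace.single i (1 : ℝ)⟫ = 1 := by
      simp
    simp only [add_apply, smul_apply, innerSL_apply_apply,
      hs, smul_eq_mul, nsmul_eq_mul]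
    push_cast
    ring
  simp_rw [key]
  rw [Finset.sum_add_distrib, ← Finset.mul_sum, sum_inner_single_sq]
  simp
  ring

/-- A smooth compactly supported radial function with prescribed radial derivative. -/
theorem exists_radial_test (x0 : Euc d) {a ρ : ℝ} (ha : a < 0) (hρ : 0 < ρ) {q q' : ℝ → ℝ}
    (hq : ContDiffOn ℝ ∞ q (Ioi a)) (hz : ∀ s, ρ ^ 2 ≤ s → q s = 0)
    (hq' : ∀ s, 0 ≤ s → HasDerivAt q (q' s) s) :
    ∃ φ : Euc d → ℝ, ContDiff ℝ ∞ φ ∧ tsupport φ ⊆ closedBall x0 ρ ∧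
      (∀ x v, fderiv ℝ φ x v = -2 * q (‖x - x0‖ ^ 2) * ⟪x - x0, v⟫) ∧
      ∀ x, laplSum φ x
        = -4 * ‖x - x0‖ ^ 2 * q' (‖x - x0‖ ^ 2) - 2 * d * q (‖x - x0‖ ^ 2) := by
  set h : ℝ → ℝ := fun s => ∫ t in s..ρ ^ 2, q t with hh
  have hρa : ρ ^ 2 ∈ Ioi a := by simp only [mem_Ioi]; nlinarith
  have hder : ∀ s ∈ Ioi a, HasDerivAt h (-q s) s := by
    intro s hs
    have hc : ContinuousOn q (Ioi a) := hq.continuousOn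
    refine intervalIntegral.integral_hasDerivAt_left ?_ ?_ ?_
    · apply ContinuousOn.intervalIntegrable
      exact hc.mono (by intro t ht; exact lt_of_lt_of_le (lt_min hs hρa) ht.1)
    · exact hc.stronglyMeasurableAtFilter isOpen_Ioi s hs
    · exact hc.continuousAt (Ioi_mem_nhds hs)
  have hsm : ContDiffOn ℝ ∞ h (Ioi a) := by
    rw [contDiffOn_infty_iff_deriv_of_isOpen isOpen_Ioi]
    refine ⟨fun s hs => (hder s hs).differentiableAt.differentiableWithinAt, ?_⟩
    exact hq.neg.congr fun s hs => (hder s hs).deriv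
  have hmem : ∀ x : Euc d, ‖x - x0‖ ^ 2 ∈ Ioi a := fun x =>
    lt_of_lt_of_le ha (by positivity)
  refine ⟨fun x => h (‖x - x0‖ ^ 2), ?_, ?_, ?_, ?_⟩
  · rw [contDiff_iff_contDiffAt]
    intro x
    exact (hsm.contDiffAt (Ioi_mem_nhds (hmem x))).comp x
      ((contDiff_id.sub contDiff_const).norm_sq ℝ).contDiffAt
  · apply closure_minimal _ isClosed_closedBall
    intro x hx
    by_contra hn
    apply hx
    rw [mem_closedBall, dist_eq_norm, not_le] at hn
    have h2 : ρ ^ 2 ≤ ‖x - x0‖ ^ 2 := by gcongr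
    simp only [hh]
    rw [intervalIntegral.integral_symm, neg_eq_zero]
    apply intervalIntegral.integral_zero_ae
    filter_upwards with t ht
    rw [uIoc_of_le h2] at ht
    exact hz t ht.1.le
  · intro x v
    rw [fderiv_radial x0 x v (hder _ (hmem x))]
    ring
  · intro x
    rw [laplSum_radial (h := h) (h' := fun s => -q s) (h'' := fun s => -q' s) x0 x
      (fun s hs => hder s (lt_of_lt_of_le ha hs)) (fun s hs => (hq' s hs).neg)]
    ring

theorem contDiff_fderiv_apply {φ : Euc d → ℝ} (hφ : ContDiff ℝ ∞ φ) (v : Euc d) :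
    ContDiff ℝ ∞ (fun y => fderiv ℝ φ y v) :=
  (hφ.fderiv_right (m := ∞) (by simp)).clm_apply contDiff_const

theorem continuous_laplSum {φ : Euc d → ℝ} (hφ : ContDiff ℝ ∞ φ) : Continuous (laplSum φ) := by
  unfold laplSum
  exact continuous_finsetSum _ fun i _ =>
    (contDiff_fderiv_apply (contDiff_fderiv_apply hφ _) _).continuous

theorem continuous_adjOp {E : Euc d → Euc d} (hE : Continuous E) {φ : Euc d → ℝ}
    (hφ : ContDiff ℝ ∞ φ) : Continuous (adjOp E φ) :=
  (continuous_laplSum hφ).sub ((hφ.continuous_fderiv (by simp)).clm_apply hE)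

theorem adjOp_add (E : Euc d → Euc d) {φ ψ : Euc d → ℝ}
    (hφ : ContDiff ℝ ∞ φ) (hψ : ContDiff ℝ ∞ ψ) :
    adjOp E (φ + ψ) = adjOp E φ + adjOp E ψ := by
  have h1 : ∀ y, fderiv ℝ (φ + ψ) y = fderiv ℝ φ y + fderiv ℝ ψ y := fun y =>
    fderiv_add (hφ.differentiable (by simp) y) (hψ.differentiable (by simp) y)
  funext x
  have h2 : ∀ v : Euc d, fderiv ℝ (fun y => fderiv ℝ (φ + ψ) y v) x
      = fderiv ℝ (fun y => fderiv ℝ φ y v) x + fderiv ℝ (fun y => fderiv ℝ ψ y v) x := by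
    intro v
    simp_rw [h1, add_apply]
    exact fderiv_fun_add ((contDiff_fderiv_apply hφ v).differentiable (by simp) x)
      ((contDiff_fderiv_apply hψ v).differentiable (by simp) x)
  simp only [adjOp, laplSum, h2, add_apply, Pi.add_apply, Finset.sum_add_distrib]
  rw [h1, add_apply]
  ring

theorem adjOp_smul (E : Euc d → Euc d) (c : ℝ) {φ : Euc d → ℝ} (hφ : ContDiff ℝ ∞ φ) :
    adjOp E (c • φ) = c • adjOp E φ := by
  have h1 : ∀ y, fderiv ℝ (c • φ) y = c • fderiv ℝ φ y := fun y =>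
    fderiv_const_smul (hφ.differentiable (by simp) y) c
  funext x
  have h2 : ∀ v : Euc d, fderiv ℝ (fun y => fderiv ℝ (c • φ) y v) x
      = c • fderiv ℝ (fun y => fderiv ℝ φ y v) x := by
    intro v
    simp_rw [h1, smul_apply]
    exact fderiv_fun_const_smul ((contDiff_fderiv_apply hφ v).differentiable (by simp) x) c
  simp only [adjOp, laplSum, h2, smul_apply, Pi.smul_apply, smul_eq_mul, ← Finset.mul_sum]
  rw [h1, smul_apply, smul_eq_mul]
  ring

theorem tsupport_adjOp_subset (E : Euc d → Euc d) (φ : Euc d → ℝ) :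
    tsupport (adjOp E φ) ⊆ tsupport φ := by
  apply closure_minimal _ (isClosed_tsupport φ)
  intro x hx
  by_contra hn
  apply hx
  have h1 : fderiv ℝ φ x = 0 := by
    by_contra h
    exact hn (support_fderiv_subset ℝ h)
  have h2 : ∀ v : Euc d, fderiv ℝ (fun y => fderiv ℝ φ y v) x = 0 := by
    intro v
    by_contra h
    exact hn (tsupport_fderiv_apply_subset ℝ v (support_fderiv_subset ℝ h))
  simp [adjOp, laplSum, h1, h2]

theorem deriv_deriv_nonpos_of_max {g : ℝ → ℝ} (hc : ContinuousAt g 0) (hg : ∀ t, g t ≤ g 0) :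
    deriv (deriv g) 0 ≤ 0 := by
  by_contra! h
  have hmax : IsLocalMax g 0 := Eventually.of_forall hg
  have hmin := isLocalMin_of_deriv_deriv_pos h hmax.deriv_eq_zero hc
  have heq : g =ᶠ[𝓝 0] fun _ => g 0 := by
    filter_upwards [hmin] with t ht using le_antisymm (hg t) ht
  have h0 := (heq.deriv).deriv_eq
  rw [h0] at h
  simp at h

theorem adjOp_nonpos_of_max (E : Euc d → Euc d) {φ : Euc d → ℝ} (hφ : ContDiff ℝ ∞ φ) {x : Euc d}
    (hx : ∀ y, φ y ≤ φ x) : adjOp E φ x ≤ 0 := by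
  have h0 : fderiv ℝ φ x = 0 := (show IsLocalMax φ x from Eventually.of_forall hx).fderiv_eq_zero
  have h1 : laplSum φ x ≤ 0 := by
    apply Finset.sum_nonpos
    intro i _
    set e : Euc d := EuclideanSpace.single i 1
    have hl : ∀ t : ℝ, HasDerivAt (fun t : ℝ => x + t • e) e t := by
      intro t
      simpa using ((hasDerivAt_id t).smul_const e).const_add x
    have d1 : deriv (fun t : ℝ => φ (x + t • e)) = fun t => fderiv ℝ φ (x + t • e) e := by
      funext t
      exact (((hφ.differentiable (by simp) _).hasFDerivAt).comp_hasDerivAt t (hl t)).deriv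
    have d2 : deriv (fun t : ℝ => fderiv ℝ φ (x + t • e) e) 0
        = fderiv ℝ (fun y => fderiv ℝ φ y e) x e := by
      have := ((((contDiff_fderiv_apply hφ e).differentiable (by simp)
        (x + (0 : ℝ) • e)).hasFDerivAt).comp_hasDerivAt (0 : ℝ) (hl 0)).deriv
      simpa [Function.comp_def] using this
    rw [← d2, ← d1]
    apply deriv_deriv_nonpos_of_max
    · exact (hφ.continuous.comp (by fun_prop)).continuousAt
    · intro t
      simpa using hx _
  simp [adjOp, h0, h1]

/-- The polynomial Lyapunov function `(1+|x|²)^(n+2)`. -/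
def lyap (n : ℕ) (x : Euc d) : ℝ := (1 + ‖x‖ ^ 2) ^ (n + 2)

theorem contDiff_lyap (n : ℕ) : ContDiff ℝ ∞ (lyap n : Euc d → ℝ) :=
  (contDiff_const.add (contDiff_id.norm_sq ℝ)).pow _

theorem adjOp_lyap (E : Euc d → Euc d) (n : ℕ) (x : Euc d) :
    adjOp E (lyap n) x = 4 * ‖x‖ ^ 2 * ((n + 2) * (n + 1) * (1 + ‖x‖ ^ 2) ^ n)
      + 2 * d * ((n + 2) * (1 + ‖x‖ ^ 2) ^ (n + 1))
      - 2 * ((n + 2) * (1 + ‖x‖ ^ 2) ^ (n + 1)) * ⟪x, E x⟫ := by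
  have e : (lyap n : Euc d → ℝ) = fun y => (fun s : ℝ => (1 + s) ^ (n + 2)) (‖y - 0‖ ^ 2) := by
    funext y; simp [lyap]
  have h1 : ∀ s : ℝ, HasDerivAt (fun s : ℝ => (1 + s) ^ (n + 2)) ((n + 2) * (1 + s) ^ (n + 1)) s := by
    intro s
    have := ((hasDerivAt_id s).const_add 1).fun_pow (n + 2)
    simpa using this
  have h2 : ∀ s : ℝ, HasDerivAt (fun s : ℝ => ((n : ℝ) + 2) * (1 + s) ^ (n + 1))
      ((n + 2) * (n + 1) * (1 + s) ^ n) s := by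
    intro s
    have := (((hasDerivAt_id s).const_add 1).fun_pow (n + 1)).const_mul ((n : ℝ) + 2)
    simpa [mul_assoc] using this
  rw [adjOp, e, laplSum_radial 0 x (fun s _ => h1 s) (fun s _ => h2 s),
    fderiv_radial 0 x (E x) (h1 _)]
  simp

theorem exists_lyap_bound {E : Euc d → Euc d} (hE : Continuous E)
    (hco : ∀ K : ℝ, ∃ R : ℝ, ∀ x, R ≤ ‖x‖ → K ≤ ⟪x, E x⟫) (n : ℕ) :
    ∃ C : ℝ, ∀ x, (1 + ‖x‖ ^ 2) ^ (n + 1) ≤ C - adjOp E (lyap n) x := by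
  obtain ⟨R, hR⟩ := hco (2 * (n + 1) + d + 1)
  have hcont : Continuous fun x : Euc d => (1 + ‖x‖ ^ 2) ^ (n + 1) + adjOp E (lyap n) x :=
    ((continuous_const.add (continuous_norm.pow 2)).pow _).add (continuous_adjOp hE (contDiff_lyap n))
  obtain ⟨C, hC⟩ := (isCompact_closedBall (0 : Euc d) R).bddAbove_image hcont.continuousOn
  refine ⟨max C 0, fun x => ?_⟩
  by_cases hx : ‖x‖ ≤ R
  · have := hC ⟨x, by simpa using hx, rfl⟩
    simp only at this
    linarith [le_max_left C 0]
  · have h1 := hR x (not_le.1 hx).le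
    have h2 := le_max_right C 0
    rw [adjOp_lyap]
    have hp : 0 < (1 + ‖x‖ ^ 2) ^ n := by positivity
    have hp1 : (1 + ‖x‖ ^ 2) ^ (n + 1) = (1 + ‖x‖ ^ 2) ^ n * (1 + ‖x‖ ^ 2) := pow_succ _ _
    have hp2 : 0 < (1 + ‖x‖ ^ 2) ^ (n + 1) := by positivity
    have h3 : 0 ≤ ((n : ℝ) + 2) * (1 + ‖x‖ ^ 2) ^ (n + 1) * (⟪x, E x⟫ - (2 * (n + 1) + d + 1)) := by
      apply mul_nonneg (by positivity); linarith
    have h4 : 4 * ‖x‖ ^ 2 * (((n : ℝ) + 2) * (n + 1) * (1 + ‖x‖ ^ 2) ^ n)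
        ≤ 4 * (((n : ℝ) + 2) * (n + 1) * (1 + ‖x‖ ^ 2) ^ (n + 1)) := by
      rw [hp1]
      have : 0 ≤ ((n : ℝ) + 2) * (n + 1) * (1 + ‖x‖ ^ 2) ^ n := by positivity
      nlinarith
    have h5 : 0 ≤ (n : ℝ) * (1 + ‖x‖ ^ 2) ^ (n + 1) := by positivity
    nlinarith

theorem tendsto_lyap_cocompact (n : ℕ) :
    Tendsto (fun x : Euc d => (1 + ‖x‖ ^ 2) ^ (n + 1)) (cocompact (Euc d)) atTop := by
  have h := tendsto_norm_cocompact_atTop (E := Euc d)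
  refine tendsto_atTop_mono (fun x => ?_) h
  have h1 : (1 : ℝ) ≤ 1 + ‖x‖ ^ 2 := by nlinarith [sq_nonneg ‖x‖]
  calc ‖x‖ ≤ 1 + ‖x‖ ^ 2 := by nlinarith [sq_nonneg (‖x‖ - 1)]
    _ ≤ (1 + ‖x‖ ^ 2) ^ (n + 1) := le_self_pow₀ h1 (by simp)

theorem const_nonneg_of_add_adjOp_nonneg (hd : 1 ≤ d) {E : Euc d → Euc d} (hE : Continuous E)
    (hco : ∀ K : ℝ, ∃ R : ℝ, ∀ x, R ≤ ‖x‖ → K ≤ ⟪x, E x⟫) (n : ℕ) {a c : ℝ} {φ : Euc d → ℝ}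
    (hφ : ContDiff ℝ ∞ φ) (hs : HasCompactSupport (φ - a • lyap n))
    (h : ∀ x, 0 ≤ c + adjOp E φ x) : 0 ≤ c := by
  have : Nonempty (Fin d) := ⟨⟨0, hd⟩⟩
  have hout : ∀ᶠ x in cocompact (Euc d), x ∉ tsupport (φ - a • lyap n) :=
    hs.isCompact.compl_mem_cocompact
  rcases le_or_gt a 0 with ha | ha
  · obtain ⟨x, hx⟩ : ∃ x, ∀ y, φ y ≤ φ x := by
      rcases ha.eq_or_lt with rfl | ha
      · simp only [zero_smul, sub_zero] at hs
        exact hφ.continuous.exists_forall_ge_of_hasCompactSupport hs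
      · apply hφ.continuous.exists_forall_ge' 0
        have ht := tendsto_lyap_cocompact (d := d) (n + 1)
        filter_upwards [hout, ht.eventually_ge_atTop (φ 0 / a)] with x hx hx'
        have h1 : φ x - a * lyap n x = 0 := by
          have := image_eq_zero_of_notMem_tsupport hx
          simpa using this
        have h2 : a * (φ 0 / a) = φ 0 := mul_div_cancel₀ _ ha.ne
        have h3 : φ 0 / a ≤ lyap n x := hx'
        nlinarith
    linarith [h x, adjOp_nonpos_of_max E hφ hx]
  · exfalso
    obtain ⟨C, hC⟩ := exists_lyap_bound hE hco n
    have ht := tendsto_lyap_cocompact (d := d) n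
    obtain ⟨x, hx, hx'⟩ := (hout.and (ht.eventually_gt_atTop (C + c / a))).exists
    have e1 : adjOp E φ x = adjOp E (φ - a • lyap n) x + a * adjOp E (lyap n) x := by
      have h1 : adjOp E (φ - a • lyap n + a • lyap n)
          = adjOp E (φ - a • lyap n) + adjOp E (a • lyap n) :=
        adjOp_add E (hφ.sub ((contDiff_lyap n).const_smul a)) ((contDiff_lyap n).const_smul a)
      rw [sub_add_cancel, adjOp_smul E a (contDiff_lyap n)] at h1
      rw [h1]
      simp
    have e2 : adjOp E (φ - a • lyap n) x = 0 :=
      image_eq_zero_of_notMem_tsupport fun h => hx (tsupport_adjOp_subset E _ h)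
    have h1 := hC x
    have h2 := h x
    rw [e1, e2, zero_add] at h2
    have h3 : a * (c / a) = c := by field_simp
    nlinarith

/-- Smooth functions which agree with a multiple of the Lyapunov function off a compact set. -/
def lyapSpace (d n : ℕ) : Submodule ℝ (Euc d → ℝ) where
  carrier := {φ | ContDiff ℝ ∞ φ ∧ ∃ a : ℝ, HasCompactSupport (φ - a • lyap n)}
  add_mem' := by
    rintro φ ψ ⟨h1, a, ha⟩ ⟨h2, b, hb⟩
    refine ⟨h1.add h2, a + b, ?_⟩
    have : φ + ψ - (a + b) • lyap n = (φ - a • lyap n) + (ψ - b • lyap n) := by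
      rw [add_smul]; abel
    rw [this]
    exact ha.add hb
  zero_mem' := ⟨contDiff_const, 0, by simpa using HasCompactSupport.zero⟩
  smul_mem' := by
    rintro c φ ⟨h1, a, ha⟩
    refine ⟨h1.const_smul c, c * a, ?_⟩
    have : c • φ - (c * a) • lyap n = (fun _ : Euc d => c) * (φ - a • lyap n) := by
      funext x
      simp only [Pi.sub_apply, Pi.smul_apply, Pi.mul_apply, smul_eq_mul]
      ring
    rw [this]
    exact ha.mul_left

/-- The positive functional obtained by extending `c + adjOp E φ ↦ c`. -/
theorem exists_functional (hd : 1 ≤ d) {E : Euc d → Euc d} (hE : Continuous E)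
    (hco : ∀ K : ℝ, ∃ R : ℝ, ∀ x, R ≤ ‖x‖ → K ≤ ⟪x, E x⟫) (n : ℕ) :
    ∃ Λ : C_c(Euc d, ℝ) →ₗ[ℝ] ℝ, ∀ (c : ℝ) (φ : lyapSpace d n) (f : C_c(Euc d, ℝ)),
      (∀ x, 0 ≤ c + adjOp E φ x + f x) → 0 ≤ c + Λ f := by
  let s : PointedCone ℝ ((ℝ × lyapSpace d n) × C_c(Euc d, ℝ)) :=
    { carrier := {p | ∀ x, 0 ≤ p.1.1 + adjOp E p.1.2 x + p.2 x}
      add_mem' := by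
        rintro ⟨⟨c, φ⟩, f⟩ ⟨⟨c', φ'⟩, f'⟩ h h' x
        have h1 : 0 ≤ c + adjOp E φ x + f x := h x
        have h2 : 0 ≤ c' + adjOp E φ' x + f' x := h' x
        have h3 := congrFun (adjOp_add E φ.2.1 φ'.2.1) x
        change 0 ≤ (c + c') + adjOp E ((φ : Euc d → ℝ) + φ') x + (f x + f' x)
        rw [h3, Pi.add_apply]
        linarith
      zero_mem' := by
        intro x
        have h3 := congrFun (adjOp_smul E 0 (φ := 0) contDiff_const) x
        simp only [smul_zero, zero_smul] at h3
        simp only [Prod.fst_zero, Prod.snd_zero, Submodule.coe_zero, h3]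
        simp
      smul_mem' := by
        rintro ⟨t, ht⟩ ⟨⟨c, φ⟩, f⟩ h x
        have h1 := mul_nonneg ht (h x)
        have h3 := congrFun (adjOp_smul E t φ.2.1) x
        change 0 ≤ t * c + adjOp E (t • (φ : Euc d → ℝ)) x + t * f x
        rw [h3]
        simp only [Pi.smul_apply, smul_eq_mul] at h1 ⊢
        linarith }
  let ℓ : ((ℝ × lyapSpace d n) × C_c(Euc d, ℝ)) →ₗ.[ℝ] ℝ :=
    { domain := Submodule.prod ⊤ ⊥
      toFun := (LinearMap.fst ℝ ℝ (lyapSpace d n)) ∘ₗ (LinearMap.fst ℝ _ _) ∘ₗ Submodule.subtype _ }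
  obtain ⟨g, hg, hgs⟩ := riesz_extension s ℓ (by
      rintro ⟨⟨⟨c, φ⟩, f⟩, hm⟩ h
      obtain rfl : f = 0 := by simpa using hm.2
      obtain ⟨h1, a, ha⟩ := φ.2
      refine const_nonneg_of_add_adjOp_nonneg hd hE hco n (c := c) h1 ha fun x => ?_
      have h2 : 0 ≤ c + adjOp E φ x + (0 : C_c(Euc d, ℝ)) x := h x
      simpa using h2) (by
      rintro ⟨p, f⟩
      obtain ⟨x0, hx0⟩ := f.continuous.exists_forall_le_of_hasCompactSupport f.hasCompactSupport
      refine ⟨⟨(-p + (-f x0, 0), 0), trivial, rfl⟩, ?_⟩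
      have h3 : ∀ x, adjOp E (0 : Euc d → ℝ) x = 0 := fun x => by
        simpa using congrFun (adjOp_smul E 0 (φ := 0) contDiff_const) x
      have e : ((-p + (-f x0, 0), 0) + (p, f) : (ℝ × lyapSpace d n) × C_c(Euc d, ℝ))
          = ((-f x0, 0), f) := by
        rw [Prod.mk_add_mk, zero_add]
        congr 1
        abel
      change ((-p + (-f x0, 0), 0) + (p, f) : (ℝ × lyapSpace d n) × C_c(Euc d, ℝ)) ∈ s
      rw [e]
      intro x
      change 0 ≤ -f x0 + adjOp E (0 : Euc d → ℝ) x + f x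
      have : f x0 ≤ f x := hx0 x
      rw [h3]
      linarith)
  refine ⟨g ∘ₗ LinearMap.inr ℝ _ _, fun c φ f h => ?_⟩
  have h1 := hgs ((c, φ), f) h
  have h2 := hg ⟨((c, φ), 0), trivial, rfl⟩
  have h3 : (((c, φ), f) : (ℝ × lyapSpace d n) × C_c(Euc d, ℝ)) = ((c, φ), 0) + (0, f) := by
    rw [Prod.mk_add_mk, zero_add, add_zero]
  rw [h3, map_add] at h1
  change g ((c, φ), 0) = c at h2
  rw [h2] at h1
  exact h1

/-- A continuous cutoff, equal to one on the ball of radius `R`. -/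
def tentCutoff (R : ℝ) (x : Euc d) : ℝ := max 0 (min 1 (R + 1 - ‖x‖))

theorem continuous_tentCutoff (R : ℝ) : Continuous (tentCutoff R : Euc d → ℝ) := by
  unfold tentCutoff
  fun_prop

theorem tentCutoff_nonneg (R : ℝ) (x : Euc d) : 0 ≤ tentCutoff R x := le_max_left _ _

theorem tentCutoff_le_one (R : ℝ) (x : Euc d) : tentCutoff R x ≤ 1 :=
  max_le zero_le_one (min_le_left _ _)

theorem tentCutoff_eq_one {R : ℝ} {x : Euc d} (h : ‖x‖ ≤ R) : tentCutoff R x = 1 := by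
  unfold tentCutoff
  rw [min_eq_left (by linarith), max_eq_right zero_le_one]

theorem hasCompactSupport_tentCutoff (R : ℝ) :
    HasCompactSupport (tentCutoff R : Euc d → ℝ) := by
  refine HasCompactSupport.intro (isCompact_closedBall (0 : Euc d) (R + 1)) fun x hx => ?_
  have : R + 1 < ‖x‖ := by simpa using hx
  unfold tentCutoff
  exact max_eq_left ((min_le_right _ _).trans (by linarith))

theorem exists_invariant_measure (hd : 1 ≤ d) {E : Euc d → Euc d} (hE : Continuous E)
    (hco : ∀ K : ℝ, ∃ R : ℝ, ∀ x, R ≤ ‖x‖ → K ≤ ⟪x, E x⟫) (n : ℕ) :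
    ∃ μ : Measure (Euc d), IsProbabilityMeasure μ ∧
      Integrable (fun x => (1 + ‖x‖ ^ 2) ^ (n + 1)) μ ∧
      ∀ φ : Euc d → ℝ, ContDiff ℝ ∞ φ → HasCompactSupport φ → ∫ x, adjOp E φ x ∂μ = 0 := by
  obtain ⟨Λ, hΛ⟩ := exists_functional hd hE hco n
  obtain ⟨C, hC⟩ := exists_lyap_bound hE hco n
  have hzero : ∀ x, adjOp E ((0 : lyapSpace d n) : Euc d → ℝ) x = 0 := fun x => by
    simpa using congrFun (adjOp_smul E 0 (φ := 0) contDiff_const) x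
  have hpos : ∀ f : C_c(Euc d, ℝ), 0 ≤ f → 0 ≤ Λ f := fun f hf => by
    have := hΛ 0 0 f (fun x => by rw [hzero]; simpa using hf x)
    simpa using this
  let L : C_c(Euc d, ℝ) →ₚ[ℝ] ℝ := PositiveLinearMap.mk₀ Λ hpos
  have hL : ∀ f, ∫ x, f x ∂(RealRMK.rieszMeasure L) = Λ f := RealRMK.integral_rieszMeasure L
  let lyapS : ℝ → lyapSpace d n := fun a => ⟨a • lyap n, (contDiff_lyap n).const_smul a, a, by
    simpa using HasCompactSupport.zero⟩
  have hlS : ∀ a x, adjOp E (lyapS a : Euc d → ℝ) x = a * adjOp E (lyap n) x := fun a x => by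
    simpa using congrFun (adjOp_smul E a (contDiff_lyap n)) x
  have hmom : ∀ f : C_c(Euc d, ℝ), (∀ x, f x ≤ (1 + ‖x‖ ^ 2) ^ (n + 1)) → Λ f ≤ C := by
    intro f hf
    have := hΛ C (lyapS (-1)) (-f) (fun x => by
      rw [hlS]
      have h1 := hC x
      have h2 := hf x
      simp only [CompactlySupportedContinuousMap.coe_neg, Pi.neg_apply]
      linarith)
    rw [map_neg] at this
    linarith
  have hone : ∀ f : C_c(Euc d, ℝ), (∀ x, f x ≤ 1) → Λ f ≤ 1 := by
    intro f hf
    have := hΛ 1 0 (-f) (fun x => by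
      rw [hzero]
      have h2 := hf x
      simp only [CompactlySupportedContinuousMap.coe_neg, Pi.neg_apply]
      linarith)
    rw [map_neg] at this
    linarith
  set μ := RealRMK.rieszMeasure L with hμ
  let W : Euc d → ℝ := fun x => (1 + ‖x‖ ^ 2) ^ (n + 1)
  have hWc : Continuous W := by fun_prop
  have hW1 : ∀ x, 1 + ‖x‖ ^ 2 ≤ W x := fun x =>
    le_self_pow₀ (by nlinarith [sq_nonneg ‖x‖]) (by simp)
  have hW0 : ∀ x, 0 ≤ W x := fun x => by positivity
  let T : ℕ → C_c(Euc d, ℝ) := fun j =>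
    ⟨⟨tentCutoff j, continuous_tentCutoff _⟩, hasCompactSupport_tentCutoff _⟩
  let TW : ℕ → C_c(Euc d, ℝ) := fun j =>
    ⟨⟨fun x => tentCutoff j x * W x, (continuous_tentCutoff _).mul hWc⟩,
      (hasCompactSupport_tentCutoff (j : ℝ)).mul_right⟩
  have hWint : Integrable W μ := by
    refine (aecover_closedBall (x := (0 : Euc d)) tendsto_natCast_atTop_atTop
      ).integrable_of_integral_norm_bounded C (fun j =>
        hWc.locallyIntegrable.integrableOn_isCompact (isCompact_closedBall _ _)) ?_
    refine Eventually.of_forall fun j => ?_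
    calc ∫ x in closedBall 0 (j : ℝ), ‖W x‖ ∂μ
        = ∫ x in closedBall 0 (j : ℝ), TW j x ∂μ := by
          refine setIntegral_congr_fun measurableSet_closedBall fun x hx => ?_
          have : ‖x‖ ≤ j := by simpa using hx
          change ‖W x‖ = tentCutoff j x * W x
          rw [tentCutoff_eq_one this, one_mul, Real.norm_of_nonneg (hW0 x)]
      _ ≤ ∫ x, TW j x ∂μ := by
          refine setIntegral_le_integral
            ((TW j).continuous.integrable_of_hasCompactSupport (TW j).hasCompactSupport)
            (Eventually.of_forall fun x => mul_nonneg (tentCutoff_nonneg _ _) (hW0 x))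
      _ = Λ (TW j) := hL _
      _ ≤ C := hmom _ fun x => mul_le_of_le_one_left (hW0 x) (tentCutoff_le_one _ _)
  have hfin : Integrable (fun _ : Euc d => (1 : ℝ)) μ := by
    refine hWint.mono' aestronglyMeasurable_const (Eventually.of_forall fun x => ?_)
    simpa using (le_add_of_nonneg_right (sq_nonneg ‖x‖)).trans (hW1 x)
  have hfin' : IsFiniteMeasure μ := by
    rcases integrable_const_iff.1 hfin with h | h
    · exact absurd h one_ne_zero
    · exact h
  have hlim : Tendsto (fun j => Λ (T j)) atTop (𝓝 (∫ _, (1 : ℝ) ∂μ)) := by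
    simp_rw [← hL]
    refine tendsto_integral_of_dominated_convergence (fun _ => 1)
      (fun j => (T j).continuous.aestronglyMeasurable) hfin
      (fun j => Eventually.of_forall fun x => ?_) (Eventually.of_forall fun x => ?_)
    · change ‖tentCutoff j x‖ ≤ 1
      rw [Real.norm_of_nonneg (tentCutoff_nonneg _ _)]
      exact tentCutoff_le_one _ _
    · refine tendsto_const_nhds.congr' ?_
      filter_upwards [eventually_ge_atTop ⌈‖x‖⌉₊] with j hj
      exact (tentCutoff_eq_one (Nat.ceil_le.1 hj)).symm
  have hlow : ∀ j : ℕ, 1 - C / (1 + (j : ℝ) ^ 2) ≤ Λ (T j) := fun j => by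
    have hN : (0 : ℝ) < 1 + (j : ℝ) ^ 2 := by positivity
    have := hΛ (C / (1 + (j : ℝ) ^ 2) - 1) (lyapS (-(1 + (j : ℝ) ^ 2)⁻¹)) (T j) (fun x => by
      rw [hlS]
      have h1 : W x ≤ C - adjOp E (lyap n) x := hC x
      have h2 : 1 ≤ W x * (1 + (j : ℝ) ^ 2)⁻¹ + tentCutoff j x := by
        rcases le_or_gt ‖x‖ j with h | h
        · rw [tentCutoff_eq_one h]
          have := mul_nonneg (hW0 x) (inv_nonneg.2 hN.le)
          linarith
        · have h3 : 1 + (j : ℝ) ^ 2 ≤ W x := by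
            refine le_trans ?_ (hW1 x)
            gcongr
          have h4 := mul_le_mul_of_nonneg_right h3 (inv_nonneg.2 hN.le)
          rw [mul_inv_cancel₀ hN.ne'] at h4
          have := tentCutoff_nonneg j x
          linarith
      have h3 := mul_le_mul_of_nonneg_right h1 (inv_nonneg.2 hN.le)
      change 0 ≤ C / (1 + (j : ℝ) ^ 2) - 1 + -(1 + (j : ℝ) ^ 2)⁻¹ * adjOp E (lyap n) x
        + tentCutoff j x
      rw [div_eq_mul_inv]
      linarith)
    linarith
  refine ⟨μ, ⟨?_⟩, hWint, fun φ hφ hs => ?_⟩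
  · have h1 : ∫ _, (1 : ℝ) ∂μ ≤ 1 :=
      le_of_tendsto' hlim fun j => hone _ fun x => tentCutoff_le_one _ _
    have h2 : 1 ≤ ∫ _, (1 : ℝ) ∂μ := by
      have ht : Tendsto (fun j : ℕ => 1 - C / (1 + (j : ℝ) ^ 2)) atTop (𝓝 (1 - 0)) := by
        refine tendsto_const_nhds.sub (Tendsto.div_atTop tendsto_const_nhds ?_)
        refine tendsto_atTop_add_const_left _ _ ?_
        exact (tendsto_pow_atTop two_ne_zero).comp tendsto_natCast_atTop_atTop
      rw [sub_zero] at ht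
      exact le_of_tendsto_of_tendsto' ht hlim hlow
    have h3 := le_antisymm h1 h2
    simp only [integral_const, smul_eq_mul, mul_one] at h3
    rw [measureReal_def, ENNReal.toReal_eq_one_iff] at h3
    exact h3
  · have hAc : Continuous (adjOp E φ) := continuous_adjOp hE hφ
    have hAs : HasCompactSupport (adjOp E φ) :=
      hs.mono' ((subset_tsupport _).trans (tsupport_adjOp_subset E φ))
    let A : C_c(Euc d, ℝ) := ⟨⟨adjOp E φ, hAc⟩, hAs⟩
    have key : ∀ t : ℝ, 0 ≤ Λ (t • A) := fun t => by
      have := hΛ 0 ⟨(-t) • φ, hφ.const_smul (-t), 0, by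
        rw [zero_smul, sub_zero]
        exact HasCompactSupport.mul_left (f := fun _ => -t) hs⟩ (t • A) (fun x => by
          have := congrFun (adjOp_smul E (-t) hφ) x
          simp only at this ⊢
          rw [this]
          change 0 ≤ 0 + -t * adjOp E φ x + t * adjOp E φ x
          linarith)
      simpa using this
    have h1 := key 1
    have h2 := key (-1)
    rw [map_smul] at h1 h2
    change ∫ x, A x ∂μ = 0
    rw [hL]
    simp only [smul_eq_mul] at h1 h2
    linarith

/-- A smooth nonincreasing cutoff on the line, `1` on `(-∞, 1/2]` and `0` on `[1, ∞)`. -/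
def cut (s : ℝ) : ℝ := Real.smoothTransition (2 - 2 * s)

theorem contDiff_cut : ContDiff ℝ ∞ cut := by
  unfold cut
  exact Real.smoothTransition.contDiff.comp (contDiff_const.sub (contDiff_const.mul contDiff_id))

theorem cut_nonneg (s : ℝ) : 0 ≤ cut s := Real.smoothTransition.nonneg _

theorem cut_le_one (s : ℝ) : cut s ≤ 1 := Real.smoothTransition.le_one _

theorem cut_eq_one {s : ℝ} (h : s ≤ 1 / 2) : cut s = 1 :=
  Real.smoothTransition.one_of_one_le (by linarith)

theorem cut_eq_zero {s : ℝ} (h : 1 ≤ s) : cut s = 0 :=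
  Real.smoothTransition.zero_of_nonpos (by linarith)

theorem continuous_cut : Continuous cut := contDiff_cut.continuous

theorem hasDerivAt_cut (s : ℝ) : HasDerivAt cut (deriv cut s) s :=
  ((contDiff_cut.differentiable (by simp)) s).hasDerivAt

theorem continuous_deriv_cut : Continuous (deriv cut) :=
  contDiff_cut.continuous_deriv (by simp)

theorem antitone_cut : Antitone cut := fun a b h =>
  Real.smoothTransition.monotone (by linarith)

theorem deriv_cut_nonpos (s : ℝ) : deriv cut s ≤ 0 := antitone_cut.deriv_nonpos

theorem deriv_cut_eq_zero_of_le {s : ℝ} (h : s ≤ 1 / 2) : deriv cut s = 0 := by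
  refine IsLocalMax.deriv_eq_zero (Eventually.of_forall fun t => ?_)
  rw [cut_eq_one h]
  exact cut_le_one t

theorem deriv_cut_eq_zero_of_ge {s : ℝ} (h : 1 ≤ s) : deriv cut s = 0 := by
  refine IsLocalMin.deriv_eq_zero (Eventually.of_forall fun t => ?_)
  rw [cut_eq_zero h]
  exact cut_nonneg t

theorem exists_deriv_cut_bound : ∃ C, 0 < C ∧ ∀ s, |deriv cut s| ≤ C := by
  obtain ⟨C, hC⟩ := (isCompact_Icc (a := (0 : ℝ)) (b := 1)).exists_bound_of_continuousOn
    continuous_deriv_cut.continuousOn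
  refine ⟨max C 1, by positivity, fun s => ?_⟩
  by_cases h1 : s ≤ 1 / 2
  · rw [deriv_cut_eq_zero_of_le h1]; simp
  by_cases h2 : 1 ≤ s
  · rw [deriv_cut_eq_zero_of_ge h2]; simp
  · push Not at h1 h2
    exact (hC s ⟨by linarith, h2.le⟩).trans (le_max_left _ _)

theorem exists_deriv_cut_neg : ∃ s, 1 / 2 < s ∧ s < 1 ∧ deriv cut s < 0 := by
  obtain ⟨c, hc, h⟩ := exists_deriv_eq_slope cut (a := 1 / 2) (b := 1) (by norm_num)
    continuous_cut.continuousOn (fun s _ => (hasDerivAt_cut s).differentiableAt.differentiableWithinAt)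
  refine ⟨c, hc.1, hc.2, ?_⟩
  rw [h, cut_eq_one le_rfl, cut_eq_zero le_rfl]
  norm_num

/-- Regularised powers of the distance give explicit test functions. -/
theorem exists_kernel_test (E : Euc d → Euc d) (x0 : Euc d) {r ε : ℝ} (hr : 0 < r) (hε : 0 < ε)
    (θ : ℝ) : ∃ φ : Euc d → ℝ, ContDiff ℝ ∞ φ ∧ tsupport φ ⊆ closedBall x0 r ∧
      ∀ x, adjOp E φ x =
        ((4 * θ - 2 * d) * (‖x - x0‖ ^ 2 + ε) ^ (-θ)
            - 4 * θ * ε * (‖x - x0‖ ^ 2 + ε) ^ (-θ - 1)) * cut (‖x - x0‖ ^ 2 / r ^ 2)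
          - 4 * ‖x - x0‖ ^ 2 * (‖x - x0‖ ^ 2 + ε) ^ (-θ) * (deriv cut (‖x - x0‖ ^ 2 / r ^ 2) / r ^ 2)
          + 2 * (‖x - x0‖ ^ 2 + ε) ^ (-θ) * cut (‖x - x0‖ ^ 2 / r ^ 2) * ⟪x - x0, E x⟫ := by
  have hr2 : 0 < r ^ 2 := by positivity
  obtain ⟨φ, h1, h2, h3, h4⟩ := exists_radial_test (d := d) x0 (a := -ε) (ρ := r)
    (q := fun s => (s + ε) ^ (-θ) * cut (s / r ^ 2))
    (q' := fun s => -θ * (s + ε) ^ (-θ - 1) * cut (s / r ^ 2)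
      + (s + ε) ^ (-θ) * (deriv cut (s / r ^ 2) / r ^ 2)) (by linarith) hr
    (by
      refine ContDiffOn.mul ?_ (contDiff_cut.comp (contDiff_id.div_const _)).contDiffOn
      refine ContDiffOn.rpow_const_of_ne (contDiff_id.add contDiff_const).contDiffOn ?_
      intro s hs
      have : -ε < s := hs
      exact (by linarith : (0 : ℝ) < s + ε).ne')
    (fun s hs => by
      have : 1 ≤ s / r ^ 2 := by rwa [one_le_div hr2]
      simp [cut_eq_zero this])
    (fun s hs => by
      have hP : s + ε ≠ 0 := by positivity
      have e1 : HasDerivAt (fun s => (s + ε) ^ (-θ)) (-θ * (s + ε) ^ (-θ - 1)) s := by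
        simpa using ((hasDerivAt_id s).add_const ε).rpow_const (p := -θ) (Or.inl hP)
      have e2 : HasDerivAt (fun s => cut (s / r ^ 2)) (deriv cut (s / r ^ 2) / r ^ 2) s := by
        have := (hasDerivAt_cut (s / r ^ 2)).comp s ((hasDerivAt_id s).div_const (r ^ 2))
        rw [mul_one_div] at this
        exact this
      exact e1.mul e2)
  refine ⟨φ, h1, h2, fun x => ?_⟩
  unfold adjOp
  rw [h4, h3]
  have hP : 0 < ‖x - x0‖ ^ 2 + ε := by positivity
  have e : (‖x - x0‖ ^ 2 + ε) ^ (-θ) = (‖x - x0‖ ^ 2 + ε) ^ (-θ - 1) * (‖x - x0‖ ^ 2 + ε) := by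
    rw [← rpow_add_one hP.ne']; ring_nf
  simp only [e]
  ring

/-- The cutoff at scale `r`. -/
def cutR (r : ℝ) (z : Euc d) : ℝ := cut (‖z‖ ^ 2 / r ^ 2)

/-- Approximate identity produced by the Laplacian of the regularised fundamental solution. -/
def dker (ε r : ℝ) (z : Euc d) : ℝ := ε * (‖z‖ ^ 2 + ε) ^ (-(d : ℝ) / 2 - 1) * cutR r z

/-- Remainder produced by the cutoff. -/
def kker (ε r : ℝ) (z : Euc d) : ℝ :=
  -2 * ‖z‖ ^ 2 * (‖z‖ ^ 2 + ε) ^ (-(d : ℝ) / 2) * (deriv cut (‖z‖ ^ 2 / r ^ 2) / r ^ 2)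

/-- Regularised, truncated gradient of the fundamental solution. -/
def nker (ε r : ℝ) (z : Euc d) : Euc d := ((‖z‖ ^ 2 + ε) ^ (-(d : ℝ) / 2) * cutR r z) • z

/-- Majorant of the truncated gradient of the fundamental solution. -/
def jker (ε r : ℝ) (z : Euc d) : ℝ := (‖z‖ ^ 2 + ε) ^ (-((d : ℝ) - 1) / 2) * cutR r z

theorem cutR_nonneg (r : ℝ) (z : Euc d) : 0 ≤ cutR r z := cut_nonneg _

theorem cutR_le_one (r : ℝ) (z : Euc d) : cutR r z ≤ 1 := cut_le_one _

theorem continuous_cutR (r : ℝ) : Continuous (cutR r : Euc d → ℝ) := by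
  unfold cutR
  exact continuous_cut.comp (by fun_prop)

theorem one_le_div_sq {r : ℝ} (hr : 0 < r) {z : Euc d} (h : r ≤ ‖z‖) : 1 ≤ ‖z‖ ^ 2 / r ^ 2 := by
  rw [one_le_div (by positivity)]
  gcongr

theorem cutR_eq_zero {r : ℝ} (hr : 0 < r) {z : Euc d} (h : r ≤ ‖z‖) : cutR r z = 0 :=
  cut_eq_zero (one_le_div_sq hr h)

theorem continuous_add_rpow {ε : ℝ} (hε : 0 < ε) (θ : ℝ) :
    Continuous (fun z : Euc d => (‖z‖ ^ 2 + ε) ^ θ) := by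
  refine Continuous.rpow_const (by fun_prop) fun z => Or.inl ?_
  positivity

theorem hasCompactSupport_of_ball {F : Type*} [Zero F] {r : ℝ} {g : Euc d → F}
    (h : ∀ z, r ≤ ‖z‖ → g z = 0) : HasCompactSupport g := by
  refine HasCompactSupport.intro (isCompact_closedBall (0 : Euc d) r) fun z hz => h z ?_
  have : r < ‖z‖ := by simpa using hz
  exact this.le

theorem dker_eq_zero {ε r : ℝ} (hr : 0 < r) {z : Euc d} (h : r ≤ ‖z‖) : dker ε r z = 0 := by
  simp [dker, cutR_eq_zero hr h]

theorem kker_eq_zero {ε r : ℝ} (hr : 0 < r) {z : Euc d} (h : r ≤ ‖z‖) : kker ε r z = 0 := by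
  simp [kker, deriv_cut_eq_zero_of_ge (one_le_div_sq hr h)]

theorem nker_eq_zero {ε r : ℝ} (hr : 0 < r) {z : Euc d} (h : r ≤ ‖z‖) : nker ε r z = 0 := by
  simp [nker, cutR_eq_zero hr h]

theorem jker_eq_zero {ε r : ℝ} (hr : 0 < r) {z : Euc d} (h : r ≤ ‖z‖) : jker ε r z = 0 := by
  simp [jker, cutR_eq_zero hr h]

theorem continuous_dker {ε : ℝ} (hε : 0 < ε) (r : ℝ) : Continuous (dker ε r : Euc d → ℝ) :=
  (continuous_const.mul (continuous_add_rpow hε _)).mul (continuous_cutR r)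

theorem continuous_kker {ε : ℝ} (hε : 0 < ε) (r : ℝ) : Continuous (kker ε r : Euc d → ℝ) := by
  refine Continuous.mul (Continuous.mul (by fun_prop) (continuous_add_rpow hε _)) ?_
  exact (continuous_deriv_cut.comp (by fun_prop)).div_const _

theorem continuous_nker {ε : ℝ} (hε : 0 < ε) (r : ℝ) : Continuous (nker ε r : Euc d → Euc d) :=
  ((continuous_add_rpow hε _).mul (continuous_cutR r)).smul continuous_id

theorem continuous_jker {ε : ℝ} (hε : 0 < ε) (r : ℝ) : Continuous (jker ε r : Euc d → ℝ) :=
  (continuous_add_rpow hε _).mul (continuous_cutR r)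

theorem dker_nonneg {ε : ℝ} (hε : 0 < ε) (r : ℝ) (z : Euc d) : 0 ≤ dker ε r z := by
  have := cutR_nonneg r z
  unfold dker
  positivity

theorem jker_nonneg {ε : ℝ} (hε : 0 < ε) (r : ℝ) (z : Euc d) : 0 ≤ jker ε r z := by
  have := cutR_nonneg r z
  unfold jker
  positivity

theorem kker_nonneg {ε : ℝ} (hε : 0 ≤ ε) (r : ℝ) (z : Euc d) : 0 ≤ kker ε r z := by
  have h1 := deriv_cut_nonpos (‖z‖ ^ 2 / r ^ 2)
  have h2 : 0 ≤ -(deriv cut (‖z‖ ^ 2 / r ^ 2)) / r ^ 2 := by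
    refine div_nonneg (by linarith) (by positivity)
  have h3 : 0 ≤ 2 * ‖z‖ ^ 2 * (‖z‖ ^ 2 + ε) ^ (-(d : ℝ) / 2) := by positivity
  have := mul_nonneg h3 h2
  unfold kker
  rw [neg_div (r ^ 2)] at this
  linarith

theorem rpow_half_mul {ε : ℝ} (hε : 0 < ε) (z : Euc d) :
    (‖z‖ ^ 2 + ε) ^ (-((d : ℝ) - 1) / 2)
      = (‖z‖ ^ 2 + ε) ^ (-(d : ℝ) / 2) * √(‖z‖ ^ 2 + ε) := by
  rw [sqrt_eq_rpow, ← rpow_add (by positivity)]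
  ring_nf

theorem norm_nker_le {ε : ℝ} (hε : 0 < ε) (r : ℝ) (z : Euc d) : ‖nker ε r z‖ ≤ jker ε r z := by
  have h0 := cutR_nonneg r z
  have h1 : ‖z‖ ≤ √(‖z‖ ^ 2 + ε) := Real.le_sqrt_of_sq_le (by linarith)
  have h2 : 0 ≤ (‖z‖ ^ 2 + ε) ^ (-(d : ℝ) / 2) := by positivity
  unfold nker jker
  rw [norm_smul, Real.norm_of_nonneg (mul_nonneg h2 h0), rpow_half_mul hε]
  calc _ ≤ (‖z‖ ^ 2 + ε) ^ (-(d : ℝ) / 2) * cutR r z * √(‖z‖ ^ 2 + ε) := by gcongr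
    _ = _ := by ring

theorem exists_dker_test (E : Euc d → Euc d) (x0 : Euc d) {r ε : ℝ} (hr : 0 < r) (hε : 0 < ε) :
    ∃ φ : Euc d → ℝ, ContDiff ℝ ∞ φ ∧ tsupport φ ⊆ closedBall x0 r ∧
      ∀ x, adjOp E φ x = 2 * (-(d * dker ε r (x - x0)) + kker ε r (x - x0)
        + ⟪nker ε r (x - x0), E x⟫) := by
  obtain ⟨φ, h1, h2, h3⟩ := exists_kernel_test E x0 hr hε ((d : ℝ) / 2)
  refine ⟨φ, h1, h2, fun x => ?_⟩
  rw [h3, nker, inner_smul_left, dker, kker, cutR]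
  simp only [neg_div, RCLike.conj_to_real]
  ring

theorem exists_jker_test (E : Euc d → Euc d) (x0 : Euc d) {r ε : ℝ} (hr : 0 < r) (hε : 0 < ε) :
    ∃ φ : Euc d → ℝ, ContDiff ℝ ∞ φ ∧ tsupport φ ⊆ closedBall x0 r ∧
      ∀ x, adjOp E φ x = 2 * (-jker ε r (x - x0)
        - (d - 1) * (√(‖x - x0‖ ^ 2 + ε) * dker ε r (x - x0))
        + √(‖x - x0‖ ^ 2 + ε) * kker ε r (x - x0) + jker ε r (x - x0) * ⟪x - x0, E x⟫) := by
  obtain ⟨φ, h1, h2, h3⟩ := exists_kernel_test E x0 hr hε (((d : ℝ) - 1) / 2)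
  refine ⟨φ, h1, h2, fun x => ?_⟩
  have hP : 0 < ‖x - x0‖ ^ 2 + ε := by positivity
  have e := rpow_half_mul hε (x - x0)
  have e2 : (‖x - x0‖ ^ 2 + ε) ^ (-(((d : ℝ) - 1) / 2) - 1)
      = (‖x - x0‖ ^ 2 + ε) ^ (-(d : ℝ) / 2 - 1) * √(‖x - x0‖ ^ 2 + ε) := by
    rw [sqrt_eq_rpow, ← rpow_add hP]
    ring_nf
  rw [h3, dker, kker, jker, cutR, e2]
  rw [neg_div] at e
  simp only [neg_div, e]
  ring

theorem integrable_comp_sub {μ : Measure (Euc d)} [IsFiniteMeasureOnCompacts μ] {r : ℝ}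
    {g h : Euc d → ℝ} (hg : Continuous g) (hh : Continuous h) (hz : ∀ z, r ≤ ‖z‖ → g z = 0)
    (x0 : Euc d) : Integrable (fun x => g (x - x0) * h x) μ := by
  refine Continuous.integrable_of_hasCompactSupport (by fun_prop) ?_
  refine HasCompactSupport.intro (isCompact_closedBall x0 r) fun z hz' => ?_
  have : r < ‖z - x0‖ := by simpa [dist_eq_norm] using hz'
  simp [hz _ this.le]

theorem dker_bounds {μ : Measure (Euc d)} [IsFiniteMeasureOnCompacts μ] (hd : 1 ≤ d)
    {E : Euc d → Euc d} (hE : Continuous E) {x0 : Euc d} {M r ε : ℝ} (hM0 : 0 ≤ M)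
    (hM : ∀ x ∈ closedBall x0 r, ‖E x‖ ≤ M) (hr : 0 < r) (hMr : M * r ≤ 1 / 8) (hε : 0 < ε)
    (hεr : ε ≤ r ^ 2)
    (hμ : ∀ φ : Euc d → ℝ, ContDiff ℝ ∞ φ → tsupport φ ⊆ closedBall x0 r →
      ∫ x, adjOp E φ x ∂μ = 0) :
    (∫ x, kker ε r (x - x0) ∂μ) / 2 ≤ d * ∫ x, dker ε r (x - x0) ∂μ ∧
      d * ∫ x, dker ε r (x - x0) ∂μ ≤ 3 * ∫ x, kker ε r (x - x0) ∂μ := by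
  have hd1 : (1 : ℝ) ≤ d := by exact_mod_cast hd
  have hsq : Continuous fun x : Euc d => √(‖x - x0‖ ^ 2 + ε) := by fun_prop
  have hin : Continuous fun x : Euc d => ⟪x - x0, E x⟫ := by fun_prop
  have iK : Integrable (fun x => kker ε r (x - x0)) μ := by
    simpa using integrable_comp_sub (continuous_kker hε r) continuous_const
      (fun z => kker_eq_zero hr) x0 (h := fun _ => 1)
  have iD : Integrable (fun x => dker ε r (x - x0)) μ := by
    simpa using integrable_comp_sub (continuous_dker hε r) continuous_const
      (fun z => dker_eq_zero hr) x0 (h := fun _ => 1)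
  have iJ : Integrable (fun x => jker ε r (x - x0)) μ := by
    simpa using integrable_comp_sub (continuous_jker hε r) continuous_const
      (fun z => jker_eq_zero hr) x0 (h := fun _ => 1)
  have iK' : Integrable (fun x => √(‖x - x0‖ ^ 2 + ε) * kker ε r (x - x0)) μ := by
    simpa [mul_comm] using integrable_comp_sub (continuous_kker hε r) hsq
      (fun z => kker_eq_zero hr) x0
  have iD' : Integrable (fun x => √(‖x - x0‖ ^ 2 + ε) * dker ε r (x - x0)) μ := by
    simpa [mul_comm] using integrable_comp_sub (continuous_dker hε r) hsq
      (fun z => dker_eq_zero hr) x0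
  have iJ' : Integrable (fun x => jker ε r (x - x0) * ⟪x - x0, E x⟫) μ :=
    integrable_comp_sub (continuous_jker hε r) hin (fun z => jker_eq_zero hr) x0
  have iN : Integrable (fun x => ⟪nker ε r (x - x0), E x⟫) μ := by
    refine Continuous.integrable_of_hasCompactSupport
      (((continuous_nker hε r).comp (by fun_prop)).inner hE) ?_
    refine HasCompactSupport.intro (isCompact_closedBall x0 r) fun z hz' => ?_
    have : r < ‖z - x0‖ := by simpa [dist_eq_norm] using hz'
    simp [nker_eq_zero hr this.le]
  have I1 : -(d * ∫ x, dker ε r (x - x0) ∂μ) + ∫ x, kker ε r (x - x0) ∂μ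
      + ∫ x, ⟪nker ε r (x - x0), E x⟫ ∂μ = 0 := by
    obtain ⟨φ, h1, h2, h3⟩ := exists_dker_test E x0 hr hε
    have h := hμ φ h1 h2
    simp_rw [h3] at h
    have iDn : Integrable (fun x => -(d * dker ε r (x - x0))) μ := (iD.const_mul _).neg
    rw [integral_const_mul, integral_add (f := fun x => -(d * dker ε r (x - x0))
      + kker ε r (x - x0)) (iDn.add iK) iN, integral_add iDn iK, integral_neg, integral_const_mul] at h
    linarith
  have I2 : -(∫ x, jker ε r (x - x0) ∂μ)
      - (d - 1) * ∫ x, √(‖x - x0‖ ^ 2 + ε) * dker ε r (x - x0) ∂μ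
      + ∫ x, √(‖x - x0‖ ^ 2 + ε) * kker ε r (x - x0) ∂μ
      + ∫ x, jker ε r (x - x0) * ⟪x - x0, E x⟫ ∂μ = 0 := by
    obtain ⟨φ, h1, h2, h3⟩ := exists_jker_test E x0 hr hε
    have h := hμ φ h1 h2
    simp_rw [h3] at h
    have iJn : Integrable (fun x => -jker ε r (x - x0)) μ := iJ.neg
    rw [integral_const_mul, integral_add (f := fun x => -jker ε r (x - x0)
        - (d - 1) * (√(‖x - x0‖ ^ 2 + ε) * dker ε r (x - x0))
        + √(‖x - x0‖ ^ 2 + ε) * kker ε r (x - x0)) ((iJn.sub (iD'.const_mul _)).add iK') iJ',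
      integral_add (f := fun x => -jker ε r (x - x0)
        - (d - 1) * (√(‖x - x0‖ ^ 2 + ε) * dker ε r (x - x0))) (iJn.sub (iD'.const_mul _)) iK',
      integral_sub iJn (iD'.const_mul _), integral_neg, integral_const_mul] at h
    linarith
  have hJ0 : 0 ≤ ∫ x, jker ε r (x - x0) ∂μ := integral_nonneg fun x => jker_nonneg hε r _
  have hX0 : 0 ≤ ∫ x, √(‖x - x0‖ ^ 2 + ε) * dker ε r (x - x0) ∂μ :=
    integral_nonneg fun x => mul_nonneg (sqrt_nonneg _) (dker_nonneg hε r _)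
  have hN : |∫ x, ⟪nker ε r (x - x0), E x⟫ ∂μ| ≤ M * ∫ x, jker ε r (x - x0) ∂μ := by
    rw [← integral_const_mul, ← Real.norm_eq_abs]
    refine norm_integral_le_of_norm_le (iJ.const_mul M) (Eventually.of_forall fun x => ?_)
    rcases le_or_gt r ‖x - x0‖ with h | h
    · simp [nker_eq_zero hr h, jker_eq_zero hr h]
    · calc ‖⟪nker ε r (x - x0), E x⟫‖ ≤ ‖nker ε r (x - x0)‖ * ‖E x‖ := norm_inner_le_norm _ _
        _ ≤ jker ε r (x - x0) * M := by
          gcongr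
          · exact jker_nonneg hε r _
          · exact norm_nker_le hε r _
          · exact hM x (by simpa [dist_eq_norm] using h.le)
        _ = _ := mul_comm _ _
  have hZ : ∫ x, jker ε r (x - x0) * ⟪x - x0, E x⟫ ∂μ ≤ (1 / 8) * ∫ x, jker ε r (x - x0) ∂μ := by
    rw [← integral_const_mul]
    refine integral_mono iJ' (iJ.const_mul _) fun x => ?_
    rcases le_or_gt r ‖x - x0‖ with h | h
    · simp [jker_eq_zero hr h]
    · have h1 : ⟪x - x0, E x⟫ ≤ 1 / 8 := by
        calc ⟪x - x0, E x⟫ ≤ ‖x - x0‖ * ‖E x‖ := real_inner_le_norm _ _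
          _ ≤ r * M := by
            gcongr
            exact hM x (by simpa [dist_eq_norm] using h.le)
          _ ≤ 1 / 8 := by linarith
      have := mul_le_mul_of_nonneg_left h1 (jker_nonneg hε r (x - x0))
      change _ ≤ 1 / 8 * jker ε r (x - x0)
      linarith
  have hY : ∫ x, √(‖x - x0‖ ^ 2 + ε) * kker ε r (x - x0) ∂μ
      ≤ 2 * r * ∫ x, kker ε r (x - x0) ∂μ := by
    rw [← integral_const_mul]
    refine integral_mono iK' (iK.const_mul _) fun x => ?_
    rcases le_or_gt r ‖x - x0‖ with h | h
    · simp [kker_eq_zero hr h]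
    · refine mul_le_mul_of_nonneg_right ?_ (kker_nonneg hε.le r _)
      rw [sqrt_le_left (by positivity)]
      nlinarith [norm_nonneg (x - x0)]
  have hK0 : 0 ≤ ∫ x, kker ε r (x - x0) ∂μ := integral_nonneg fun x => kker_nonneg hε.le r _
  rw [abs_le] at hN
  have hX1 := mul_nonneg (sub_nonneg.2 hd1) hX0
  have hJK : (∫ x, jker ε r (x - x0) ∂μ) ≤ 16 / 7 * r * ∫ x, kker ε r (x - x0) ∂μ := by linarith
  have hMJ : M * ∫ x, jker ε r (x - x0) ∂μ ≤ 2 / 7 * ∫ x, kker ε r (x - x0) ∂μ := by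
    have h1 := mul_le_mul_of_nonneg_left hJK hM0
    have h2 := mul_le_mul_of_nonneg_right hMr hK0
    linarith
  constructor <;> linarith [hN.1, hN.2]

theorem exists_kker_bound (d : ℕ) {r : ℝ} (hr : 0 < r) :
    ∃ C, 0 < C ∧ ∀ ε, 0 ≤ ε → ∀ z : Euc d, kker ε r z ≤ C := by
  obtain ⟨C, hC0, hC⟩ := exists_deriv_cut_bound
  refine ⟨2 * r ^ 2 * (r ^ 2 / 2) ^ (-(d : ℝ) / 2) * (C / r ^ 2), by positivity, fun ε hε z => ?_⟩
  rcases le_or_gt r ‖z‖ with h | h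
  · rw [kker_eq_zero hr h]; positivity
  rcases le_or_gt (‖z‖ ^ 2 / r ^ 2) (1 / 2) with h2 | h2
  · simp only [kker, deriv_cut_eq_zero_of_le h2, zero_div, mul_zero]; positivity
  have h3 : r ^ 2 / 2 ≤ ‖z‖ ^ 2 := by
    rw [lt_div_iff₀ (by positivity)] at h2
    linarith
  have h4 : (‖z‖ ^ 2 + ε) ^ (-(d : ℝ) / 2) ≤ (r ^ 2 / 2) ^ (-(d : ℝ) / 2) := by
    refine rpow_le_rpow_of_nonpos (by positivity) (by linarith) ?_
    have : (0 : ℝ) ≤ d := by positivity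
    linarith
  have h5 : -deriv cut (‖z‖ ^ 2 / r ^ 2) ≤ C := (neg_le_abs _).trans (hC _)
  have h6 := deriv_cut_nonpos (‖z‖ ^ 2 / r ^ 2)
  calc kker ε r z = 2 * ‖z‖ ^ 2 * (‖z‖ ^ 2 + ε) ^ (-(d : ℝ) / 2)
        * (-deriv cut (‖z‖ ^ 2 / r ^ 2) / r ^ 2) := by unfold kker; ring
    _ ≤ _ := by
      gcongr
      exact div_nonneg (by linarith) (by positivity)

/-- The mass of the approximate identity. -/
def kappa (d : ℕ) : ℝ := ∫ w : Euc d, (1 + ‖w‖ ^ 2) ^ (-(d : ℝ) / 2 - 1)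

theorem integrable_kappa (d : ℕ) :
    Integrable (fun w : Euc d => (1 + ‖w‖ ^ 2) ^ (-(d : ℝ) / 2 - 1)) := by
  have := integrable_rpow_neg_one_add_norm_sq (E := Euc d) (μ := volume) (r := d + 2)
    (by simp)
  refine this.congr (Eventually.of_forall fun w => ?_)
  simp only
  ring_nf

theorem kappa_pos (d : ℕ) : 0 < kappa d := by
  unfold kappa
  refine (integral_pos_iff_support_of_nonneg (fun w => by positivity) (integrable_kappa d)).2 ?_
  have : Function.support (fun w : Euc d => (1 + ‖w‖ ^ 2) ^ (-(d : ℝ) / 2 - 1)) = univ := by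
    ext w
    simp only [Function.mem_support, mem_univ, iff_true]
    positivity
  rw [this]
  exact isOpen_univ.measure_pos volume univ_nonempty

theorem integral_dker_scaling {ε r : ℝ} (hε : 0 < ε) (g : Euc d → ℝ) (x0 : Euc d) :
    ∫ z, dker ε r z * g (x0 + z) = ∫ w : Euc d, (1 + ‖w‖ ^ 2) ^ (-(d : ℝ) / 2 - 1)
      * (cut (ε * ‖w‖ ^ 2 / r ^ 2) * g (x0 + √ε • w)) := by
  have hs : 0 < √ε := sqrt_pos.2 hε
  have h := Measure.integral_comp_smul (volume : Measure (Euc d))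
    (fun z => dker ε r z * g (x0 + z)) (√ε)
  rw [finrank_euclideanSpace_fin, abs_of_pos (by positivity)] at h
  have h2 : ∫ z, dker ε r z * g (x0 + z)
      = (√ε) ^ d * ∫ x : Euc d, dker ε r (√ε • x) * g (x0 + √ε • x) := by
    rw [h, smul_eq_mul, ← mul_assoc, mul_inv_cancel₀ (by positivity), one_mul]
  rw [h2, ← integral_const_mul]
  congr 1
  funext w
  have e1 : ‖√ε • w‖ ^ 2 = ε * ‖w‖ ^ 2 := by
    rw [norm_smul, mul_pow, Real.norm_of_nonneg hs.le, sq_sqrt hε.le]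
  have e2 : (ε * ‖w‖ ^ 2 + ε) ^ (-(d : ℝ) / 2 - 1)
      = ε ^ (-(d : ℝ) / 2 - 1) * (1 + ‖w‖ ^ 2) ^ (-(d : ℝ) / 2 - 1) := by
    rw [← mul_rpow hε.le (by positivity)]
    ring_nf
  have e3 : (√ε) ^ d * ε * ε ^ (-(d : ℝ) / 2 - 1) = 1 := by
    rw [sqrt_eq_rpow, ← rpow_natCast, ← rpow_mul hε.le, ← rpow_add_one hε.ne', ← rpow_add hε]
    ring_nf
    exact rpow_zero ε
  rw [dker, cutR, e1, e2]
  calc _ = ((√ε) ^ d * ε * ε ^ (-(d : ℝ) / 2 - 1)) * ((1 + ‖w‖ ^ 2) ^ (-(d : ℝ) / 2 - 1)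
      * (cut (ε * ‖w‖ ^ 2 / r ^ 2) * g (x0 + √ε • w))) := by ring
    _ = _ := by rw [e3, one_mul]

theorem abs_integral_dker_le {ε r B : ℝ} (hε : 0 < ε) {g : Euc d → ℝ} (hg : ∀ x, |g x| ≤ B)
    (x0 : Euc d) : |∫ z, dker ε r z * g (x0 + z)| ≤ kappa d * B := by
  rw [integral_dker_scaling hε, kappa, ← integral_mul_const, ← Real.norm_eq_abs]
  refine norm_integral_le_of_norm_le ((integrable_kappa d).mul_const B)
    (Eventually.of_forall fun w => ?_)
  rw [norm_mul, Real.norm_of_nonneg (by positivity), norm_mul, Real.norm_of_nonneg (cut_nonneg _)]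
  have h1 := cut_le_one (ε * ‖w‖ ^ 2 / r ^ 2)
  have h2 := hg (x0 + √ε • w)
  have h3 : cut (ε * ‖w‖ ^ 2 / r ^ 2) * ‖g (x0 + √ε • w)‖ ≤ B :=
    (mul_le_of_le_one_left (norm_nonneg _) h1).trans h2
  gcongr

theorem tendsto_integral_dker {r B : ℝ} {g : Euc d → ℝ} (hgc : Continuous g)
    (hg : ∀ x, |g x| ≤ B) (x0 : Euc d) :
    Tendsto (fun ε => ∫ z, dker ε r z * g (x0 + z)) (𝓝[>] 0) (𝓝 (kappa d * g x0)) := by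
  have h : Tendsto (fun ε : ℝ => ∫ w : Euc d, (1 + ‖w‖ ^ 2) ^ (-(d : ℝ) / 2 - 1)
      * (cut (ε * ‖w‖ ^ 2 / r ^ 2) * g (x0 + √ε • w))) (𝓝[>] 0) (𝓝 (kappa d * g x0)) := by
    rw [kappa, ← integral_mul_const]
    refine tendsto_integral_filter_of_dominated_convergence
      (fun w => (1 + ‖w‖ ^ 2) ^ (-(d : ℝ) / 2 - 1) * B) ?_ ?_
      ((integrable_kappa d).mul_const B) ?_
    · refine Eventually.of_forall fun ε => ?_
      refine ((integrable_kappa d).aestronglyMeasurable).mul (Continuous.aestronglyMeasurable ?_)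
      exact (continuous_cut.comp (by fun_prop)).mul (hgc.comp (by fun_prop))
    · refine Eventually.of_forall fun ε => Eventually.of_forall fun w => ?_
      rw [norm_mul, Real.norm_of_nonneg (by positivity), norm_mul,
        Real.norm_of_nonneg (cut_nonneg _)]
      have h3 : cut (ε * ‖w‖ ^ 2 / r ^ 2) * ‖g (x0 + √ε • w)‖ ≤ B :=
        (mul_le_of_le_one_left (norm_nonneg _) (cut_le_one _)).trans (hg _)
      gcongr
    · refine Eventually.of_forall fun w => ?_
      have hc : Continuous fun ε : ℝ => (1 + ‖w‖ ^ 2) ^ (-(d : ℝ) / 2 - 1)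
          * (cut (ε * ‖w‖ ^ 2 / r ^ 2) * g (x0 + √ε • w)) :=
        continuous_const.mul ((continuous_cut.comp (by fun_prop)).mul (hgc.comp (by fun_prop)))
      have := (hc.tendsto 0).mono_left (nhdsWithin_le_nhds (s := Ioi 0))
      simpa [cut_eq_one (show (0 : ℝ) ≤ 1 / 2 by norm_num)] using this
  refine h.congr' ?_
  filter_upwards [self_mem_nhdsWithin] with ε hε
  exact (integral_dker_scaling hε g x0).symm

theorem dker_neg (ε r : ℝ) (z : Euc d) : dker ε r (-z) = dker ε r z := by
  simp [dker, cutR]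

/-- Testing the mollified measure against a compactly supported function. -/
theorem integral_mul_dker_swap {μ : Measure (Euc d)} [IsFiniteMeasure μ] {ε r : ℝ} (hε : 0 < ε)
    (hr : 0 < r) {φ : Euc d → ℝ} (hφ : Continuous φ) (hs : HasCompactSupport φ) :
    ∫ y, φ y * ∫ x, dker ε r (x - y) ∂μ = ∫ x, (∫ z, dker ε r z * φ (x + z)) ∂μ := by
  have hc : Continuous (Function.uncurry fun (y x : Euc d) => φ y * dker ε r (x - y)) := by
    have := (continuous_dker (d := d) hε r).comp
      (continuous_snd.sub continuous_fst : Continuous fun p : Euc d × Euc d => p.2 - p.1)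
    exact (hφ.comp continuous_fst).mul this
  have hcs : HasCompactSupport (Function.uncurry fun (y x : Euc d) => φ y * dker ε r (x - y)) := by
    obtain ⟨R, hR⟩ := hs.isCompact.isBounded.subset_closedBall (0 : Euc d)
    refine HasCompactSupport.intro
      ((isCompact_closedBall (0 : Euc d) R).prod (isCompact_closedBall (0 : Euc d) (R + r))) ?_
    rintro ⟨y, x⟩ h
    simp only [Function.uncurry_apply_pair]
    by_cases hy : y ∈ closedBall (0 : Euc d) R
    · have hx : R + r < ‖x‖ := by simpa using fun hx => h ⟨hy, hx⟩
      have hy' : ‖y‖ ≤ R := by simpa using hy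
      have : r ≤ ‖x - y‖ := by linarith [norm_sub_norm_le x y]
      rw [dker_eq_zero hr this, mul_zero]
    · rw [image_eq_zero_of_notMem_tsupport fun hy' => hy (hR hy'), zero_mul]
  simp_rw [← integral_const_mul]
  rw [integral_integral_swap_of_hasCompactSupport hc hcs]
  congr 1
  funext x
  rw [← integral_add_left_eq_self (fun y => φ y * dker ε r (x - y)) x]
  congr 1
  funext z
  rw [sub_add_cancel_left, dker_neg, mul_comm]

theorem tendsto_integral_mul_dker {μ : Measure (Euc d)} [IsFiniteMeasure μ] {r : ℝ}
    (hr : 0 < r) {φ : Euc d → ℝ} (hφ : Continuous φ) (hs : HasCompactSupport φ) :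
    Tendsto (fun ε => ∫ y, φ y * ∫ x, dker ε r (x - y) ∂μ) (𝓝[>] 0)
      (𝓝 (kappa d * ∫ x, φ x ∂μ)) := by
  obtain ⟨B, hB⟩ := hφ.bounded_above_of_compact_support hs
  have h : Tendsto (fun ε : ℝ => ∫ x, (∫ z, dker ε r z * φ (x + z)) ∂μ) (𝓝[>] 0)
      (𝓝 (kappa d * ∫ x, φ x ∂μ)) := by
    rw [← integral_const_mul]
    refine tendsto_integral_filter_of_dominated_convergence (fun _ => kappa d * B) ?_ ?_
      (integrable_const _) ?_
    · filter_upwards [self_mem_nhdsWithin] with ε hε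
      have hm : Measurable (Function.uncurry fun (x z : Euc d) => dker ε r z * φ (x + z)) := by
        refine Continuous.measurable ?_
        exact ((continuous_dker hε r).comp continuous_snd).mul
          (hφ.comp (continuous_fst.add continuous_snd))
      exact (hm.stronglyMeasurable.integral_prod_right).aestronglyMeasurable
    · filter_upwards [self_mem_nhdsWithin] with ε hε
      exact Eventually.of_forall fun x => abs_integral_dker_le hε hB x
    · exact Eventually.of_forall fun x => tendsto_integral_dker hφ hB x
  refine h.congr' ?_
  filter_upwards [self_mem_nhdsWithin] with ε hε
  exact (integral_mul_dker_swap hε hr hφ hs).symm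

theorem integrableOn_norm_rpow (hd : 1 ≤ d) {a : ℝ} (ha : 0 < a) {ρ : ℝ} (hρ : 0 < ρ) :
    IntegrableOn (fun z : Euc d => ‖z‖ ^ (a - d)) (ball 0 ρ) := by
  have : Nonempty (Fin d) := ⟨⟨0, hd⟩⟩
  rw [integrableOn_fun_norm_addHaar volume (f := fun y => y ^ (a - d)),
    finrank_euclideanSpace_fin]
  have h := (intervalIntegral.integrableOn_Ioo_rpow_iff (s := a - 1) hρ).2 (by linarith)
  refine h.congr_fun (fun y hy => ?_) measurableSet_Ioo
  have hy0 : 0 < y := hy.1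
  simp only [smul_eq_mul]
  rw [← rpow_natCast, ← rpow_add hy0, Nat.cast_sub hd]
  congr 1
  push_cast
  ring

theorem integrable_indicator_norm_rpow (hd : 1 ≤ d) {a : ℝ} (ha : 0 < a) {ρ : ℝ} (hρ : 0 < ρ) :
    Integrable ((ball (0 : Euc d) ρ).indicator fun z => ‖z‖ ^ (a - d)) :=
  (integrable_indicator_iff measurableSet_ball).2 (integrableOn_norm_rpow hd ha hρ)

theorem sq_rpow_neg_half {z : Euc d} : (‖z‖ ^ 2) ^ (-(d : ℝ) / 2) = ‖z‖ ^ (-(d : ℝ)) := by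
  rw [← rpow_natCast, ← rpow_mul (norm_nonneg z)]
  congr 1
  push_cast
  ring

theorem add_rpow_le {ε : ℝ} (hε : 0 ≤ ε) {z : Euc d} (hz : z ≠ 0) {θ : ℝ} (hθ : 0 ≤ θ) :
    (‖z‖ ^ 2 + ε) ^ (-θ) ≤ (‖z‖ ^ 2) ^ (-θ) := by
  have : 0 < ‖z‖ := norm_pos_iff.2 hz
  exact rpow_le_rpow_of_nonpos (by positivity) (by linarith) (by linarith)

theorem norm_nker_le_rpow {ε r : ℝ} (hε : 0 ≤ ε) (hr : 0 < r) (z : Euc d) :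
    ‖nker ε r z‖ ≤ (ball (0 : Euc d) r).indicator (fun z => ‖z‖ ^ (1 - (d : ℝ))) z := by
  rcases le_or_gt r ‖z‖ with h | h
  · rw [nker_eq_zero hr h, norm_zero]
    exact indicator_nonneg (fun z _ => by positivity) z
  rw [indicator_of_mem (by simpa using h)]
  rcases eq_or_ne z 0 with rfl | hz
  · simp only [nker, smul_zero, norm_zero]; positivity
  have hz0 : 0 < ‖z‖ := norm_pos_iff.2 hz
  have h1 := add_rpow_le hε hz (θ := (d : ℝ) / 2) (by positivity)
  rw [← neg_div, sq_rpow_neg_half] at h1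
  have h2 := cutR_nonneg r z
  have h3 := cutR_le_one r z
  rw [nker, norm_smul, Real.norm_of_nonneg (by positivity)]
  calc _ ≤ (‖z‖ ^ (-(d : ℝ)) * 1) * ‖z‖ := by gcongr
    _ = _ := by rw [mul_one, ← rpow_add_one hz0.ne']; ring_nf

theorem tendsto_nker (r : ℝ) (z : Euc d) :
    Tendsto (fun ε => nker ε r z) (𝓝[>] 0) (𝓝 (nker 0 r z)) := by
  rcases eq_or_ne z 0 with rfl | hz
  · simp [nker]
  have hz0 : 0 < ‖z‖ := norm_pos_iff.2 hz
  refine Tendsto.mono_left ?_ nhdsWithin_le_nhds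
  refine ContinuousAt.tendsto (f := fun ε => nker ε r z) ?_
  unfold nker
  refine ContinuousAt.smul (ContinuousAt.mul (ContinuousAt.rpow_const (by fun_prop) ?_)
    continuousAt_const) continuousAt_const
  left
  positivity

theorem tendsto_kker (r : ℝ) (z : Euc d) :
    Tendsto (fun ε => kker ε r z) (𝓝[>] 0) (𝓝 (kker 0 r z)) := by
  rcases eq_or_ne z 0 with rfl | hz
  · simp [kker]
  have hz0 : 0 < ‖z‖ := norm_pos_iff.2 hz
  refine Tendsto.mono_left ?_ nhdsWithin_le_nhds
  refine ContinuousAt.tendsto (f := fun ε => kker ε r z) ?_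
  unfold kker
  refine ContinuousAt.mul (ContinuousAt.mul continuousAt_const
    (ContinuousAt.rpow_const (by fun_prop) ?_)) continuousAt_const
  left
  positivity

theorem measurable_nker (ε r : ℝ) : Measurable (nker ε r : Euc d → Euc d) := by
  unfold nker
  have := (continuous_cutR (d := d) r).measurable
  fun_prop

theorem measurable_kker (ε r : ℝ) : Measurable (kker ε r : Euc d → ℝ) := by
  unfold kker
  have : Measurable fun z : Euc d => deriv cut (‖z‖ ^ 2 / r ^ 2) :=
    (continuous_deriv_cut.comp (by fun_prop)).measurable
  fun_prop

theorem integrable_nker (hd : 1 ≤ d) {ε r : ℝ} (hε : 0 ≤ ε) (hr : 0 < r) :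
    Integrable (nker ε r : Euc d → Euc d) :=
  (integrable_indicator_norm_rpow hd zero_lt_one hr).mono'
    (measurable_nker ε r).aestronglyMeasurable (Eventually.of_forall (norm_nker_le_rpow hε hr))

theorem kker_le_indicator {ε r C : ℝ} (hr : 0 < r) (hC : 0 < C) {z : Euc d} (h : kker ε r z ≤ C) :
    kker ε r z ≤ (ball (0 : Euc d) r).indicator (fun _ => C) z := by
  rcases le_or_gt r ‖z‖ with h' | h'
  · rw [kker_eq_zero hr h']
    exact indicator_nonneg (fun z _ => hC.le) z
  · rwa [indicator_of_mem (by simpa using h')]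

theorem integrable_const_ball (r C : ℝ) :
    Integrable ((ball (0 : Euc d) r).indicator fun _ => C) :=
  (integrable_indicator_iff measurableSet_ball).2 (integrableOn_const measure_ball_lt_top.ne)

theorem integrable_kker {ε r : ℝ} (hε : 0 ≤ ε) (hr : 0 < r) :
    Integrable (kker ε r : Euc d → ℝ) := by
  obtain ⟨C, hC0, hC⟩ := exists_kker_bound d hr
  refine (integrable_const_ball r C).mono' (measurable_kker ε r).aestronglyMeasurable
    (Eventually.of_forall fun z => ?_)
  rw [Real.norm_of_nonneg (kker_nonneg hε r z)]
  exact kker_le_indicator hr hC0 (hC ε hε z)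

/-- The `L¹` distance of the regularised kernels to their limits. -/
def kerErr (d : ℕ) (r ε : ℝ) : ℝ :=
  (∫ z : Euc d, ‖nker ε r z - nker 0 r z‖) + ∫ z : Euc d, ‖kker ε r z - kker 0 r z‖

theorem tendsto_kerErr (hd : 1 ≤ d) {r : ℝ} (hr : 0 < r) :
    Tendsto (kerErr d r) (𝓝[>] 0) (𝓝 0) := by
  obtain ⟨C, hC0, hC⟩ := exists_kker_bound d hr
  rw [← add_zero (0 : ℝ)]
  refine Tendsto.add ?_ ?_
  · have h := tendsto_integral_filter_of_dominated_convergence (μ := (volume : Measure (Euc d)))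
      (F := fun ε z => ‖nker ε r z - nker 0 r z‖) (f := fun _ => (0 : ℝ)) (l := 𝓝[>] 0)
      (fun z => 2 * (ball (0 : Euc d) r).indicator (fun z => ‖z‖ ^ (1 - (d : ℝ))) z)
      (Eventually.of_forall fun ε =>
        ((measurable_nker ε r).sub (measurable_nker 0 r)).norm.aestronglyMeasurable) ?_
      ((integrable_indicator_norm_rpow hd zero_lt_one hr).const_mul 2)
      (Eventually.of_forall fun z => ?_)
    · simpa using h
    · filter_upwards [self_mem_nhdsWithin] with ε hε
      refine Eventually.of_forall fun z => ?_
      rw [norm_norm]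
      linarith [norm_sub_le (nker ε r z) (nker 0 r z), norm_nker_le_rpow (le_of_lt hε) hr z,
        norm_nker_le_rpow le_rfl hr z]
    · exact tendsto_iff_norm_sub_tendsto_zero.1 (tendsto_nker r z)
  · have h := tendsto_integral_filter_of_dominated_convergence (μ := (volume : Measure (Euc d)))
      (F := fun ε z => ‖kker ε r z - kker 0 r z‖) (f := fun _ => (0 : ℝ)) (l := 𝓝[>] 0)
      (fun z => 2 * (ball (0 : Euc d) r).indicator (fun z => C) z)
      (Eventually.of_forall fun ε =>
        ((measurable_kker ε r).sub (measurable_kker 0 r)).norm.aestronglyMeasurable) ?_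
      ((integrable_const_ball r C).const_mul 2)
      (Eventually.of_forall fun z => ?_)
    · simpa using h
    · filter_upwards [self_mem_nhdsWithin] with ε hε
      refine Eventually.of_forall fun z => ?_
      rw [norm_norm]
      have h1 := kker_le_indicator hr hC0 (hC ε (le_of_lt hε) z)
      have h2 := kker_le_indicator hr hC0 (hC 0 le_rfl z)
      have h3 := norm_sub_le (kker ε r z) (kker 0 r z)
      rw [Real.norm_of_nonneg (kker_nonneg (le_of_lt hε) r z),
        Real.norm_of_nonneg (kker_nonneg le_rfl r z)] at h3
      linarith
    · exact tendsto_iff_norm_sub_tendsto_zero.1 (tendsto_kker r z)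

theorem integral_ker_sub_le (hd : 1 ≤ d) {r ε ε' : ℝ} (hr : 0 < r) (hε : 0 ≤ ε) (hε' : 0 ≤ ε') :
    (∫ z : Euc d, ‖nker ε r z - nker ε' r z‖) + ∫ z : Euc d, ‖kker ε r z - kker ε' r z‖
      ≤ kerErr d r ε + kerErr d r ε' := by
  have iN : ∀ {a}, 0 ≤ a → Integrable (fun z : Euc d => ‖nker a r z - nker 0 r z‖) := fun ha =>
    ((integrable_nker hd ha hr).sub (integrable_nker hd le_rfl hr)).norm
  have iK : ∀ {a}, 0 ≤ a → Integrable (fun z : Euc d => ‖kker a r z - kker 0 r z‖) := fun ha =>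
    ((integrable_kker ha hr).sub (integrable_kker le_rfl hr)).norm
  have h1 : ∫ z : Euc d, ‖nker ε r z - nker ε' r z‖
      ≤ (∫ z : Euc d, ‖nker ε r z - nker 0 r z‖) + ∫ z : Euc d, ‖nker ε' r z - nker 0 r z‖ := by
    rw [← integral_add (iN hε) (iN hε')]
    refine integral_mono_of_nonneg (Eventually.of_forall fun z => norm_nonneg _)
      ((iN hε).add (iN hε')) (Eventually.of_forall fun z => ?_)
    simp only
    rw [norm_sub_rev (nker ε' r z)]
    exact norm_sub_le_norm_sub_add_norm_sub _ _ _
  have h2 : ∫ z : Euc d, ‖kker ε r z - kker ε' r z‖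
      ≤ (∫ z : Euc d, ‖kker ε r z - kker 0 r z‖) + ∫ z : Euc d, ‖kker ε' r z - kker 0 r z‖ := by
    rw [← integral_add (iK hε) (iK hε')]
    refine integral_mono_of_nonneg (Eventually.of_forall fun z => norm_nonneg _)
      ((iK hε).add (iK hε')) (Eventually.of_forall fun z => ?_)
    simp only
    rw [norm_sub_rev (kker ε' r z)]
    exact norm_sub_le_norm_sub_add_norm_sub _ _ _
  unfold kerErr
  linarith

theorem hasCompactSupport_of_tsupport_subset_closedBall {φ : Euc d → ℝ} {x0 : Euc d} {r : ℝ}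
    (h : tsupport φ ⊆ closedBall x0 r) : HasCompactSupport φ :=
  (isCompact_closedBall x0 r).of_isClosed_subset (isClosed_tsupport φ) h

theorem exists_norm_le_of_continuous {E : Euc d → Euc d} (hE : Continuous E) (R : ℝ) :
    ∃ M, 0 ≤ M ∧ ∀ x, ‖x‖ ≤ R → ‖E x‖ ≤ M := by
  obtain ⟨M, hM⟩ := (isCompact_closedBall (0 : Euc d) R).exists_bound_of_continuousOn
    hE.continuousOn
  exact ⟨max M 0, le_max_right _ _, fun x hx => (hM x (by simpa using hx)).trans (le_max_left _ _)⟩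

theorem integrable_comp_sub_one {μ : Measure (Euc d)} [IsFiniteMeasureOnCompacts μ] {r : ℝ}
    {g : Euc d → ℝ} (hg : Continuous g) (hz : ∀ z, r ≤ ‖z‖ → g z = 0)
    (x0 : Euc d) : Integrable (fun x => g (x - x0)) μ := by
  simpa using integrable_comp_sub (μ := μ) (h := fun _ => 1) hg continuous_const hz x0

theorem integral_le_of_invariant {μ : Measure (Euc d)} [IsFiniteMeasure μ] (hd : 1 ≤ d)
    {E : Euc d → Euc d} (hE : Continuous E)
    (hμ : ∀ φ : Euc d → ℝ, ContDiff ℝ ∞ φ → HasCompactSupport φ → ∫ x, adjOp E φ x ∂μ = 0)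
    (R : ℝ) : ∃ C, 0 ≤ C ∧ ∀ φ : Euc d → ℝ, Continuous φ → HasCompactSupport φ → (∀ x, 0 ≤ φ x) →
      (∀ x, R < ‖x‖ → φ x = 0) → ∫ x, φ x ∂μ ≤ C * ∫ x, φ x := by
  obtain ⟨M, hM0, hM⟩ := exists_norm_le_of_continuous hE (R + 1)
  have hd' : (1 : ℝ) ≤ d := by exact_mod_cast hd
  set r : ℝ := 1 / (8 * (M + 1)) with hrdef
  have hr : 0 < r := by positivity
  have hr1 : r ≤ 1 := by
    rw [hrdef, div_le_one (by positivity)]; linarith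
  have hMr : M * r ≤ 1 / 8 := by
    rw [hrdef, mul_one_div, div_le_div_iff₀ (by positivity) (by norm_num)]; linarith
  obtain ⟨Ck, hCk, hk⟩ := exists_kker_bound d hr
  have hF : ∀ ε, 0 < ε → ε ≤ r ^ 2 → ∀ y : Euc d, ‖y‖ ≤ R →
      ∫ x, dker ε r (x - y) ∂μ ≤ 3 * (μ.real univ * Ck) := by
    intro ε hε hεr y hy
    have h1 := (dker_bounds (μ := μ) (x0 := y) hd hE hM0 (fun x hx => hM x ?_) hr hMr hε hεr
      (fun φ h1 h2 => hμ φ h1 (hasCompactSupport_of_tsupport_subset_closedBall h2))).2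
    · have h2 : ∫ x, kker ε r (x - y) ∂μ ≤ ∫ x, Ck ∂μ :=
        integral_mono (integrable_comp_sub_one (continuous_kker hε r)
          (fun z hz => kker_eq_zero hr hz) y) (integrable_const _) (fun x => hk ε hε.le _)
      rw [integral_const, smul_eq_mul] at h2
      have h3 : 0 ≤ ∫ x, dker ε r (x - y) ∂μ := integral_nonneg fun x => dker_nonneg hε r _
      nlinarith
    · have h3 : ‖x - y‖ ≤ r := by simpa [dist_eq_norm] using hx
      have h4 : ‖x‖ ≤ ‖x - y‖ + ‖y‖ := by simpa using norm_add_le (x - y) y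
      linarith
  refine ⟨3 * (μ.real univ * Ck) / kappa d, div_nonneg (by positivity) (kappa_pos d).le, ?_⟩
  intro φ hφ hs h0 hz
  have hlim := tendsto_integral_mul_dker (μ := μ) hr hφ hs
  have hle : kappa d * ∫ x, φ x ∂μ ≤ ∫ x, φ x * (3 * (μ.real univ * Ck)) := by
    refine le_of_tendsto hlim ?_
    filter_upwards [Ioc_mem_nhdsGT (show (0 : ℝ) < r ^ 2 by positivity)] with ε hε
    refine integral_mono_of_nonneg (Eventually.of_forall fun y => ?_)
      ((hφ.integrable_of_hasCompactSupport hs).mul_const _) (Eventually.of_forall fun y => ?_)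
    · exact mul_nonneg (h0 y) (integral_nonneg fun x => dker_nonneg hε.1 r _)
    · rcases le_or_gt ‖y‖ R with hy | hy
      · exact mul_le_mul_of_nonneg_left (hF ε hε.1 hε.2 y hy) (h0 y)
      · simp [hz y hy]
  rw [integral_mul_const] at hle
  rw [div_mul_eq_mul_div, le_div_iff₀ (kappa_pos d)]
  linarith

/-- The regularised density `∫ dker ε 1 (x - y) dμ(x)`. -/
def regDensity (μ : Measure (Euc d)) (ε : ℝ) (y : Euc d) : ℝ := ∫ x, dker ε 1 (x - y) ∂μ

theorem continuous_regDensity (μ : Measure (Euc d)) [IsFiniteMeasure μ] {ε : ℝ} (hε : 0 < ε) :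
    Continuous (regDensity μ ε) := by
  have hc := continuous_dker (d := d) hε 1
  obtain ⟨B, hB⟩ := hc.bounded_above_of_compact_support
    (hasCompactSupport_of_ball (r := 1) fun z hz => dker_eq_zero one_pos hz)
  refine continuous_of_dominated (bound := fun _ => B) (fun y => ?_) (fun y => ?_)
    (integrable_const _) ?_
  · exact (hc.comp (continuous_id.sub continuous_const)).aestronglyMeasurable
  · exact Eventually.of_forall fun x => hB _
  · exact Eventually.of_forall fun x => hc.comp (continuous_const.sub continuous_id)

theorem mul_regDensity_eq {μ : Measure (Euc d)} [IsFiniteMeasure μ]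
    {E : Euc d → Euc d} (hE : Continuous E)
    (hμ : ∀ φ : Euc d → ℝ, ContDiff ℝ ∞ φ → HasCompactSupport φ → ∫ x, adjOp E φ x ∂μ = 0)
    {ε : ℝ} (hε : 0 < ε) (y : Euc d) :
    d * regDensity μ ε y = ∫ x, (kker ε 1 (x - y) + ⟪nker ε 1 (x - y), E x⟫) ∂μ := by
  obtain ⟨φ, h1, h2, h3⟩ := exists_dker_test E y (one_pos (α := ℝ)) hε
  have h4 := hμ φ h1 (hasCompactSupport_of_tsupport_subset_closedBall h2)
  have hI : Integrable (fun x => adjOp E φ x) μ :=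
    (continuous_adjOp hE h1).integrable_of_hasCompactSupport
      ((hasCompactSupport_of_tsupport_subset_closedBall h2).mono'
        ((subset_tsupport _).trans (tsupport_adjOp_subset E φ)))
  have hD : Integrable (fun x => dker ε 1 (x - y)) μ := integrable_comp_sub_one
    (continuous_dker hε 1) (fun z hz => dker_eq_zero one_pos hz) y
  have : ∀ x, kker ε 1 (x - y) + ⟪nker ε 1 (x - y), E x⟫
      = 2⁻¹ * adjOp E φ x + d * dker ε 1 (x - y) := fun x => by rw [h3]; ring
  simp_rw [this]
  rw [integral_add (hI.const_mul _) (hD.const_mul _), integral_const_mul, integral_const_mul, h4,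
    regDensity]
  ring

theorem abs_regDensity_sub_le {μ : Measure (Euc d)} [IsFiniteMeasure μ] (hd : 1 ≤ d)
    {E : Euc d → Euc d} (hE : Continuous E)
    (hμ : ∀ φ : Euc d → ℝ, ContDiff ℝ ∞ φ → HasCompactSupport φ → ∫ x, adjOp E φ x ∂μ = 0)
    (R : ℝ) : ∃ K, 0 ≤ K ∧ ∀ y : Euc d, ‖y‖ ≤ R → ∀ ε ε', 0 < ε → 0 < ε' →
      |regDensity μ ε y - regDensity μ ε' y| ≤ K * (kerErr d 1 ε + kerErr d 1 ε') := by
  obtain ⟨M, hM0, hM⟩ := exists_norm_le_of_continuous hE (R + 1)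
  obtain ⟨C, hC0, hC⟩ := integral_le_of_invariant hd hE hμ (R + 1)
  have hd' : (1 : ℝ) ≤ d := by exact_mod_cast hd
  refine ⟨C * (1 + M), by positivity, fun y hy ε ε' hε hε' => ?_⟩
  set h : Euc d → ℝ := fun z => ‖kker ε 1 z - kker ε' 1 z‖ + M * ‖nker ε 1 z - nker ε' 1 z‖
    with hh
  have hhc : Continuous h :=
    ((continuous_kker hε 1).sub (continuous_kker hε' 1)).norm.add
      (continuous_const.mul ((continuous_nker hε 1).sub (continuous_nker hε' 1)).norm)
  have hhz : ∀ z : Euc d, 1 ≤ ‖z‖ → h z = 0 := fun z hz => by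
    simp [hh, kker_eq_zero one_pos hz, nker_eq_zero one_pos hz]
  have hh0 : ∀ z, 0 ≤ h z := fun z => by positivity
  have hfar : ∀ x : Euc d, R + 1 < ‖x‖ → 1 ≤ ‖x - y‖ := fun x hx => by
    have h4 : ‖x‖ ≤ ‖x - y‖ + ‖y‖ := by simpa using norm_add_le (x - y) y
    linarith
  have hhI : Integrable (fun x => h (x - y)) μ := integrable_comp_sub_one hhc hhz y
  have hcs : HasCompactSupport (fun x => h (x - y)) := by
    refine hasCompactSupport_of_ball (r := ‖y‖ + 1) fun x hx => hhz _ ?_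
    have h4 : ‖x‖ ≤ ‖x - y‖ + ‖y‖ := by simpa using norm_add_le (x - y) y
    linarith
  have hintg : ∀ ε, 0 < ε →
      Integrable (fun x => kker ε 1 (x - y) + ⟪nker ε 1 (x - y), E x⟫) μ := fun ε hε => by
    refine Continuous.integrable_of_hasCompactSupport ?_ ?_
    · exact ((continuous_kker hε 1).comp (continuous_id.sub continuous_const)).add
        (((continuous_nker hε 1).comp (continuous_id.sub continuous_const)).inner hE)
    · refine hasCompactSupport_of_ball (r := ‖y‖ + 1) fun x hx => ?_
      have h4 : ‖x‖ ≤ ‖x - y‖ + ‖y‖ := by simpa using norm_add_le (x - y) y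
      have h5 : 1 ≤ ‖x - y‖ := by linarith
      simp [kker_eq_zero one_pos h5, nker_eq_zero one_pos h5]
  have e1 : d * |regDensity μ ε y - regDensity μ ε' y| ≤ ∫ x, h (x - y) ∂μ := by
    have : (d : ℝ) * |regDensity μ ε y - regDensity μ ε' y|
        = |d * regDensity μ ε y - d * regDensity μ ε' y| := by
      rw [← mul_sub, abs_mul, Nat.abs_cast]
    rw [this, mul_regDensity_eq hE hμ hε, mul_regDensity_eq hE hμ hε',
      ← integral_sub (hintg ε hε) (hintg ε' hε'), ← Real.norm_eq_abs]
    refine norm_integral_le_of_norm_le hhI (Eventually.of_forall fun x => ?_)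
    rcases le_or_gt ‖x‖ (R + 1) with hx | hx
    · have : kker ε 1 (x - y) + ⟪nker ε 1 (x - y), E x⟫
          - (kker ε' 1 (x - y) + ⟪nker ε' 1 (x - y), E x⟫)
          = (kker ε 1 (x - y) - kker ε' 1 (x - y))
            + ⟪nker ε 1 (x - y) - nker ε' 1 (x - y), E x⟫ := by rw [inner_sub_left]; ring
      rw [this]
      refine (norm_add_le _ _).trans (add_le_add le_rfl ?_)
      refine (norm_inner_le_norm _ _).trans ?_
      rw [mul_comm]
      exact mul_le_mul_of_nonneg_right (hM x hx) (norm_nonneg _)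
    · have h5 := hfar x hx
      simp [kker_eq_zero one_pos h5, nker_eq_zero one_pos h5, hhz _ h5]
  have e2 := hC (fun x => h (x - y)) (hhc.comp (continuous_id.sub continuous_const)) hcs
    (fun x => hh0 _) (fun x hx => hhz _ (hfar x hx))
  rw [integral_sub_right_eq_self (μ := volume) h y] at e2
  have e3 : ∫ z, h z ≤ (1 + M) * (kerErr d 1 ε + kerErr d 1 ε') := by
    have hk := ((integrable_kker (d := d) hε.le one_pos).sub
      (integrable_kker (d := d) hε'.le one_pos)).norm
    have hn := ((integrable_nker (d := d) hd hε.le one_pos).sub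
      (integrable_nker (d := d) hd hε'.le one_pos)).norm
    have := integral_ker_sub_le hd one_pos hε.le hε'.le (d := d)
    have a1 : 0 ≤ ∫ z : Euc d, ‖nker ε 1 z - nker ε' 1 z‖ := integral_nonneg fun _ => norm_nonneg _
    have a2 : 0 ≤ ∫ z : Euc d, ‖kker ε 1 z - kker ε' 1 z‖ := integral_nonneg fun _ => norm_nonneg _
    simp only [Pi.sub_apply] at hk hn
    have e : ∫ z, h z = (∫ z : Euc d, ‖kker ε 1 z - kker ε' 1 z‖)
        + M * ∫ z : Euc d, ‖nker ε 1 z - nker ε' 1 z‖ := by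
      rw [← integral_const_mul, ← integral_add hk (hn.const_mul M)]
    rw [e]
    nlinarith
  have e4 : |regDensity μ ε y - regDensity μ ε' y|
      ≤ d * |regDensity μ ε y - regDensity μ ε' y| :=
    le_mul_of_one_le_left (abs_nonneg _) hd'
  calc _ ≤ C * ∫ z, h z := e4.trans (e1.trans e2)
    _ ≤ C * ((1 + M) * (kerErr d 1 ε + kerErr d 1 ε')) := mul_le_mul_of_nonneg_left e3 hC0
    _ = _ := by ring

theorem exists_continuous_density {μ : Measure (Euc d)} [IsFiniteMeasure μ] (hd : 1 ≤ d)
    {E : Euc d → Euc d} (hE : Continuous E)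
    (hμ : ∀ φ : Euc d → ℝ, ContDiff ℝ ∞ φ → HasCompactSupport φ → ∫ x, adjOp E φ x ∂μ = 0) :
    ∃ f : Euc d → ℝ, Continuous f ∧ (∀ x, 0 ≤ f x) ∧
      μ = volume.withDensity (fun x => ENNReal.ofReal (f x)) := by
  set ε : ℕ → ℝ := fun n => 1 / ((n : ℝ) + 1) with hεdef
  have hε : ∀ n, 0 < ε n := fun n => by positivity
  have hε0 : Tendsto ε atTop (𝓝[>] 0) :=
    tendsto_nhdsWithin_of_tendsto_nhds_of_eventually_within _ tendsto_one_div_add_atTop_nhds_zero_nat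
      (Eventually.of_forall hε)
  have herr : Tendsto (fun n => kerErr d 1 (ε n)) atTop (𝓝 0) :=
    (tendsto_kerErr hd one_pos).comp hε0
  choose K hK0 hK using abs_regDensity_sub_le hd hE hμ
  have hlim : ∀ y, ∃ l, Tendsto (fun n => regDensity μ (ε n) y) atTop (𝓝 l) := fun y => by
    refine cauchySeq_tendsto_of_complete (Metric.cauchySeq_iff.2 fun δ hδ => ?_)
    have h1 : Tendsto (fun n => K ‖y‖ * kerErr d 1 (ε n)) atTop (𝓝 0) := by
      simpa using herr.const_mul (K ‖y‖)
    obtain ⟨N, hN⟩ := eventually_atTop.1 (h1.eventually (gt_mem_nhds (half_pos hδ)))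
    refine ⟨N, fun m hm n hn => ?_⟩
    have := hK ‖y‖ y le_rfl (ε m) (ε n) (hε m) (hε n)
    rw [Real.dist_eq]
    have a := hN m hm
    have b := hN n hn
    linarith
  choose g hg using hlim
  have hdist : ∀ R y, ‖y‖ ≤ R → ∀ n, |regDensity μ (ε n) y - g y| ≤ K R * kerErr d 1 (ε n) := by
    intro R y hy n
    have h1 : Tendsto (fun m => |regDensity μ (ε n) y - regDensity μ (ε m) y|) atTop
        (𝓝 |regDensity μ (ε n) y - g y|) := (tendsto_const_nhds.sub (hg y)).abs
    have h2 : Tendsto (fun m => K R * (kerErr d 1 (ε n) + kerErr d 1 (ε m))) atTop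
        (𝓝 (K R * (kerErr d 1 (ε n) + 0))) := (tendsto_const_nhds.add herr).const_mul _
    rw [add_zero] at h2
    exact le_of_tendsto_of_tendsto' h1 h2 fun m => hK R y hy _ _ (hε n) (hε m)
  have hgc : Continuous g := by
    have hu : TendstoLocallyUniformly (fun n => regDensity μ (ε n)) g atTop := by
      rw [Metric.tendstoLocallyUniformly_iff]
      intro δ hδ x
      refine ⟨ball x 1, ball_mem_nhds x one_pos, ?_⟩
      have h1 : Tendsto (fun n => K (‖x‖ + 1) * kerErr d 1 (ε n)) atTop (𝓝 0) := by
        simpa using herr.const_mul (K (‖x‖ + 1))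
      filter_upwards [h1.eventually (gt_mem_nhds hδ)] with n hn y hy
      have hy' : ‖y‖ ≤ ‖x‖ + 1 := by
        have h3 : ‖y - x‖ < 1 := by simpa [dist_eq_norm] using hy
        have h4 : ‖y‖ ≤ ‖y - x‖ + ‖x‖ := by simpa using norm_add_le (y - x) x
        linarith
      rw [dist_comm, Real.dist_eq]
      exact (hdist _ y hy' n).trans_lt hn
    exact hu.continuous (Eventually.of_forall fun n => continuous_regDensity μ (hε n)).frequently
  have hg0 : ∀ y, 0 ≤ g y := fun y => ge_of_tendsto' (hg y) fun n =>
    integral_nonneg fun x => dker_nonneg (hε n) 1 _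
  have hintg : ∀ φ : Euc d → ℝ, Continuous φ → HasCompactSupport φ →
      ∫ y, φ y * g y = kappa d * ∫ x, φ x ∂μ := by
    intro φ hφ hs
    have h1 := (tendsto_integral_mul_dker (μ := μ) one_pos hφ hs).comp hε0
    refine tendsto_nhds_unique ?_ h1
    obtain ⟨R, hR⟩ := hs.isBounded.subset_closedBall 0
    refine tendsto_iff_norm_sub_tendsto_zero.2 ?_
    have h2 : Tendsto (fun n => ∫ y, |φ y| * (K R * kerErr d 1 (ε n))) atTop (𝓝 0) := by
      simp_rw [integral_mul_const]
      simpa using (herr.const_mul (K R)).const_mul (∫ y, |φ y|)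
    refine squeeze_zero (fun n => norm_nonneg _) (fun n => ?_) h2
    have i1 : Integrable (fun y => φ y * regDensity μ (ε n) y) :=
      (hφ.mul (continuous_regDensity μ (hε n))).integrable_of_hasCompactSupport hs.mul_right
    have i2 : Integrable (fun y => φ y * g y) :=
      (hφ.mul hgc).integrable_of_hasCompactSupport hs.mul_right
    have : (((fun ε => ∫ y, φ y * ∫ x, dker ε 1 (x - y) ∂μ) ∘ ε) n - ∫ y, φ y * g y)
        = ∫ y, (φ y * regDensity μ (ε n) y - φ y * g y) := by
      rw [integral_sub i1 i2]; rfl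
    rw [this]
    refine norm_integral_le_of_norm_le
      ((hφ.abs.integrable_of_hasCompactSupport (hs.comp_left abs_zero)).mul_const _)
      (Eventually.of_forall fun y => ?_)
    rw [← mul_sub, norm_mul, Real.norm_eq_abs, Real.norm_eq_abs]
    by_cases hy : y ∈ tsupport φ
    · exact mul_le_mul_of_nonneg_left (hdist R y (by simpa using hR hy) n) (abs_nonneg _)
    · simp [image_eq_zero_of_notMem_tsupport hy]
  set f : Euc d → ℝ := fun y => g y / kappa d with hf
  have hfc : Continuous f := hgc.div_const _
  have hf0 : ∀ y, 0 ≤ f y := fun y => div_nonneg (hg0 y) (kappa_pos d).le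
  refine ⟨f, hfc, hf0, ?_⟩
  have hlf : IsLocallyFiniteMeasure (volume.withDensity fun x => ENNReal.ofReal (f x)) :=
    IsLocallyFiniteMeasure.withDensity_ofReal hfc
  refine Measure.ext_of_integral_eq_on_compactlySupported fun φ => ?_
  rw [integral_withDensity_eq_integral_toReal_smul (by fun_prop) (by simp)]
  have h1 := hintg φ φ.continuous φ.hasCompactSupport
  have h2 : ∀ x, (ENNReal.ofReal (f x)).toReal • φ x = (φ x * g x) / kappa d := fun x => by
    rw [ENNReal.toReal_ofReal (hf0 x), hf, smul_eq_mul]; ring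
  simp_rw [h2]
  rw [integral_div, h1, mul_div_cancel_left₀ _ (kappa_pos d).ne']

theorem contDiff_kker_zero {r : ℝ} (hr : 0 < r) : ContDiff ℝ ∞ (kker 0 r : Euc d → ℝ) := by
  set H : ℝ → ℝ := fun s => -2 * s * s ^ (-(d : ℝ) / 2) * (deriv cut (s / r ^ 2) / r ^ 2) with hH
  have hHc : ContDiff ℝ ∞ H := by
    rw [contDiff_iff_contDiffAt]
    intro s
    have hdc : ContDiff ℝ ∞ (deriv cut) := (contDiff_infty_iff_deriv.1 contDiff_cut).2
    rcases lt_or_ge s (r ^ 2 / 2) with hs | hs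
    · have : H =ᶠ[𝓝 s] fun _ => 0 := by
        filter_upwards [Iio_mem_nhds hs] with t ht
        have : t / r ^ 2 ≤ 1 / 2 := by
          rw [div_le_iff₀ (by positivity)]
          have : t < r ^ 2 / 2 := ht
          linarith
        simp [hH, deriv_cut_eq_zero_of_le this]
      exact contDiffAt_const.congr_of_eventuallyEq this
    · have hs0 : s ≠ 0 := (lt_of_lt_of_le (by positivity) hs).ne'
      refine ((contDiffAt_const.mul contDiffAt_id).mul
        (contDiffAt_id.rpow_const_of_ne hs0)).mul ?_
      exact ((hdc.comp (contDiff_id.div_const _)).div_const _).contDiffAt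
  have : (kker 0 r : Euc d → ℝ) = H ∘ fun z => ‖z‖ ^ 2 := by
    ext z
    simp [kker, hH]
  rw [this]
  exact hHc.comp (contDiff_norm_sq ℝ)

theorem kker_zero_pos {r : ℝ} (hr : 0 < r) {s : ℝ} (hs : 0 < s) (hc : deriv cut s < 0)
    {z : Euc d} (hz : ‖z‖ ^ 2 = s * r ^ 2) : 0 < kker 0 r z := by
  have h1 : 0 < ‖z‖ ^ 2 := by rw [hz]; positivity
  have h2 : ‖z‖ ^ 2 / r ^ 2 = s := by rw [hz]; field_simp
  have h3 : (0 : ℝ) < (‖z‖ ^ 2) ^ (-(d : ℝ) / 2) := rpow_pos_of_pos h1 _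
  rw [kker, h2, add_zero]
  have h4 : deriv cut s / r ^ 2 < 0 := div_neg_of_neg_of_pos hc (by positivity)
  nlinarith [mul_pos h1 h3, mul_pos (mul_pos h1 h3) (neg_pos.2 h4)]

theorem integral_withDensity_ofReal {f : Euc d → ℝ} (hf : Continuous f) (hf0 : ∀ x, 0 ≤ f x)
    (g : Euc d → ℝ) :
    ∫ x, g x ∂(volume.withDensity fun x => ENNReal.ofReal (f x)) = ∫ x, f x * g x := by
  rw [integral_withDensity_eq_integral_toReal_smul (by fun_prop) (by simp)]
  simp_rw [ENNReal.toReal_ofReal (hf0 _), smul_eq_mul]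

/-- A continuous function cut off so that it is unchanged on the unit ball around `x0`. -/
theorem exists_bounded_eq_on_ball {f : Euc d → ℝ} (hf : Continuous f) (x0 : Euc d) :
    ∃ g : Euc d → ℝ, Continuous g ∧ (∃ B, ∀ x, |g x| ≤ B) ∧ g x0 = f x0 ∧
      ∀ z, ‖z‖ ≤ 1 → g (x0 + z) = f (x0 + z) := by
  refine ⟨fun x => f x * tentCutoff (‖x0‖ + 1) x, hf.mul (continuous_tentCutoff _), ?_, ?_, ?_⟩
  · obtain ⟨B, hB⟩ := (hf.mul (continuous_tentCutoff (‖x0‖ + 1))).bounded_above_of_compact_support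
      (hasCompactSupport_tentCutoff _).mul_left
    exact ⟨B, fun x => by simpa using hB x⟩
  · simp [tentCutoff_eq_one (R := ‖x0‖ + 1) (x := x0) (by linarith)]
  · intro z hz
    have : ‖x0 + z‖ ≤ ‖x0‖ + 1 := (norm_add_le _ _).trans (by linarith)
    simp [tentCutoff_eq_one this]

theorem tendsto_integral_dker_loc {r : ℝ} (hr : 0 < r) (hr1 : r ≤ 1) {f : Euc d → ℝ}
    (hf : Continuous f) (x0 : Euc d) :
    Tendsto (fun ε => ∫ z, dker ε r z * f (x0 + z)) (𝓝[>] 0) (𝓝 (kappa d * f x0)) := by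
  obtain ⟨g, hg, ⟨B, hB⟩, h1, h2⟩ := exists_bounded_eq_on_ball hf x0
  have := tendsto_integral_dker (r := r) hg hB x0
  rw [h1] at this
  refine this.congr fun ε => integral_congr_ae (Eventually.of_forall fun z => ?_)
  rcases le_or_gt r ‖z‖ with h | h
  · simp [dker_eq_zero hr h]
  · simp [h2 z (by linarith)]

theorem tendsto_integral_kker_loc {r : ℝ} (hr : 0 < r) (hr1 : r ≤ 1) {f : Euc d → ℝ}
    (hf : Continuous f) (x0 : Euc d) :
    Tendsto (fun ε => ∫ z, kker ε r z * f (x0 + z)) (𝓝[>] 0)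
      (𝓝 (∫ z, kker 0 r z * f (x0 + z))) := by
  obtain ⟨g, hg, ⟨B, hB⟩, h1, h2⟩ := exists_bounded_eq_on_ball hf x0
  have hB0 : 0 ≤ B := (abs_nonneg _).trans (hB 0)
  obtain ⟨C, hC, hk⟩ := exists_kker_bound d hr
  have e : ∀ ε z, kker ε r z * f (x0 + z) = kker ε r z * g (x0 + z) := fun ε z => by
    rcases le_or_gt r ‖z‖ with h | h
    · simp [kker_eq_zero hr h]
    · simp [h2 z (by linarith)]
  simp_rw [e]
  refine tendsto_integral_filter_of_dominated_convergence
    (fun z => (ball (0 : Euc d) r).indicator (fun _ => C) z * B) ?_ ?_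
    ((integrable_const_ball r C).mul_const B) ?_
  · exact Eventually.of_forall fun ε => ((measurable_kker ε r).mul
      (hg.comp (continuous_const.add continuous_id)).measurable).aestronglyMeasurable
  · filter_upwards [self_mem_nhdsWithin] with ε hε
    refine Eventually.of_forall fun z => ?_
    rw [norm_mul, Real.norm_eq_abs, abs_of_nonneg (kker_nonneg (le_of_lt hε) r z)]
    exact mul_le_mul (kker_le_indicator hr hC (hk ε (le_of_lt hε) z)) (hB _) (abs_nonneg _)
      (indicator_nonneg (fun _ _ => hC.le) _)
  · exact Eventually.of_forall fun z => (tendsto_kker r z).mul_const _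

theorem integral_mul_comp_sub (f g : Euc d → ℝ) (x0 : Euc d) :
    ∫ x, f x * g (x - x0) = ∫ z, g z * f (x0 + z) := by
  rw [← integral_sub_right_eq_self (μ := volume) (fun z => g z * f (x0 + z)) x0]
  exact integral_congr_ae (Eventually.of_forall fun x => by simp [mul_comm])

theorem eventually_zero_of_zero (hd : 1 ≤ d) {E : Euc d → Euc d} (hE : Continuous E)
    {f : Euc d → ℝ} (hf : Continuous f) (hf0 : ∀ x, 0 ≤ f x)
    (hw : ∀ φ : Euc d → ℝ, ContDiff ℝ ∞ φ → HasCompactSupport φ → ∫ x, f x * adjOp E φ x = 0)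
    {x0 : Euc d} (hx0 : f x0 = 0) : ∀ᶠ x in 𝓝 x0, f x = 0 := by
  obtain ⟨M, hM0, hM⟩ := exists_norm_le_of_continuous hE (‖x0‖ + 1)
  set r0 : ℝ := 1 / (8 * (M + 1)) with hrdef
  have hr0 : 0 < r0 := by positivity
  have hr01 : r0 ≤ 1 := by
    rw [hrdef, div_le_one (by positivity)]; linarith
  have hMr0 : M * r0 ≤ 1 / 8 := by
    rw [hrdef, mul_one_div, div_le_div_iff₀ (by positivity) (by norm_num)]; linarith
  have hlf : IsLocallyFiniteMeasure (volume.withDensity fun x => ENNReal.ofReal (f x)) :=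
    IsLocallyFiniteMeasure.withDensity_ofReal hf
  have key : ∀ r, 0 < r → r ≤ r0 → ∀ z, kker 0 r z * f (x0 + z) = 0 := by
    intro r hr hrr
    have hle : ∫ z, kker 0 r z * f (x0 + z) ≤ 0 := by
      have l1 := (tendsto_integral_kker_loc hr (hrr.trans hr01) hf x0).div_const 2
      have l2 := (tendsto_integral_dker_loc hr (hrr.trans hr01) hf x0).const_mul (d : ℝ)
      have : (∫ z, kker 0 r z * f (x0 + z)) / 2 ≤ d * (kappa d * f x0) := by
        refine le_of_tendsto_of_tendsto l1 l2 ?_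
        filter_upwards [Ioc_mem_nhdsGT (show (0 : ℝ) < r ^ 2 by positivity)] with ε hε
        have h1 := (dker_bounds (μ := volume.withDensity fun x => ENNReal.ofReal (f x))
          (x0 := x0) (M := M) hd hE hM0 (fun x hx => hM x ?_) hr
          ((mul_le_mul_of_nonneg_left hrr hM0).trans hMr0) hε.1 hε.2 (fun φ h1 h2 => ?_)).1
        · rwa [integral_withDensity_ofReal hf hf0, integral_withDensity_ofReal hf hf0,
            integral_mul_comp_sub, integral_mul_comp_sub] at h1
        · have h3 : ‖x - x0‖ ≤ r := by simpa [dist_eq_norm] using hx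
          have h4 : ‖x‖ ≤ ‖x - x0‖ + ‖x0‖ := by simpa using norm_add_le (x - x0) x0
          linarith
        · rw [integral_withDensity_ofReal hf hf0]
          exact hw φ h1 (hasCompactSupport_of_tsupport_subset_closedBall h2)
      rw [hx0] at this
      linarith
    have hc : Continuous fun z => kker 0 r z * f (x0 + z) :=
      (contDiff_kker_zero hr).continuous.mul (hf.comp (continuous_const.add continuous_id))
    have hnn : 0 ≤ fun z => kker 0 r z * f (x0 + z) := fun z =>
      mul_nonneg (kker_nonneg le_rfl r z) (hf0 _)
    have hI : Integrable fun z => kker 0 r z * f (x0 + z) :=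
      hc.integrable_of_hasCompactSupport
        (hasCompactSupport_of_ball (r := r) fun z hz => by simp [kker_eq_zero hr hz])
    have h0 := (integral_eq_zero_iff_of_nonneg hnn hI).1 (le_antisymm hle (integral_nonneg hnn))
    exact fun z => congrFun ((hc.ae_eq_iff_eq volume continuous_const).1 h0) z
  obtain ⟨s, hs1, hs2, hs3⟩ := exists_deriv_cut_neg
  have hs : 0 < s := by linarith
  filter_upwards [ball_mem_nhds x0 (show 0 < √s * r0 by positivity)] with x hx
  have hxr : ‖x - x0‖ < √s * r0 := by simpa [dist_eq_norm] using hx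
  rcases eq_or_ne x x0 with rfl | hne
  · exact hx0
  have hpos : 0 < ‖x - x0‖ := norm_pos_iff.2 (sub_ne_zero.2 hne)
  have hsq : 0 < √s := Real.sqrt_pos.2 hs
  have h1 := key (‖x - x0‖ / √s) (by positivity) ((div_le_iff₀ hsq).2 (by linarith)) (x - x0)
  have h2 : 0 < kker 0 (‖x - x0‖ / √s) (x - x0) := by
    refine kker_zero_pos (by positivity) hs hs3 ?_
    rw [div_pow, Real.sq_sqrt hs.le]
    field_simp
  have h3 := (mul_eq_zero.1 h1).resolve_left h2.ne'
  simpa using h3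

theorem pos_of_integral_ne_zero (hd : 1 ≤ d) {E : Euc d → Euc d} (hE : Continuous E)
    {f : Euc d → ℝ} (hf : Continuous f) (hf0 : ∀ x, 0 ≤ f x)
    (hw : ∀ φ : Euc d → ℝ, ContDiff ℝ ∞ φ → HasCompactSupport φ → ∫ x, f x * adjOp E φ x = 0)
    (hne : ∫ x, f x ≠ 0) (x : Euc d) : 0 < f x := by
  have hclopen : IsClopen {x | f x = 0} :=
    ⟨isClosed_eq hf continuous_const, isOpen_iff_mem_nhds.2 fun x hx =>
      eventually_zero_of_zero hd hE hf hf0 hw hx⟩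
  rcases isClopen_iff.1 hclopen with h | h
  · refine lt_of_le_of_ne (hf0 x) fun hx => ?_
    have : x ∈ {x | f x = 0} := hx.symm
    simp [h] at this
  · refine absurd ?_ hne
    have : ∀ x, f x = 0 := fun x => by
      have : x ∈ {x | f x = 0} := h ▸ mem_univ x
      exact this
    simp [this]

theorem tendsto_integral_nker_loc (hd : 1 ≤ d) {r : ℝ} (hr : 0 < r) (hr1 : r ≤ 1)
    {w : Euc d → Euc d} (hw : Continuous w) (x0 : Euc d) :
    Tendsto (fun ε => ∫ z, ⟪nker ε r z, w (x0 + z)⟫) (𝓝[>] 0)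
      (𝓝 (∫ z, ⟪nker 0 r z, w (x0 + z)⟫)) := by
  obtain ⟨B, hB0, hB⟩ := exists_norm_le_of_continuous
    (hw.comp (continuous_const.add continuous_id) : Continuous fun z => w (x0 + z)) 1
  refine tendsto_integral_filter_of_dominated_convergence
    (fun z => (ball (0 : Euc d) r).indicator (fun z => ‖z‖ ^ (1 - (d : ℝ))) z * B) ?_ ?_
    ((integrable_indicator_norm_rpow hd one_pos hr).mul_const B) ?_
  · exact Eventually.of_forall fun ε => ((measurable_nker ε r).inner
      (hw.comp (continuous_const.add continuous_id)).measurable).aestronglyMeasurable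
  · filter_upwards [self_mem_nhdsWithin] with ε hε
    refine Eventually.of_forall fun z => ?_
    have h1 := norm_nker_le_rpow (le_of_lt hε) hr z
    rcases le_or_gt r ‖z‖ with h | h
    · rw [nker_eq_zero hr h]
      simp only [inner_zero_left, norm_zero]
      exact mul_nonneg ((norm_nonneg _).trans h1) hB0
    · refine (norm_inner_le_norm _ _).trans ?_
      exact mul_le_mul h1 (hB z (by linarith)) (norm_nonneg _) ((norm_nonneg _).trans h1)
  · exact Eventually.of_forall fun z => (tendsto_nker r z).inner tendsto_const_nhds

theorem integrable_inner_nker (hd : 1 ≤ d) {ε r : ℝ} (hε : 0 ≤ ε) (hr : 0 < r)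
    {w : Euc d → Euc d} (hw : Continuous w) (x0 : Euc d) :
    Integrable (fun z => ⟪nker ε r z, w (x0 + z)⟫) := by
  obtain ⟨B, hB0, hB⟩ := exists_norm_le_of_continuous
    (hw.comp (continuous_const.add continuous_id) : Continuous fun z => w (x0 + z)) r
  refine ((integrable_nker hd hε hr).norm.mul_const B).mono' ((measurable_nker ε r).inner
      (hw.comp (continuous_const.add continuous_id)).measurable).aestronglyMeasurable
    (Eventually.of_forall fun z => ?_)
  rcases le_or_gt r ‖z‖ with h | h
  · simp [nker_eq_zero hr h]
  · exact (norm_inner_le_norm _ _).trans (mul_le_mul_of_nonneg_left (hB z h.le) (norm_nonneg _))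

/-- Representation formula for a continuous weak solution. -/
theorem representation (hd : 1 ≤ d) {E : Euc d → Euc d} (hE : Continuous E) {f : Euc d → ℝ}
    (hf : Continuous f) {r : ℝ} (hr : 0 < r) (hr1 : r ≤ 1) (x0 : Euc d)
    (hw : ∀ φ : Euc d → ℝ, ContDiff ℝ ∞ φ → tsupport φ ⊆ closedBall x0 r →
      ∫ x, f x * adjOp E φ x = 0) :
    d * (kappa d * f x0) = (∫ z, kker 0 r z * f (x0 + z))
      + ∫ z, ⟪nker 0 r z, f (x0 + z) • E (x0 + z)⟫ := by
  have l1 := (tendsto_integral_dker_loc hr hr1 hf x0).const_mul (d : ℝ)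
  have l2 := (tendsto_integral_kker_loc hr hr1 hf x0).add
    (tendsto_integral_nker_loc hd hr hr1 (hf.smul hE) x0)
  refine tendsto_nhds_unique (l1.congr' ?_) l2
  filter_upwards [self_mem_nhdsWithin] with ε hε
  have hε' : 0 < ε := hε
  obtain ⟨φ, h1, h2, h3⟩ := exists_dker_test E x0 hr hε'
  have h4 := hw φ h1 h2
  rw [← integral_add_left_eq_self (μ := volume) _ x0] at h4
  have e : ∀ z, f (x0 + z) * adjOp E φ (x0 + z) = 2 * (-(d * (dker ε r z * f (x0 + z)))
      + (kker ε r z * f (x0 + z) + ⟪nker ε r z, f (x0 + z) • E (x0 + z)⟫)) := fun z => by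
    rw [h3, inner_smul_right, add_sub_cancel_left]; ring
  have cs : ∀ g : Euc d → ℝ, Continuous g → (∀ z, r ≤ ‖z‖ → g z = 0) →
      Integrable (fun z => g z * f (x0 + z)) := fun g hg hz =>
    (hg.mul (hf.comp (continuous_const.add continuous_id))).integrable_of_hasCompactSupport
      (hasCompactSupport_of_ball (r := r) fun z h => by simp [hz z h])
  have i1 := cs _ (continuous_dker hε' r) fun z h => dker_eq_zero hr h
  have i2 := cs _ (continuous_kker hε' r) fun z h => kker_eq_zero hr h
  have i3 : Integrable (fun z => ⟪nker ε r z, f (x0 + z) • E (x0 + z)⟫) :=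
    integrable_inner_nker hd hε'.le hr (hf.smul hE) x0
  simp_rw [e] at h4
  rw [integral_const_mul, integral_add (i1.const_mul (d : ℝ)).fun_neg (i2.fun_add i3),
    integral_neg, integral_const_mul, integral_add i2 i3] at h4
  change _ = _ + ∫ z, ⟪nker ε r z, f (x0 + z) • E (x0 + z)⟫
  linarith

/-- The total mass of `‖z‖ ^ (1 - d)` on the unit ball. -/
def nMass (d : ℕ) : ℝ := ∫ z, (ball (0 : Euc d) 1).indicator (fun z => ‖z‖ ^ (1 - (d : ℝ))) z

theorem nMass_nonneg (d : ℕ) : 0 ≤ nMass d :=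
  integral_nonneg fun z => indicator_nonneg (fun _ _ => rpow_nonneg (norm_nonneg _) _) z

theorem integral_comp_inv_smul {r : ℝ} (hr : 0 < r) (g : Euc d → ℝ) :
    ∫ z, g (r⁻¹ • z) = r ^ (d : ℝ) * ∫ z, g z := by
  rw [Measure.integral_comp_smul volume g r⁻¹, finrank_euclideanSpace_fin, smul_eq_mul,
    rpow_natCast, abs_of_pos (by positivity)]
  simp

theorem integral_norm_rpow_ball {r : ℝ} (hr : 0 < r) :
    ∫ z, (ball (0 : Euc d) r).indicator (fun z => ‖z‖ ^ (1 - (d : ℝ))) z = r * nMass d := by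
  have e : ∀ z, (ball (0 : Euc d) r).indicator (fun z => ‖z‖ ^ (1 - (d : ℝ))) z
      = r ^ (1 - (d : ℝ)) * (ball (0 : Euc d) 1).indicator (fun z => ‖z‖ ^ (1 - (d : ℝ)))
        (r⁻¹ • z) := fun z => by
    have hn : ‖r⁻¹ • z‖ = r⁻¹ * ‖z‖ := by rw [norm_smul, Real.norm_of_nonneg (by positivity)]
    by_cases hz : ‖z‖ < r
    · have h2 : r⁻¹ • z ∈ ball (0 : Euc d) 1 := by
        rw [mem_ball_zero_iff, hn, inv_mul_lt_iff₀ hr]; simpa using hz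
      rw [indicator_of_mem (by simpa using hz), indicator_of_mem h2, hn,
        mul_rpow (by positivity) (norm_nonneg _), ← mul_assoc, ← mul_rpow hr.le (by positivity),
        mul_inv_cancel₀ hr.ne', one_rpow, one_mul]
    · have h2 : r⁻¹ • z ∉ ball (0 : Euc d) 1 := by
        rw [mem_ball_zero_iff, hn, inv_mul_lt_iff₀ hr]; simpa using hz
      rw [indicator_of_notMem (by simpa using hz), indicator_of_notMem h2, mul_zero]
  simp_rw [e]
  rw [integral_const_mul, integral_comp_inv_smul hr
    ((ball (0 : Euc d) 1).indicator (fun z => ‖z‖ ^ (1 - (d : ℝ)))), ← mul_assoc,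
    ← rpow_add hr, nMass]
  simp

theorem kker_zero_scale {r : ℝ} (hr : 0 < r) (z : Euc d) :
    kker 0 r z = r ^ (-(d : ℝ)) * kker 0 1 (r⁻¹ • z) := by
  have hn : ‖r⁻¹ • z‖ ^ 2 = ‖z‖ ^ 2 / r ^ 2 := by
    rw [norm_smul, Real.norm_of_nonneg (by positivity), mul_pow, inv_pow]; field_simp
  have h1 : (‖z‖ ^ 2 / r ^ 2) ^ (-(d : ℝ) / 2)
      = (‖z‖ ^ 2) ^ (-(d : ℝ) / 2) * r ^ (d : ℝ) := by
    rw [div_rpow (by positivity) (by positivity), ← rpow_natCast r 2, ← rpow_mul hr.le,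
      div_eq_mul_inv, ← rpow_neg hr.le]
    congr 2; push_cast; ring
  have h2 : r ^ (-(d : ℝ)) * r ^ (d : ℝ) = 1 := by rw [← rpow_add hr]; simp
  simp only [kker, hn, add_zero, h1, one_pow, div_one]
  linear_combination (2 * ‖z‖ ^ 2 * (‖z‖ ^ 2) ^ (-(d : ℝ) / 2) *
    (deriv cut (‖z‖ ^ 2 / r ^ 2) / r ^ 2)) * h2

theorem exists_kker_translate_bound (d : ℕ) : ∃ C, 0 < C ∧ ∀ r, 0 < r → ∀ h : Euc d,
    ∫ z, |kker 0 r (z - h) - kker 0 r z| ≤ C * ‖h‖ / r := by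
  obtain ⟨L, hL⟩ := ContDiff.lipschitzWith_of_hasCompactSupport
    (hasCompactSupport_of_ball (r := 1) fun z hz => kker_eq_zero (ε := 0) one_pos hz)
    (contDiff_kker_zero (d := d) one_pos) (by simp)
  set V : ℝ := ∫ z, (ball (0 : Euc d) 1).indicator (fun _ => (1 : ℝ)) z with hV
  have hV0 : 0 ≤ V := integral_nonneg fun z => indicator_nonneg (fun _ _ => zero_le_one) z
  have hunit : ∀ a : Euc d, ∫ z, |kker 0 1 (z - a) - kker 0 1 z| ≤ (2 * L * V + 1) * ‖a‖ := by
    intro a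
    have hI := integrable_const_ball (d := d) 1 1
    have hI2 : Integrable (fun z => (ball (0 : Euc d) 1).indicator (fun _ => (1 : ℝ)) (z - a)) :=
      hI.comp_sub_right a
    have : ∫ z, |kker 0 1 (z - a) - kker 0 1 z|
        ≤ ∫ z, (L * ‖a‖) * ((ball (0 : Euc d) 1).indicator (fun _ => (1 : ℝ)) (z - a)
          + (ball (0 : Euc d) 1).indicator (fun _ => (1 : ℝ)) z) := by
      refine integral_mono_of_nonneg (Eventually.of_forall fun z => abs_nonneg _)
        ((hI2.add hI).const_mul _) (Eventually.of_forall fun z => ?_)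
      have h1 : |kker 0 1 (z - a) - kker 0 1 z| ≤ L * ‖a‖ := by
        have := hL.dist_le_mul (z - a) z
        simpa [Real.dist_eq, dist_eq_norm] using this
      have hLa : 0 ≤ L * ‖a‖ := by positivity
      have p1 : 0 ≤ (ball (0 : Euc d) 1).indicator (fun _ => (1 : ℝ)) (z - a) :=
        indicator_nonneg (fun _ _ => zero_le_one) _
      have p2 : 0 ≤ (ball (0 : Euc d) 1).indicator (fun _ => (1 : ℝ)) z :=
        indicator_nonneg (fun _ _ => zero_le_one) _
      by_cases h2 : ‖z‖ < 1
      · have : (ball (0 : Euc d) 1).indicator (fun _ => (1 : ℝ)) z = 1 :=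
          indicator_of_mem (by simpa using h2) _
        simp only [this]
        nlinarith
      · by_cases h3 : ‖z - a‖ < 1
        · have : (ball (0 : Euc d) 1).indicator (fun _ => (1 : ℝ)) (z - a) = 1 :=
            indicator_of_mem (by simpa using h3) _
          simp only [this]
          nlinarith
        · simp only [kker_eq_zero (ε := 0) one_pos (not_lt.1 h2),
            kker_eq_zero (ε := 0) one_pos (not_lt.1 h3)]
          simp only [sub_self, abs_zero]
          positivity
    refine this.trans ?_
    rw [integral_const_mul, integral_add hI2 hI,
      integral_sub_right_eq_self (μ := volume)
        ((ball (0 : Euc d) 1).indicator (fun _ => (1 : ℝ))) a, ← hV]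
    nlinarith [norm_nonneg a]
  refine ⟨2 * L * V + 1, by positivity, fun r hr h => ?_⟩
  have e : ∀ z, |kker 0 r (z - h) - kker 0 r z| = r ^ (-(d : ℝ)) *
      (fun w => |kker 0 1 (w - r⁻¹ • h) - kker 0 1 w|) (r⁻¹ • z) := fun z => by
    rw [kker_zero_scale hr, kker_zero_scale hr, ← mul_sub, abs_mul,
      abs_of_pos (rpow_pos_of_pos hr _), smul_sub]
  simp_rw [e]
  rw [integral_const_mul, integral_comp_inv_smul hr
    (fun w : Euc d => |kker 0 1 (w - r⁻¹ • h) - kker 0 1 w|), ← mul_assoc, ← rpow_add hr]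
  simp only [neg_add_cancel, rpow_zero, one_mul]
  refine (hunit _).trans (le_of_eq ?_)
  rw [norm_smul, Real.norm_of_nonneg (by positivity)]
  field_simp

theorem abs_integral_kker_diff_le {f : Euc d → ℝ} (hf : Continuous f) {r C : ℝ} (hr : 0 < r)
    {y h : Euc d} (hC : ∫ z, |kker 0 r (z - h) - kker 0 r z| ≤ C * ‖h‖ / r) {c η : ℝ}
    (hη0 : 0 ≤ η) (hη : ∀ z, ‖z‖ < r ∨ ‖z - h‖ < r → |f (y + z) - c| ≤ η) :
    |(∫ z, kker 0 r z * f (y + h + z)) - ∫ z, kker 0 r z * f (y + z)| ≤ η * (C * ‖h‖ / r) := by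
  have hk := (contDiff_kker_zero (d := d) hr).continuous
  have hkh : Continuous fun z : Euc d => kker 0 r (z - h) := hk.comp (by fun_prop)
  have cs0 : HasCompactSupport (kker 0 r : Euc d → ℝ) :=
    hasCompactSupport_of_ball (r := r) fun z hz => kker_eq_zero hr hz
  have csh : HasCompactSupport (fun z : Euc d => kker 0 r (z - h)) :=
    cs0.comp_homeomorph (Homeomorph.subRight h)
  have hfy : Continuous fun z => f (y + z) := hf.comp (by fun_prop)
  have e1 : ∫ z, kker 0 r z * f (y + h + z) = ∫ z, kker 0 r (z - h) * f (y + z) := by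
    rw [← integral_sub_right_eq_self (μ := volume) (fun z => kker 0 r z * f (y + h + z)) h]
    refine integral_congr_ae (Eventually.of_forall fun z => ?_)
    simp [add_assoc]
  have e2 : ∫ z, (kker 0 r (z - h) - kker 0 r z : ℝ) = 0 := by
    rw [integral_sub (hkh.integrable_of_hasCompactSupport csh)
      (hk.integrable_of_hasCompactSupport cs0), integral_sub_right_eq_self (μ := volume), sub_self]
  have i1 : Integrable fun z : Euc d => |kker 0 r (z - h) - kker 0 r z| :=
    ((hkh.integrable_of_hasCompactSupport csh).sub
      (hk.integrable_of_hasCompactSupport cs0)).abs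
  have e3 : (∫ z, kker 0 r (z - h) * f (y + z)) - ∫ z, kker 0 r z * f (y + z)
      = ∫ z, (kker 0 r (z - h) - kker 0 r z) * (f (y + z) - c) := by
    have j1 : Integrable fun z => kker 0 r (z - h) * f (y + z) :=
      (hkh.mul hfy).integrable_of_hasCompactSupport csh.mul_right
    have j2 : Integrable fun z => kker 0 r z * f (y + z) :=
      (hk.mul hfy).integrable_of_hasCompactSupport cs0.mul_right
    have j3 : Integrable fun z : Euc d => (kker 0 r (z - h) - kker 0 r z) * c :=
      ((hkh.integrable_of_hasCompactSupport csh).sub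
      (hk.integrable_of_hasCompactSupport cs0)).mul_const c
    have : ∀ z, (kker 0 r (z - h) - kker 0 r z) * (f (y + z) - c)
        = (kker 0 r (z - h) * f (y + z) - kker 0 r z * f (y + z))
          - (kker 0 r (z - h) - kker 0 r z) * c := fun z => by ring
    simp_rw [this]
    rw [integral_sub (f := fun z => kker 0 r (z - h) * f (y + z) - kker 0 r z * f (y + z))
      (j1.sub j2) j3, integral_sub j1 j2, integral_mul_const, e2]
    ring
  rw [e1, e3, ← Real.norm_eq_abs]
  refine (norm_integral_le_of_norm_le (i1.const_mul η) (Eventually.of_forall fun z => ?_)).trans ?_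
  · rw [norm_mul, Real.norm_eq_abs, Real.norm_eq_abs, mul_comm]
    by_cases hz : ‖z‖ < r ∨ ‖z - h‖ < r
    · exact mul_le_mul_of_nonneg_right (hη z hz) (abs_nonneg _)
    · push Not at hz
      simp [kker_eq_zero (ε := 0) hr hz.1, kker_eq_zero (ε := 0) hr hz.2]
  · rw [integral_const_mul]
    exact mul_le_mul_of_nonneg_left hC hη0

theorem abs_integral_nker_diff_le (hd : 1 ≤ d) {w : Euc d → Euc d} (hw : Continuous w) {r A : ℝ}
    (hr : 0 < r) {y y' : Euc d} (hA0 : 0 ≤ A)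
    (hA : ∀ z, ‖z‖ < r → ‖w (y' + z) - w (y + z)‖ ≤ A) :
    |(∫ z, ⟪nker 0 r z, w (y' + z)⟫) - ∫ z, ⟪nker 0 r z, w (y + z)⟫| ≤ r * nMass d * A := by
  rw [← integral_sub (integrable_inner_nker hd le_rfl hr hw _)
    (integrable_inner_nker hd le_rfl hr hw _), ← Real.norm_eq_abs, ← integral_norm_rpow_ball hr,
    ← integral_mul_const]
  refine norm_integral_le_of_norm_le ((integrable_indicator_norm_rpow hd one_pos hr).mul_const A)
    (Eventually.of_forall fun z => ?_)
  have h1 := norm_nker_le_rpow le_rfl hr z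
  rw [← inner_sub_right]
  rcases le_or_gt r ‖z‖ with h | h
  · rw [nker_eq_zero hr h, inner_zero_left, norm_zero]
    exact mul_nonneg ((norm_nonneg _).trans h1) hA0
  · exact (norm_inner_le_norm _ _).trans
      (mul_le_mul h1 (hA z h) (norm_nonneg _) ((norm_nonneg _).trans h1))

/-- Interior Lipschitz estimate for continuous weak solutions of `Δf + div (f E) = 0`. -/
theorem exists_interior_lipschitz (hd : 1 ≤ d) : ∃ C, 0 < C ∧
    ∀ (E : Euc d → Euc d) (f : Euc d → ℝ) (x0 : Euc d) (M B η c r0 : ℝ),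
      Continuous E → Continuous f → 0 ≤ M → 0 ≤ B → 0 ≤ η → 0 < r0 → r0 ≤ 1 → C * M * r0 ≤ 1 →
      (∀ x ∈ ball x0 (2 * r0), ‖E x‖ ≤ M) →
      (∀ x ∈ ball x0 (2 * r0), ∀ y ∈ ball x0 (2 * r0), ‖E x - E y‖ ≤ M * ‖x - y‖) →
      (∀ x ∈ ball x0 (2 * r0), |f x| ≤ B) → (∀ x ∈ ball x0 (2 * r0), |f x - c| ≤ η) →
      (∀ φ : Euc d → ℝ, ContDiff ℝ ∞ φ → HasCompactSupport φ → tsupport φ ⊆ ball x0 (2 * r0) →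
        ∫ x, f x * adjOp E φ x = 0) →
      ∀ h, ‖h‖ < r0 → |f (x0 + h) - f x0| ≤ C * ‖h‖ * (η / r0 + r0 * M * B) := by
  obtain ⟨C1, hC1, hk⟩ := exists_kker_translate_bound d
  have hκ := kappa_pos d
  have hn := nMass_nonneg d
  have hd' : (1 : ℝ) ≤ d := by exact_mod_cast hd
  set a : ℝ := 2 / kappa d with ha
  have ha0 : 0 < a := by positivity
  refine ⟨2 * a * (C1 + nMass d), by positivity, ?_⟩
  intro E f x0 M B η c r0 hE hf hM hB hη hr0 hr01 hsmall hEM hEL hfB hfη hweak h hh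
  set D : Euc d → ℝ := fun y => |f (y + h) - f y| with hD
  set S : Euc d → ℝ := fun y => (r0 - ‖y - x0‖) * D y with hS
  have hmem2 : ∀ y, ‖y - x0‖ < r0 → y ∈ ball x0 (2 * r0) := fun y hy => by
    rw [mem_ball, dist_eq_norm]; linarith
  have hmem2h : ∀ y, ‖y - x0‖ < r0 → y + h ∈ ball x0 (2 * r0) := fun y hy => by
    rw [mem_ball, dist_eq_norm]
    have : ‖y + h - x0‖ ≤ ‖y - x0‖ + ‖h‖ := by
      rw [add_sub_right_comm]; exact norm_add_le _ _
    linarith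
  have hbdd : BddAbove (S '' ball x0 r0) := by
    refine ⟨r0 * (2 * B), ?_⟩
    rintro _ ⟨y, hy, rfl⟩
    have hy' : ‖y - x0‖ < r0 := by simpa [dist_eq_norm] using hy
    have h1 : D y ≤ 2 * B := by
      have h1 := abs_sub (f (y + h)) (f y)
      have h2 := hfB _ (hmem2 y hy')
      have h3 := hfB _ (hmem2h y hy')
      simp only [hD]; linarith
    exact mul_le_mul (by linarith [norm_nonneg (y - x0)]) h1 (abs_nonneg _) hr0.le
  set S0 : ℝ := sSup (S '' ball x0 r0) with hS0
  have hle : ∀ y, ‖y - x0‖ < r0 → S y ≤ S0 := fun y hy =>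
    le_csSup hbdd ⟨y, by simpa [dist_eq_norm] using hy, rfl⟩
  have hS00 : 0 ≤ S0 := by
    refine le_trans ?_ (hle x0 (by simpa using hr0))
    exact mul_nonneg (by simpa using hr0.le) (abs_nonneg _)
  have step : ∀ y, ‖y - x0‖ < r0 →
      S y ≤ a * (C1 + nMass d) * (η + r0 ^ 2 * M * B) * ‖h‖ + S0 / 2 := by
    intro y hy
    set r : ℝ := (r0 - ‖y - x0‖) / 2 with hr
    have hrpos : 0 < r := by rw [hr]; linarith
    have hrr0 : r ≤ r0 / 2 := by rw [hr]; linarith [norm_nonneg (y - x0)]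
    have hin : ∀ z, ‖z‖ < r → ‖y + z - x0‖ < r0 - r := fun z hz => by
      have : ‖y + z - x0‖ ≤ ‖y - x0‖ + ‖z‖ := by
        rw [add_sub_right_comm]; exact norm_add_le _ _
      have : ‖y - x0‖ = r0 - 2 * r := by rw [hr]; ring
      linarith
    have hcb : ∀ y', ‖y' - x0‖ + r < 2 * r0 → closedBall y' r ⊆ ball x0 (2 * r0) :=
      fun y' hy' => closedBall_subset_ball' (by rw [dist_eq_norm]; linarith)
    have hrep : ∀ y', ‖y' - x0‖ + r < 2 * r0 → _ := fun y' hy' =>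
      representation hd hE hf hrpos (by linarith) y' fun φ h1 h2 => hweak φ h1
        (hasCompactSupport_of_tsupport_subset_closedBall h2) (h2.trans (hcb y' hy'))
    have R1 := hrep y (by linarith)
    have R2 := hrep (y + h) (by
      have : ‖y + h - x0‖ ≤ ‖y - x0‖ + ‖h‖ := by
        rw [add_sub_right_comm]; exact norm_add_le _ _
      have : ‖y - x0‖ = r0 - 2 * r := by rw [hr]; ring
      linarith)
    have T1 := abs_integral_kker_diff_le hf hrpos (hk r hrpos h) (y := y) (c := c) hη
      (fun z hz => hfη _ (by
        rcases hz with hz | hz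
        · exact hmem2 _ (by linarith [hin z hz])
        · have := hmem2h (y + (z - h)) (by linarith [hin _ hz])
          simpa [add_assoc] using this))
    have T2 := abs_integral_nker_diff_le hd (hf.smul hE) hrpos (y := y) (y' := y + h)
      (A := M * (S0 / r) + B * (M * ‖h‖)) (by positivity) (fun z hz => by
        have hz' := hin z hz
        have hz'' : ‖y + z - x0‖ < r0 := by linarith
        have h1 : D (y + z) ≤ S0 / r := by
          rw [le_div_iff₀ hrpos]
          have h2 := hle (y + z) hz''
          have h3 : 0 ≤ D (y + z) := abs_nonneg _
          simp only [hS] at h2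
          nlinarith
        have ec : y + h + z = y + z + h := by abel
        rw [ec, Pi.smul_apply', Pi.smul_apply']
        have : f (y + z + h) • E (y + z + h) - f (y + z) • E (y + z)
            = (f (y + z + h) - f (y + z)) • E (y + z + h)
              + f (y + z) • (E (y + z + h) - E (y + z)) := by
          rw [sub_smul, smul_sub]; abel
        rw [this]
        refine (norm_add_le _ _).trans (add_le_add ?_ ?_)
        · rw [norm_smul, mul_comm]
          exact mul_le_mul (hEM _ (hmem2h _ hz'')) h1 (abs_nonneg _) hM
        · rw [norm_smul]
          refine mul_le_mul (hfB _ (hmem2 _ hz'')) ?_ (norm_nonneg _) hB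
          simpa using hEL _ (hmem2h _ hz'') _ (hmem2 _ hz''))
    have T3 : d * (kappa d * D y) ≤ η * (C1 * ‖h‖ / r)
        + r * nMass d * (M * (S0 / r) + B * (M * ‖h‖)) := by
      have : d * (kappa d * D y) = |d * (kappa d * f (y + h)) - d * (kappa d * f y)| := by
        rw [← mul_sub, ← mul_sub, abs_mul, abs_mul, Nat.abs_cast, abs_of_pos hκ]
      rw [this, R1, R2, add_sub_add_comm]
      exact (abs_add_le _ _).trans (add_le_add T1 T2)
    have T4 : kappa d * D y ≤ d * (kappa d * D y) :=
      le_mul_of_one_le_left (mul_nonneg hκ.le (abs_nonneg _)) hd'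
    have T5 : kappa d * S y ≤ 2 * (η * C1 * ‖h‖ + r * nMass d * M * S0
        + r ^ 2 * nMass d * (B * M * ‖h‖)) := by
      have e : kappa d * S y = 2 * (r * (kappa d * D y)) := by
        simp only [hS, hr]; ring
      have e2 : r * (η * (C1 * ‖h‖ / r) + r * nMass d * (M * (S0 / r) + B * (M * ‖h‖)))
          = η * C1 * ‖h‖ + r * nMass d * M * S0 + r ^ 2 * nMass d * (B * M * ‖h‖) := by
        field_simp
        ring
      rw [e, ← e2]
      have := mul_le_mul_of_nonneg_left (T4.trans T3) hrpos.le
      linarith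
    have T6 : S y ≤ a * (η * C1 * ‖h‖ + r * nMass d * M * S0
        + r ^ 2 * nMass d * (B * M * ‖h‖)) := by
      rw [ha, div_mul_eq_mul_div, le_div_iff₀ hκ]
      linarith
    have u1 : r * nMass d * M * S0 * a ≤ S0 / 2 := by
      have v1 : a * (nMass d * M * r0) ≤ 1 / 2 := by
        have : 0 ≤ a * C1 * M * r0 := by positivity
        nlinarith
      have v2 : a * (nMass d * M * r) ≤ a * (nMass d * M * r0) := by
        have : r ≤ r0 := by linarith
        gcongr
      have := mul_le_mul_of_nonneg_right (v2.trans v1) hS00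
      linarith
    have u2 : r ^ 2 * nMass d * (B * M * ‖h‖) ≤ (C1 + nMass d) * (r0 ^ 2 * M * B) * ‖h‖ := by
      have : r ^ 2 ≤ r0 ^ 2 := by
        have : r ≤ r0 := by linarith
        gcongr
      calc r ^ 2 * nMass d * (B * M * ‖h‖) ≤ r0 ^ 2 * (C1 + nMass d) * (B * M * ‖h‖) := by
            gcongr; linarith
        _ = _ := by ring
    have u3 : η * C1 * ‖h‖ ≤ (C1 + nMass d) * η * ‖h‖ := by
      rw [mul_comm η C1]; gcongr; linarith
    have u4 := mul_le_mul_of_nonneg_left (add_le_add u3 u2) ha0.le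
    linarith
  have hfin : S0 ≤ a * (C1 + nMass d) * (η + r0 ^ 2 * M * B) * ‖h‖ + S0 / 2 := by
    refine csSup_le ⟨_, x0, by simpa using hr0, rfl⟩ ?_
    rintro _ ⟨y, hy, rfl⟩
    exact step y (by simpa [dist_eq_norm] using hy)
  have h1 := hle x0 (by simpa using hr0)
  simp only [hS, hD, sub_self, norm_zero, sub_zero] at h1
  have h2 : r0 * (2 * a * (C1 + nMass d) * ‖h‖ * (η / r0 + r0 * M * B))
      = 2 * (a * (C1 + nMass d) * (η + r0 ^ 2 * M * B) * ‖h‖) := by field_simp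
  refine le_of_mul_le_mul_left ?_ hr0
  rw [h2]
  linarith

/-- `f` is Lipschitz on every ball. -/
def LipBalls {F : Type*} [NormedAddCommGroup F] (f : Euc d → F) : Prop :=
  ∀ R : ℝ, ∃ L, 0 ≤ L ∧ ∀ x y, ‖x‖ ≤ R → ‖y‖ ≤ R → ‖f x - f y‖ ≤ L * ‖x - y‖

theorem lipBalls_of_fderiv_bound {F : Type*} [NormedAddCommGroup F] [NormedSpace ℝ F]
    {f : Euc d → F} (hf : Differentiable ℝ f)
    (hb : ∀ R : ℝ, ∃ C, ∀ x, ‖x‖ ≤ R → ‖fderiv ℝ f x‖ ≤ C) : LipBalls f := by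
  intro R
  obtain ⟨C, hC⟩ := hb R
  refine ⟨max C 0, le_max_right _ _, fun x y hx hy => ?_⟩
  exact (convex_closedBall (0 : Euc d) R).norm_image_sub_le_of_norm_fderiv_le
    (fun z _ => hf z) (fun z hz => (hC z (by simpa using hz)).trans (le_max_left _ _))
    (by simpa using hy) (by simpa using hx)

theorem H0.lipBalls {E : Euc d → Euc d} (h : H0 E) : LipBalls E :=
  lipBalls_of_fderiv_bound h.1 fun R => by
    obtain ⟨C, hC⟩ := h.2 R
    exact ⟨C, fun x hx => by have := hC x hx; have := norm_nonneg (E x); linarith⟩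

theorem LipBalls.continuous {F : Type*} [NormedAddCommGroup F] {f : Euc d → F}
    (hf : LipBalls f) : Continuous f := by
  refine continuous_iff_continuousAt.2 fun x => ?_
  obtain ⟨L, hL, h⟩ := hf (‖x‖ + 1)
  refine tendsto_iff_norm_sub_tendsto_zero.2 ?_
  have h0 : Tendsto (fun y => L * ‖y - x‖) (𝓝 x) (𝓝 0) := by
    have : Continuous fun y : Euc d => L * ‖y - x‖ := by fun_prop
    simpa using this.tendsto x
  refine squeeze_zero' (Eventually.of_forall fun _ => norm_nonneg _) ?_ h0
  filter_upwards [Metric.ball_mem_nhds x one_pos] with y hy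
  refine h y x ?_ (by linarith)
  have : ‖y - x‖ < 1 := by simpa [dist_eq_norm] using hy
  have := norm_le_norm_add_norm_sub x y
  rw [norm_sub_rev] at this
  linarith [norm_sub_rev x y]

theorem LipBalls.norm_fderiv_le {F : Type*} [NormedAddCommGroup F] [NormedSpace ℝ F]
    {f : Euc d → F} {R L : ℝ} (hL : 0 ≤ L)
    (h : ∀ x y, ‖x‖ ≤ R → ‖y‖ ≤ R → ‖f x - f y‖ ≤ L * ‖x - y‖)
    {x : Euc d} (hx : ‖x‖ < R) : ‖fderiv ℝ f x‖ ≤ L := by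
  refine norm_fderiv_le_of_lip' ℝ hL ?_
  filter_upwards [(isOpen_lt continuous_norm continuous_const).mem_nhds hx] with y hy
  exact h y x (le_of_lt hy) hx.le

theorem LipBalls.exists_bound {F : Type*} [NormedAddCommGroup F] {f : Euc d → F}
    (hf : LipBalls f) (R : ℝ) : ∃ B, 0 ≤ B ∧ ∀ x, ‖x‖ ≤ R → ‖f x‖ ≤ B := by
  obtain ⟨B, hB⟩ := (isCompact_closedBall (0 : Euc d) R).exists_bound_of_continuousOn
    hf.continuous.continuousOn
  exact ⟨max B 0, le_max_right _ _, fun x hx => (hB x (by simpa using hx)).trans (le_max_left _ _)⟩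

theorem lipBalls_of_weak (hd : 1 ≤ d) {E : Euc d → Euc d} (hE : LipBalls E) {f : Euc d → ℝ}
    (hf : Continuous f)
    (hw : ∀ φ : Euc d → ℝ, ContDiff ℝ ∞ φ → HasCompactSupport φ → ∫ x, f x * adjOp E φ x = 0) :
    LipBalls f := by
  intro R
  obtain ⟨C, hC, key⟩ := exists_interior_lipschitz hd
  obtain ⟨M1, hM1, hEM⟩ := exists_norm_le_of_continuous hE.continuous (R + 2)
  obtain ⟨L1, hL1, hEL⟩ := hE (R + 2)
  obtain ⟨B', hB'⟩ := (isCompact_closedBall (0 : Euc d) (R + 2)).exists_bound_of_continuousOn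
    hf.continuousOn
  set B := max B' 0
  have hB : ∀ x : Euc d, ‖x‖ ≤ R + 2 → |f x| ≤ B := fun x hx =>
    (hB' x (by simpa using hx)).trans (le_max_left _ _)
  have hB0 : 0 ≤ B := le_max_right _ _
  set M := M1 + L1 + 1
  have hM : 0 < M := by positivity
  set r0 := min 1 (1 / (C * M))
  have hr0 : 0 < r0 := by positivity
  have hr1 : r0 ≤ 1 := min_le_left _ _
  have hCM : C * M * r0 ≤ 1 := by
    have : r0 ≤ 1 / (C * M) := min_le_right _ _
    calc C * M * r0 ≤ C * M * (1 / (C * M)) := by gcongr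
      _ = 1 := by field_simp
  refine ⟨C * (B / r0 + r0 * M * B) + 2 * B / r0, by positivity, fun x y hx hy => ?_⟩
  rcases lt_or_ge ‖x - y‖ r0 with h | h
  · have hin : ∀ z ∈ ball y (2 * r0), ‖z‖ ≤ R + 2 := fun z hz => by
      have h1 : ‖z - y‖ < 2 * r0 := by simpa [dist_eq_norm] using hz
      have h2 : ‖z‖ ≤ ‖y‖ + ‖z - y‖ := by
        simpa using norm_add_le y (z - y)
      linarith
    have := key E f y M B B 0 r0 hE.continuous hf hM.le hB0 hB0 hr0 hr1 hCM
      (fun z hz => (hEM z (hin z hz)).trans (by simp only [M]; linarith))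
      (fun z hz z' hz' => (hEL z z' (hin z hz) (hin z' hz')).trans (by
        gcongr; simp only [M]; linarith))
      (fun z hz => hB z (hin z hz)) (fun z hz => by simpa using hB z (hin z hz))
      (fun φ h1 h2 _ => hw φ h1 h2) (x - y) h
    rw [add_sub_cancel] at this
    rw [Real.norm_eq_abs]
    have h3 : 0 ≤ 2 * B / r0 * ‖x - y‖ := by positivity
    linarith
  · have h1 : ‖f x - f y‖ ≤ 2 * B := by
      have := norm_sub_le (f x) (f y)
      simp only [Real.norm_eq_abs] at *
      linarith [hB x (by linarith), hB y (by linarith)]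
    have h2 : 2 * B ≤ 2 * B / r0 * ‖x - y‖ := by
      rw [div_mul_eq_mul_div, le_div_iff₀ hr0]
      gcongr
    have h3 : 0 ≤ C * (B / r0 + r0 * M * B) * ‖x - y‖ := by positivity
    linarith

theorem LipBalls.ae_differentiableAt {f : Euc d → ℝ} (hf : LipBalls f) :
    ∀ᵐ x, DifferentiableAt ℝ f x := by
  have h : ∀ n : ℕ, ∀ᵐ x : Euc d, x ∈ ball (0 : Euc d) n → DifferentiableAt ℝ f x := fun n => by
    obtain ⟨L, hL, h⟩ := hf n
    have hlip : LipschitzOnWith L.toNNReal f (ball (0 : Euc d) n) :=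
      LipschitzOnWith.of_dist_le_mul fun x hx y hy => by
        rw [dist_eq_norm, dist_eq_norm, Real.coe_toNNReal _ hL]
        exact h x y (by simpa using (mem_ball_zero_iff.1 hx).le)
          (by simpa using (mem_ball_zero_iff.1 hy).le)
    filter_upwards [hlip.ae_differentiableWithinAt_of_mem (μ := volume)] with x hx hxm
    exact (hx hxm).differentiableAt (isOpen_ball.mem_nhds hxm)
  filter_upwards [ae_all_iff.2 h] with x hx
  obtain ⟨n, hn⟩ := exists_nat_gt ‖x‖
  exact hx n (by simpa using hn)

set_option maxHeartbeats 800000 in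
theorem differentiable_of_weak (hd : 1 ≤ d) {E : Euc d → Euc d} (hE : LipBalls E)
    (hEd : Differentiable ℝ E) {f : Euc d → ℝ} (hf : LipBalls f)
    (hw : ∀ φ : Euc d → ℝ, ContDiff ℝ ∞ φ → HasCompactSupport φ → ∫ x, f x * adjOp E φ x = 0) :
    Differentiable ℝ f := by
  intro x0
  have hEc := hE.continuous
  have hfc := hf.continuous
  set F : Euc d → Euc d → ℝ := fun y z =>
    kker 0 1 z * f (y + z) + ⟪nker 0 1 z, f (y + z) • E (y + z)⟫ with hF
  have hk : Integrable (kker 0 1 : Euc d → ℝ) := integrable_kker le_rfl one_pos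
  have hn : Integrable (nker 0 1 : Euc d → Euc d) := integrable_nker hd le_rfl one_pos
  have hI1 : ∀ y, Integrable fun z => kker 0 1 z * f (y + z) := fun y => by
    have hc : Continuous fun z => kker 0 1 z * f (y + z) :=
      (contDiff_kker_zero one_pos).continuous.mul (by fun_prop)
    exact hc.integrable_of_hasCompactSupport
      (hasCompactSupport_of_ball (r := 1) fun z hz => by rw [kker_eq_zero one_pos hz, zero_mul])
  have hI2 : ∀ y, Integrable fun z => ⟪nker 0 1 z, f (y + z) • E (y + z)⟫ := fun y =>
    integrable_inner_nker hd le_rfl one_pos (hfc.smul hEc) y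
  have hrep : ∀ y, d * (kappa d * f y) = ∫ z, F y z := fun y => by
    rw [hF, integral_add (hI1 y) (hI2 y)]
    exact representation hd hEc hfc one_pos le_rfl y fun φ h1 h2 =>
      hw φ h1 (hasCompactSupport_of_tsupport_subset_closedBall h2)
  suffices h : DifferentiableAt ℝ (fun y => ∫ z, F y z) x0 by
    have hne : (d : ℝ) * kappa d ≠ 0 :=
      mul_ne_zero (by exact_mod_cast (by omega : d ≠ 0)) (kappa_pos d).ne'
    have e : f = fun y => ((d : ℝ) * kappa d)⁻¹ * ∫ z, F y z := by
      funext y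
      rw [← hrep y, ← mul_assoc, ← mul_assoc, mul_assoc _ (d : ℝ), inv_mul_cancel₀ hne, one_mul]
    rw [e]
    exact h.const_mul _
  obtain ⟨Lf, hLf, hfL⟩ := hf (‖x0‖ + 2)
  obtain ⟨LE, hLE, hEL⟩ := hE (‖x0‖ + 2)
  obtain ⟨Bf, hBf, hfB⟩ := hf.exists_bound (‖x0‖ + 2)
  obtain ⟨BE, hBE, hEB⟩ := hE.exists_bound (‖x0‖ + 2)
  set F' : Euc d → Euc d →L[ℝ] ℝ := fun z =>
    kker 0 1 z • fderiv ℝ f (x0 + z) + (⟪nker 0 1 z, E (x0 + z)⟫ • fderiv ℝ f (x0 + z)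
      + f (x0 + z) • (innerSL ℝ (nker 0 1 z)).comp (fderiv ℝ E (x0 + z))) with hF'
  have hadd : Measurable fun z : Euc d => x0 + z := measurable_const_add x0
  have hmf : Measurable fun z => fderiv ℝ f (x0 + z) := (measurable_fderiv ℝ f).comp hadd
  have hmE : Measurable fun z => fderiv ℝ E (x0 + z) := (measurable_fderiv ℝ E).comp hadd
  have hmn : Measurable (nker 0 1 : Euc d → Euc d) := measurable_nker 0 1
  have hF'm : AEStronglyMeasurable F' volume := by
    have hc : Continuous fun p : (Euc d →L[ℝ] ℝ) × (Euc d →L[ℝ] Euc d) => p.1.comp p.2 := by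
      fun_prop
    have m3 : Measurable fun z => (innerSL ℝ (nker 0 1 z)).comp (fderiv ℝ E (x0 + z)) :=
      hc.measurable.comp (((innerSL ℝ).continuous.measurable.comp hmn).prodMk hmE)
    have m2 : Measurable fun z => ⟪nker 0 1 z, E (x0 + z)⟫ :=
      hmn.inner (hEc.measurable.comp hadd)
    have m1 : Measurable fun z => f (x0 + z) := hfc.measurable.comp hadd
    have n1 := ((measurable_kker 0 1).aestronglyMeasurable (μ := volume)).smul
      hmf.aestronglyMeasurable
    have n2 := (m2.aestronglyMeasurable (μ := volume)).smul hmf.aestronglyMeasurable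
    have n3 := (m1.aestronglyMeasurable (μ := volume)).smul m3.aestronglyMeasurable
    exact n1.add (n2.add n3)
  refine (hasFDerivAt_integral_of_dominated_loc_of_lip' (μ := volume) (F := F) (F' := F')
    (s := ball x0 1) (bound := fun z => kker 0 1 z * Lf + ‖nker 0 1 z‖ * (Bf * LE + BE * Lf))
    (ball_mem_nhds x0 one_pos) (fun y _ => ((hI1 y).add (hI2 y)).aestronglyMeasurable)
    ((hI1 x0).add (hI2 x0)) hF'm ?_ ((hk.mul_const _).add (hn.norm.mul_const _)) ?_).2.differentiableAt
  · refine Eventually.of_forall fun z y hy => ?_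
    have hy1 : ‖y - x0‖ < 1 := by simpa [dist_eq_norm] using hy
    rcases lt_or_ge ‖z‖ 1 with hz | hz
    · have hyz : ‖y + z‖ ≤ ‖x0‖ + 2 := by
        have h1 := norm_add_le (x0 + (y - x0)) z
        have h2 := norm_add_le x0 (y - x0)
        rw [add_sub_cancel] at h1 h2
        linarith
      have hxz : ‖x0 + z‖ ≤ ‖x0‖ + 2 := by linarith [norm_add_le x0 z]
      have a1 : ‖f (y + z) - f (x0 + z)‖ ≤ Lf * ‖y - x0‖ := by simpa using hfL _ _ hyz hxz
      have a2 : ‖E (y + z) - E (x0 + z)‖ ≤ LE * ‖y - x0‖ := by simpa using hEL _ _ hyz hxz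
      have a3 : ‖f (y + z) • E (y + z) - f (x0 + z) • E (x0 + z)‖
          ≤ (Bf * LE + BE * Lf) * ‖y - x0‖ := by
        have e : f (y + z) • E (y + z) - f (x0 + z) • E (x0 + z)
            = f (y + z) • (E (y + z) - E (x0 + z)) + (f (y + z) - f (x0 + z)) • E (x0 + z) := by
          rw [smul_sub, sub_smul]; abel
        rw [e]
        refine (norm_add_le _ _).trans ?_
        rw [norm_smul, norm_smul]
        have b1 := mul_le_mul (hfB _ hyz) a2 (norm_nonneg _) hBf
        have b2 := mul_le_mul a1 (hEB _ hxz) (norm_nonneg _) (by positivity)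
        linarith
      have e : F y z - F x0 z = kker 0 1 z * (f (y + z) - f (x0 + z))
          + ⟪nker 0 1 z, f (y + z) • E (y + z) - f (x0 + z) • E (x0 + z)⟫ := by
        simp only [hF, inner_sub_right]; ring
      rw [e]
      refine (norm_add_le _ _).trans ?_
      rw [norm_mul, Real.norm_of_nonneg (kker_nonneg le_rfl 1 z)]
      have c1 := mul_le_mul_of_nonneg_left a1 (kker_nonneg le_rfl 1 z)
      have c2 := (norm_inner_le_norm (𝕜 := ℝ) (nker 0 1 z)
        (f (y + z) • E (y + z) - f (x0 + z) • E (x0 + z))).trans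
        (mul_le_mul_of_nonneg_left a3 (norm_nonneg _))
      linarith
    · simp only [hF, kker_eq_zero one_pos hz, nker_eq_zero one_pos hz]
      simp
  · have hae : ∀ᵐ z : Euc d, DifferentiableAt ℝ f (x0 + z) :=
      (measurePreserving_add_left volume x0).quasiMeasurePreserving.ae hf.ae_differentiableAt
    filter_upwards [hae] with z hz
    have hsh : HasFDerivAt (fun y : Euc d => y + z) (ContinuousLinearMap.id ℝ _) x0 :=
      (hasFDerivAt_id x0).add_const z
    have h1 : HasFDerivAt (fun y => f (y + z)) (fderiv ℝ f (x0 + z)) x0 :=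
      (hz.hasFDerivAt.comp x0 hsh).congr_fderiv (ContinuousLinearMap.comp_id _)
    have h2 : HasFDerivAt (fun y => E (y + z)) (fderiv ℝ E (x0 + z)) x0 :=
      ((hEd (x0 + z)).hasFDerivAt.comp x0 hsh).congr_fderiv (ContinuousLinearMap.comp_id _)
    have h3 : HasFDerivAt (fun y => ⟪nker 0 1 z, f (y + z) • E (y + z)⟫)
        ((innerSL ℝ (nker 0 1 z)).comp (f (x0 + z) • fderiv ℝ E (x0 + z)
          + (fderiv ℝ f (x0 + z)).smulRight (E (x0 + z)))) x0 :=
      (innerSL ℝ (nker 0 1 z)).hasFDerivAt.comp x0 (h1.smul h2)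
    refine ((h1.const_mul (kker 0 1 z)).add h3).congr_fderiv ?_
    ext v
    simp [hF']
    ring

theorem real_inner_gradient_right (f : Euc d → ℝ) (x v : Euc d) :
    ⟪v, gradient f x⟫ = fderiv ℝ f x v := by
  rw [real_inner_comm, inner_gradient_left]

theorem norm_gradient (f : Euc d → ℝ) (x : Euc d) : ‖gradient f x‖ = ‖fderiv ℝ f x‖ := by
  rw [← toDual_gradient (𝕜 := ℝ) (f := f) (x := x), LinearIsometryEquiv.norm_map]

theorem measurable_gradient (f : Euc d → ℝ) : Measurable (gradient f) :=
  (InnerProductSpace.toDual ℝ (Euc d)).symm.continuous.measurable.comp (measurable_fderiv ℝ f)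

theorem gradient_mul_real {f g : Euc d → ℝ} {x : Euc d} (hf : DifferentiableAt ℝ f x)
    (hg : DifferentiableAt ℝ g x) :
    gradient (fun y => f y * g y) x = f x • gradient g x + g x • gradient f x := by
  apply (InnerProductSpace.toDual ℝ (Euc d)).injective
  rw [map_add, map_smul, map_smul, toDual_gradient, toDual_gradient, toDual_gradient,
    fderiv_fun_mul hf hg]

theorem gradient_comp_real {f : Euc d → ℝ} {g : ℝ → ℝ} {g' : ℝ} {x : Euc d}
    (hf : DifferentiableAt ℝ f x) (hg : HasDerivAt g g' (f x)) :
    gradient (fun y => g (f y)) x = g' • gradient f x := by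
  apply (InnerProductSpace.toDual ℝ (Euc d)).injective
  rw [map_smul, toDual_gradient, toDual_gradient]
  exact (hg.comp_hasFDerivAt x hf.hasFDerivAt).fderiv

theorem inner_eq_sum_single (u v : Euc d) :
    ⟪u, v⟫ = ∑ i, ⟪u, EuclideanSpace.single i (1 : ℝ)⟫ * ⟪v, EuclideanSpace.single i (1 : ℝ)⟫ := by
  simp [PiLp.inner_apply, mul_comm]

theorem integrable_of_bounded_on_compact {F : Type*} [NormedAddCommGroup F] {g : Euc d → F}
    (hg : AEStronglyMeasurable g volume) {K : Set (Euc d)} (hK : IsCompact K)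
    (h0 : ∀ x, x ∉ K → g x = 0) {C : ℝ} (hb : ∀ x ∈ K, ‖g x‖ ≤ C) : Integrable g := by
  have h : IntegrableOn g K :=
    Measure.integrableOn_of_bounded hK.measure_lt_top.ne hg
      ((ae_restrict_iff' hK.measurableSet).2 (Eventually.of_forall fun x hx => hb x hx))
  exact (integrableOn_iff_integrable_of_support_subset fun x hx => by
    by_contra hn; exact hx (h0 x hn)).1 h

/-- Differentiable with derivative bounded on every ball. -/
def DLip (f : Euc d → ℝ) : Prop :=
  Differentiable ℝ f ∧ ∀ R : ℝ, ∃ C, ∀ x, ‖x‖ ≤ R → ‖fderiv ℝ f x‖ ≤ C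

theorem DLip.lipBalls {f : Euc d → ℝ} (hf : DLip f) : LipBalls f :=
  lipBalls_of_fderiv_bound hf.1 hf.2

theorem DLip.exists_bound_on_compact {f : Euc d → ℝ} (hf : DLip f) {K : Set (Euc d)}
    (hK : IsCompact K) : ∃ C, 0 ≤ C ∧ ∀ x ∈ K, ‖fderiv ℝ f x‖ ≤ C := by
  obtain ⟨R, hR⟩ := hK.isBounded.subset_closedBall (0 : Euc d)
  obtain ⟨C, hC⟩ := hf.2 R
  exact ⟨max C 0, le_max_right _ _,
    fun x hx => (hC x (by simpa using hR hx)).trans (le_max_left _ _)⟩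

theorem DLip.mul {f g : Euc d → ℝ} (hf : DLip f) (hg : DLip g) : DLip fun x => f x * g x := by
  refine ⟨hf.1.mul hg.1, fun R => ?_⟩
  obtain ⟨C, hC⟩ := hf.2 R
  obtain ⟨C', hC'⟩ := hg.2 R
  obtain ⟨B, hB0, hB⟩ := hf.lipBalls.exists_bound R
  obtain ⟨B', hB0', hB'⟩ := hg.lipBalls.exists_bound R
  refine ⟨B * C' + B' * C, fun x hx => ?_⟩
  rw [fderiv_fun_mul (hf.1 x) (hg.1 x)]
  refine (norm_add_le _ _).trans ?_
  rw [norm_smul, norm_smul]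
  exact add_le_add (mul_le_mul (hB x hx) (hC' x hx) (norm_nonneg _) hB0)
    (mul_le_mul (hB' x hx) (hC x hx) (norm_nonneg _) hB0')

theorem DLip.comp {f : Euc d → ℝ} (hf : DLip f) {s : Set ℝ} (hs : ∀ x, f x ∈ s) {g g' : ℝ → ℝ}
    (hg : ∀ t ∈ s, HasDerivAt g (g' t) t) (hg' : ContinuousOn g' s) : DLip fun x => g (f x) := by
  refine ⟨fun x => ((hg _ (hs x)).differentiableAt.comp x (hf.1 x)), fun R => ?_⟩
  obtain ⟨C, hC⟩ := hf.2 R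
  have hc : Continuous fun x => g' (f x) := hg'.comp_continuous hf.1.continuous hs
  obtain ⟨B, hB⟩ := (isCompact_closedBall (0 : Euc d) R).exists_bound_of_continuousOn
    hc.continuousOn
  refine ⟨B * C, fun x hx => ?_⟩
  have hx' := hB x (by simpa using hx)
  rw [show fderiv ℝ (fun x => g (f x)) x = g' (f x) • fderiv ℝ f x from
    ((hg _ (hs x)).comp_hasFDerivAt x (hf.1 x).hasFDerivAt).fderiv, norm_smul]
  exact mul_le_mul hx' (hC x hx) (norm_nonneg _) ((norm_nonneg _).trans hx')

theorem DLip.of_contDiff {f : Euc d → ℝ} (hf : ContDiff ℝ ∞ f) : DLip f := by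
  refine ⟨hf.differentiable (by simp), fun R => ?_⟩
  obtain ⟨C, hC⟩ := (isCompact_closedBall (0 : Euc d) R).exists_bound_of_continuousOn
    (hf.continuous_fderiv (by simp)).continuousOn
  exact ⟨C, fun x hx => hC x (by simpa using hx)⟩

theorem gradient_eq_zero_of_notMem_tsupport {φ : Euc d → ℝ} {x : Euc d} (hx : x ∉ tsupport φ) :
    gradient φ x = 0 := by
  have : fderiv ℝ φ x = 0 := by
    by_contra h
    exact hx (support_fderiv_subset ℝ h)
  rw [gradient, this, map_zero]

/-- Integration by parts against one partial derivative of a compactly supported function. -/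
theorem integral_fderiv_mul_eq {f g : Euc d → ℝ} (hf : Differentiable ℝ f) (hg : DLip g)
    (hgs : HasCompactSupport g) {C : ℝ} (hC : ∀ x ∈ tsupport g, ‖fderiv ℝ f x‖ ≤ C) (v : Euc d) :
    Integrable (fun x => fderiv ℝ f x v * g x) ∧ Integrable (fun x => f x * fderiv ℝ g x v) ∧
      ∫ x, fderiv ℝ f x v * g x = - ∫ x, f x * fderiv ℝ g x v := by
  obtain ⟨Bg, hBg⟩ := hgs.isCompact.exists_bound_of_continuousOn hg.1.continuous.continuousOn
  obtain ⟨Bf, hBf⟩ := hgs.isCompact.exists_bound_of_continuousOn hf.continuous.continuousOn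
  obtain ⟨Cg, hCg0, hCg⟩ := hg.exists_bound_on_compact hgs.isCompact
  have mf : Measurable fun x => fderiv ℝ f x v := measurable_fderiv_apply_const ℝ f v
  have mg : Measurable fun x => fderiv ℝ g x v := measurable_fderiv_apply_const ℝ g v
  have i1 : Integrable fun x => fderiv ℝ f x v * g x := by
    refine integrable_of_bounded_on_compact
      (mf.mul hg.1.continuous.measurable).aestronglyMeasurable hgs.isCompact
      (fun x hx => by rw [image_eq_zero_of_notMem_tsupport hx, mul_zero]) (C := C * ‖v‖ * Bg) ?_
    intro x hx
    rw [norm_mul]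
    have h1 := (fderiv ℝ f x).le_of_opNorm_le (hC x hx) v
    exact mul_le_mul h1 (hBg x hx) (norm_nonneg _) ((norm_nonneg _).trans h1)
  have i2 : Integrable fun x => f x * fderiv ℝ g x v := by
    refine integrable_of_bounded_on_compact
      (hf.continuous.measurable.mul mg).aestronglyMeasurable hgs.isCompact
      (fun x hx => ?_) (C := Bf * (Cg * ‖v‖)) ?_
    · rw [← inner_gradient_left, gradient_eq_zero_of_notMem_tsupport hx, inner_zero_left, mul_zero]
    intro x hx
    rw [norm_mul]
    exact mul_le_mul (hBf x hx) ((fderiv ℝ g x).le_of_opNorm_le (hCg x hx) v) (norm_nonneg _)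
      ((norm_nonneg _).trans (hBf x hx))
  have i3 : Integrable fun x => f x * g x :=
    (hf.continuous.mul hg.1.continuous).integrable_of_hasCompactSupport hgs.mul_left
  refine ⟨i1, i2, ?_⟩
  rw [integral_mul_fderiv_eq_neg_fderiv_mul_of_integrable i1 i2 i3 (fun x _ => hf x)
    (fun x _ => hg.1 x), neg_neg]

theorem integral_inner_gradient_eq {f χ : Euc d → ℝ} (hf : Differentiable ℝ f)
    (hχ : ContDiff ℝ ∞ χ) (hχs : HasCompactSupport χ) {C : ℝ}
    (hC : ∀ x ∈ tsupport χ, ‖fderiv ℝ f x‖ ≤ C) :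
    Integrable (fun x => ⟪gradient f x, gradient χ x⟫) ∧
      ∫ x, ⟪gradient f x, gradient χ x⟫ = - ∫ x, f x * laplSum χ x := by
  have hs : ∀ i : Fin d, tsupport (fun x => fderiv ℝ χ x (EuclideanSpace.single i 1))
      ⊆ tsupport χ := fun i => tsupport_fderiv_apply_subset ℝ _
  have key := fun i : Fin d => integral_fderiv_mul_eq hf
    (DLip.of_contDiff (contDiff_fderiv_apply hχ (EuclideanSpace.single i 1)))
    (hχs.mono' (subset_closure.trans (hs i))) (fun x hx => hC x (hs i hx)) (EuclideanSpace.single i 1)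
  have e : (fun x => ⟪gradient f x, gradient χ x⟫) = fun x => ∑ i,
      fderiv ℝ f x (EuclideanSpace.single i 1) * fderiv ℝ χ x (EuclideanSpace.single i 1) := by
    funext x
    rw [inner_eq_sum_single]
    simp only [inner_gradient_left]
  rw [e]
  refine ⟨integrable_finsetSum _ fun i _ => (key i).1, ?_⟩
  rw [integral_finsetSum _ fun i _ => (key i).1, Finset.sum_congr rfl fun i _ => (key i).2.2,
    Finset.sum_neg_distrib, ← integral_finsetSum _ fun i _ => (key i).2.1]
  congr 1
  refine integral_congr_ae (Eventually.of_forall fun x => ?_)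
  simp only [laplSum, Finset.mul_sum]

/-- The weak formulation agrees with the distributional one. -/
theorem integral_weak_eq {E : Euc d → Euc d} (hE : Continuous E) {f χ : Euc d → ℝ}
    (hf : Differentiable ℝ f) (hχ : ContDiff ℝ ∞ χ) (hχs : HasCompactSupport χ) {C : ℝ}
    (hC : ∀ x ∈ tsupport χ, ‖fderiv ℝ f x‖ ≤ C) :
    ∫ x, ⟪gradient f x + f x • E x, gradient χ x⟫ = - ∫ x, f x * adjOp E χ x := by
  obtain ⟨h1, h2⟩ := integral_inner_gradient_eq hf hχ hχs hC
  have hc : Continuous fun x => fderiv ℝ χ x (E x) :=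
    (hχ.continuous_fderiv (by simp)).clm_apply hE
  have hcs : HasCompactSupport fun x => fderiv ℝ χ x (E x) := by
    refine HasCompactSupport.intro hχs.isCompact fun x hx => ?_
    rw [← inner_gradient_left, gradient_eq_zero_of_notMem_tsupport hx, inner_zero_left]
  have h3 : Integrable fun x => f x * fderiv ℝ χ x (E x) :=
    (hf.continuous.mul hc).integrable_of_hasCompactSupport hcs.mul_left
  have h4 : Integrable fun x => f x * laplSum χ x := by
    refine (hf.continuous.mul (continuous_laplSum hχ)).integrable_of_hasCompactSupport ?_
    refine HasCompactSupport.mul_left (HasCompactSupport.intro hχs.isCompact fun x hx => ?_)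
    have hz : ∀ y : Euc d, adjOp (fun _ => (0 : Euc d)) χ y = laplSum χ y := fun y => by simp [adjOp]
    rw [← hz]
    exact image_eq_zero_of_notMem_tsupport fun hx' => hx (tsupport_adjOp_subset _ _ hx')
  have e1 : (fun x => ⟪gradient f x + f x • E x, gradient χ x⟫)
      = fun x => ⟪gradient f x, gradient χ x⟫ + f x * fderiv ℝ χ x (E x) := by
    funext x
    rw [inner_add_left, real_inner_smul_left, real_inner_gradient_right χ x (E x)]
  have e2 : (fun x => f x * adjOp E χ x)
      = fun x => f x * laplSum χ x - f x * fderiv ℝ χ x (E x) := by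
    funext x; rw [adjOp]; ring
  rw [e1, e2, integral_add h1 h3, integral_sub h4 h3, h2]
  ring

theorem hasFDerivAt_convolution_of_dLip {ρ φ : Euc d → ℝ} (hρ : Continuous ρ)
    (hρs : HasCompactSupport ρ) (hφ : DLip φ) {L : ℝ} (hL : ∀ x, ‖fderiv ℝ φ x‖ ≤ L)
    (x0 : Euc d) :
    HasFDerivAt (fun x => ∫ t, ρ t * φ (x - t)) (∫ t, ρ t • fderiv ℝ φ (x0 - t)) x0 := by
  have hρi : Integrable ρ := hρ.integrable_of_hasCompactSupport hρs
  have hc : ∀ x, Continuous fun t => ρ t * φ (x - t) := fun x =>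
    hρ.mul (hφ.1.continuous.comp (continuous_const.sub continuous_id))
  have hsub : Measurable fun t : Euc d => x0 - t := measurable_const.sub measurable_id
  refine hasFDerivAt_integral_of_dominated_of_fderiv_le (μ := volume)
    (F := fun x t => ρ t * φ (x - t)) (F' := fun x t => ρ t • fderiv ℝ φ (x - t))
    (s := univ) (bound := fun t => |ρ t| * L) univ_mem
    (Eventually.of_forall fun x => (hc x).aestronglyMeasurable)
    ((hc x0).integrable_of_hasCompactSupport hρs.mul_right) ?_ ?_ (hρi.abs.mul_const L) ?_
  · exact hρ.measurable.aestronglyMeasurable.smul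
      ((measurable_fderiv ℝ φ).comp hsub).aestronglyMeasurable
  · refine Eventually.of_forall fun t x _ => ?_
    rw [norm_smul, Real.norm_eq_abs]
    exact mul_le_mul_of_nonneg_left (hL _) (abs_nonneg _)
  · refine Eventually.of_forall fun t x _ => ?_
    have h1 : HasFDerivAt (fun y : Euc d => y - t) (ContinuousLinearMap.id ℝ _) x :=
      (hasFDerivAt_id x).sub_const t
    have h2 : HasFDerivAt (fun y => φ (y - t)) (fderiv ℝ φ (x - t)) x :=
      ((hφ.1 (x - t)).hasFDerivAt.comp x h1).congr_fderiv (ContinuousLinearMap.comp_id _)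
    exact h2.const_mul (ρ t)

/-- A vector field orthogonal to the gradients of all smooth tests is orthogonal to the gradients
of all Lipschitz tests. -/
theorem integral_inner_gradient_eq_zero_of_dLip {W : Euc d → Euc d} (hW : Measurable W)
    (hWb : ∀ R : ℝ, ∃ C, ∀ x, ‖x‖ ≤ R → ‖W x‖ ≤ C)
    (hw : ∀ φ : Euc d → ℝ, ContDiff ℝ ∞ φ → HasCompactSupport φ →
      ∫ x, ⟪W x, gradient φ x⟫ = 0) {φ : Euc d → ℝ} (hφ : DLip φ) (hs : HasCompactSupport φ) :
    ∫ x, ⟪W x, gradient φ x⟫ = 0 := by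
  obtain ⟨R, hR⟩ := hs.isCompact.isBounded.subset_closedBall (0 : Euc d)
  obtain ⟨L, hL0, hL'⟩ := hφ.exists_bound_on_compact hs.isCompact
  have hfd0 : ∀ x, x ∉ tsupport φ → fderiv ℝ φ x = 0 := fun x hx => by
    by_contra h
    exact hx (support_fderiv_subset ℝ h)
  have hL : ∀ x, ‖fderiv ℝ φ x‖ ≤ L := fun x => by
    by_cases hx : x ∈ tsupport φ
    · exact hL' x hx
    · rw [hfd0 x hx, norm_zero]; exact hL0
  have hfar : ∀ x, R < ‖x‖ → x ∉ tsupport φ := fun x hx hx' => by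
    have := hR hx'
    rw [mem_closedBall_zero_iff] at this
    linarith
  let b : ℕ → ContDiffBump (0 : Euc d) := fun n =>
    ⟨1 / ((n : ℝ) + 1) / 2, 1 / ((n : ℝ) + 1), by positivity, half_lt_self (by positivity)⟩
  have hbout : ∀ n, (b n).rOut = 1 / ((n : ℝ) + 1) := fun n => rfl
  have hb1 : ∀ n, (b n).rOut ≤ 1 := fun n => by
    rw [hbout, div_le_one (by positivity)]; linarith [n.cast_nonneg (α := ℝ)]
  let ρ : ℕ → Euc d → ℝ := fun n => (b n).normed volume
  have hρ0 : ∀ n t, 0 ≤ ρ n t := fun n t => (b n).nonneg_normed t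
  have hρz : ∀ n t, 1 ≤ ‖t‖ → ρ n t = 0 := fun n t ht => by
    by_contra h
    have : t ∈ Function.support (ρ n) := h
    rw [(b n).support_normed_eq, mem_ball_zero_iff] at this
    linarith [hb1 n]
  have hρc : ∀ n, ContDiff ℝ ∞ (ρ n) := fun n => (b n).contDiff_normed
  have hρs : ∀ n, HasCompactSupport (ρ n) := fun n => (b n).hasCompactSupport_normed
  have hρ1 : ∀ n, ∫ t, ρ n t = 1 := fun n => (b n).integral_normed
  have hρi : ∀ n, Integrable (ρ n) := fun n =>
    (hρc n).continuous.integrable_of_hasCompactSupport (hρs n)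
  set φn : ℕ → Euc d → ℝ := fun n x => ∫ t, ρ n t * φ (x - t) with hφn
  have hφnc : ∀ n, ContDiff ℝ ∞ (φn n) := fun n =>
    (hρs n).contDiff_convolution_left (ContinuousLinearMap.lsmul ℝ ℝ) (hρc n)
      hφ.1.continuous.locallyIntegrable
  have hφns : ∀ n, HasCompactSupport (φn n) := fun n => by
    refine hasCompactSupport_of_ball (r := R + 2) fun x hx => ?_
    refine integral_eq_zero_of_ae (Eventually.of_forall fun t => ?_)
    rcases lt_or_ge ‖t‖ 1 with ht | ht
    · have : R < ‖x - t‖ := by linarith [norm_sub_norm_le x t]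
      simp [image_eq_zero_of_notMem_tsupport (hfar _ this)]
    · simp [hρz n t ht]
  have hgr : ∀ n x, fderiv ℝ (φn n) x = ∫ t, ρ n t • fderiv ℝ φ (x - t) := fun n x =>
    (hasFDerivAt_convolution_of_dLip (hρc n).continuous (hρs n) hφ hL x).fderiv
  have hloc : LocallyIntegrable (fun x => fderiv ℝ φ x) := by
    refine Integrable.locallyIntegrable ?_
    exact integrable_of_bounded_on_compact (measurable_fderiv ℝ φ).aestronglyMeasurable
      hs.isCompact hfd0 hL'
  have hae : ∀ᵐ x, Tendsto (fun n => fderiv ℝ (φn n) x) atTop (𝓝 (fderiv ℝ φ x)) := by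
    have := ContDiffBump.ae_convolution_tendsto_right_of_locallyIntegrable (μ := volume)
      (φ := b) (l := atTop) (K := 2) (g := fun x => fderiv ℝ φ x)
      (tendsto_one_div_add_atTop_nhds_zero_nat (𝕜 := ℝ)) (Eventually.of_forall fun n => by
        change 1 / ((n : ℝ) + 1) ≤ 2 * (1 / ((n : ℝ) + 1) / 2)
        linarith) hloc
    filter_upwards [this] with x hx
    refine hx.congr fun n => ?_
    rw [hgr]
    rfl
  obtain ⟨C, hC⟩ := hWb (R + 1)
  have hlim : Tendsto (fun n => ∫ x, ⟪W x, gradient (φn n) x⟫) atTop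
      (𝓝 (∫ x, ⟪W x, gradient φ x⟫)) := by
    refine tendsto_integral_of_dominated_convergence
      ((closedBall (0 : Euc d) (R + 1)).indicator fun _ => C * L) ?_ ?_ ?_ ?_
    · exact fun n => (hW.inner (measurable_gradient _)).aestronglyMeasurable
    · exact (integrableOn_const (isCompact_closedBall _ _).measure_lt_top.ne).integrable_indicator
        measurableSet_closedBall
    · refine fun n => Eventually.of_forall fun x => ?_
      rw [real_inner_gradient_right]
      by_cases hx : ‖x‖ ≤ R + 1
      · rw [indicator_of_mem (by simpa using hx)]
        have h1 : ‖fderiv ℝ (φn n) x‖ ≤ L := by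
          rw [hgr]
          calc ‖∫ t, ρ n t • fderiv ℝ φ (x - t)‖ ≤ ∫ t, ρ n t * L :=
                norm_integral_le_of_norm_le ((hρi n).mul_const L) (Eventually.of_forall fun t => by
                  rw [norm_smul, Real.norm_of_nonneg (hρ0 n t)]
                  exact mul_le_mul_of_nonneg_left (hL _) (hρ0 n t))
            _ = L := by rw [integral_mul_const, hρ1, one_mul]
        refine ((fderiv ℝ (φn n) x).le_opNorm _).trans ?_
        rw [mul_comm]
        exact mul_le_mul (hC x hx) h1 (norm_nonneg _) ((norm_nonneg _).trans (hC x hx))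
      · rw [indicator_of_notMem (by simpa using hx), hgr]
        have : ∫ t, ρ n t • fderiv ℝ φ (x - t) = 0 := by
          refine integral_eq_zero_of_ae (Eventually.of_forall fun t => ?_)
          rcases lt_or_ge ‖t‖ 1 with ht | ht
          · have : R < ‖x - t‖ := by
              push Not at hx
              linarith [norm_sub_norm_le x t]
            simp [hfd0 _ (hfar _ this)]
          · simp [hρz n t ht]
        rw [this]; simp
    · filter_upwards [hae] with x hx
      simp only [real_inner_gradient_right]
      exact ((ContinuousLinearMap.apply ℝ ℝ (W x)).continuous.tendsto _).comp hx
  refine tendsto_nhds_unique hlim (tendsto_const_nhds.congr fun n => ?_)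
  exact (hw _ (hφnc n) (hφns n)).symm

theorem contDiff_cutR (r : ℝ) : ContDiff ℝ ∞ (cutR r : Euc d → ℝ) :=
  contDiff_cut.comp ((contDiff_norm_sq ℝ).div_const _)

theorem hasCompactSupport_cutR {r : ℝ} (hr : 0 < r) : HasCompactSupport (cutR r : Euc d → ℝ) :=
  hasCompactSupport_of_ball (r := r) fun _ hz => cutR_eq_zero hr hz

theorem adjOp_cutR (E : Euc d → Euc d) (r : ℝ) (x : Euc d) :
    adjOp E (cutR r) x = 4 * ‖x‖ ^ 2 * (deriv (deriv cut) (‖x‖ ^ 2 / r ^ 2) / r ^ 2 / r ^ 2)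
      + 2 * d * (deriv cut (‖x‖ ^ 2 / r ^ 2) / r ^ 2)
      - 2 * (deriv cut (‖x‖ ^ 2 / r ^ 2) / r ^ 2) * ⟪x, E x⟫ := by
  have h1 : ∀ s : ℝ, HasDerivAt (fun s => cut (s / r ^ 2)) (deriv cut (s / r ^ 2) / r ^ 2) s :=
    fun s => by
      have := (hasDerivAt_cut (s / r ^ 2)).comp s ((hasDerivAt_id s).div_const (r ^ 2))
      rw [mul_one_div] at this
      exact this
  have hd2 : Differentiable ℝ (deriv cut) :=
    (contDiff_infty_iff_deriv.1 contDiff_cut).2.differentiable (by simp)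
  have h2 : ∀ s : ℝ, HasDerivAt (fun s => deriv cut (s / r ^ 2) / r ^ 2)
      (deriv (deriv cut) (s / r ^ 2) / r ^ 2 / r ^ 2) s := fun s => by
    have := ((hd2 (s / r ^ 2)).hasDerivAt.comp s
      ((hasDerivAt_id s).div_const (r ^ 2))).div_const (r ^ 2)
    rw [mul_one_div] at this
    exact this
  have e : (cutR r : Euc d → ℝ) = fun y => cut (‖y - 0‖ ^ 2 / r ^ 2) := by
    funext y; simp [cutR]
  rw [adjOp, e, laplSum_radial 0 x (fun s _ => h1 s) (fun s _ => h2 s),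
    fderiv_radial (h := fun s => cut (s / r ^ 2)) 0 x (E x) (h1 _)]
  simp

theorem exists_deriv_deriv_cut_bound :
    ∃ C, 0 < C ∧ ∀ s, 0 ≤ s → s ≤ 1 → |deriv (deriv cut) s| ≤ C := by
  have hc : Continuous (deriv (deriv cut)) :=
    (contDiff_infty_iff_deriv.1 contDiff_cut).2.continuous_deriv (by simp)
  obtain ⟨C, hC⟩ := (isCompact_Icc (a := (0 : ℝ)) (b := 1)).exists_bound_of_continuousOn
    hc.continuousOn
  exact ⟨max C 1, by positivity, fun s h0 h1 => (hC s ⟨h0, h1⟩).trans (le_max_left _ _)⟩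

theorem adjOp_cutR_eq_zero (E : Euc d → Euc d) {r : ℝ} (hr : 0 < r) {x : Euc d}
    (hx : ‖x‖ ^ 2 < r ^ 2 / 2) : adjOp E (cutR r) x = 0 := by
  have hlt : ‖x‖ ^ 2 / r ^ 2 < 1 / 2 := by
    rw [div_lt_iff₀ (by positivity)]; linarith
  have h1 : deriv cut (‖x‖ ^ 2 / r ^ 2) = 0 := deriv_cut_eq_zero_of_le hlt.le
  have h2 : deriv (deriv cut) (‖x‖ ^ 2 / r ^ 2) = 0 := by
    have : deriv cut =ᶠ[𝓝 (‖x‖ ^ 2 / r ^ 2)] fun _ => 0 := by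
      filter_upwards [Iio_mem_nhds hlt] with s hs
      exact deriv_cut_eq_zero_of_le (le_of_lt hs)
    rw [this.deriv_eq]; simp
  rw [adjOp_cutR, h1, h2]; simp

theorem exists_adjOp_cutR_bound {E : Euc d → Euc d} {c : ℝ}
    (hE : ∀ x, |⟪x, E x⟫| ≤ c * (1 + ‖x‖ ^ 2)) :
    ∃ C, 0 ≤ C ∧ ∀ r : ℝ, 1 ≤ r → ∀ x, |adjOp E (cutR r) x| ≤ C := by
  obtain ⟨C1, hC1, h1⟩ := exists_deriv_cut_bound
  obtain ⟨C2, hC2, h2⟩ := exists_deriv_deriv_cut_bound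
  have hc : 0 ≤ c := by
    have := (abs_nonneg _).trans (hE 0)
    simpa using this
  refine ⟨4 * C2 + 2 * d * C1 + 4 * C1 * c, by positivity, fun r hr x => ?_⟩
  have hr0 : 0 < r := by linarith
  have hr2 : 1 ≤ r ^ 2 := by nlinarith
  rcases le_or_gt (‖x‖ ^ 2) (r ^ 2) with hx | hx
  · rw [adjOp_cutR]
    set s := ‖x‖ ^ 2 / r ^ 2 with hs
    have hs1 : s ≤ 1 := by rw [hs, div_le_one (by positivity)]; exact hx
    have hs0 : 0 ≤ s := by positivity
    have e : 4 * ‖x‖ ^ 2 * (deriv (deriv cut) s / r ^ 2 / r ^ 2) + 2 * d * (deriv cut s / r ^ 2)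
        - 2 * (deriv cut s / r ^ 2) * ⟪x, E x⟫
        = 4 * (s / r ^ 2) * deriv (deriv cut) s + 2 * d * (1 / r ^ 2) * deriv cut s
          - 2 * (⟪x, E x⟫ / r ^ 2) * deriv cut s := by
      rw [hs]; ring
    rw [e]
    have b1 : |4 * (s / r ^ 2) * deriv (deriv cut) s| ≤ 4 * C2 := by
      rw [abs_mul, abs_of_nonneg (by positivity)]
      have : s / r ^ 2 ≤ 1 := by rw [div_le_one (by positivity)]; linarith
      have h := h2 s hs0 hs1
      calc 4 * (s / r ^ 2) * |deriv (deriv cut) s| ≤ 4 * 1 * C2 := by gcongr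
        _ = _ := by ring
    have b2 : |2 * d * (1 / r ^ 2) * deriv cut s| ≤ 2 * d * C1 := by
      rw [abs_mul, abs_of_nonneg (by positivity)]
      have : 1 / r ^ 2 ≤ 1 := by rw [div_le_one (by positivity)]; linarith
      have h := h1 s
      calc 2 * d * (1 / r ^ 2) * |deriv cut s| ≤ 2 * d * 1 * C1 := by gcongr
        _ = _ := by ring
    have b3 : |2 * (⟪x, E x⟫ / r ^ 2) * deriv cut s| ≤ 4 * C1 * c := by
      rw [abs_mul, abs_mul, abs_div, abs_of_nonneg (by positivity : (0 : ℝ) ≤ r ^ 2), abs_two]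
      have : |⟪x, E x⟫| / r ^ 2 ≤ 2 * c := by
        rw [div_le_iff₀ (by positivity)]
        have := hE x
        nlinarith
      have h := h1 s
      calc 2 * (|⟪x, E x⟫| / r ^ 2) * |deriv cut s| ≤ 2 * (2 * c) * C1 := by gcongr
        _ = _ := by ring
    refine (abs_sub _ _).trans ?_
    linarith [abs_add_le (4 * (s / r ^ 2) * deriv (deriv cut) s) (2 * d * (1 / r ^ 2) * deriv cut s)]
  · have hx' : x ∉ tsupport (cutR r : Euc d → ℝ) := by
      have : cutR r =ᶠ[𝓝 x] (0 : Euc d → ℝ) := by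
        filter_upwards [(isOpen_lt continuous_const (continuous_norm.pow 2)).mem_nhds hx] with y hy
        exact cutR_eq_zero hr0 (by
          have : r ^ 2 < ‖y‖ ^ 2 := hy
          nlinarith [norm_nonneg y])
      exact notMem_tsupport_iff_eventuallyEq.2 this
    rw [image_eq_zero_of_notMem_tsupport fun h => hx' (tsupport_adjOp_subset E _ h), abs_zero]
    positivity

theorem tendsto_integral_mul_adjOp_cutR {E : Euc d → Euc d} (hEc : Continuous E) {c : ℝ}
    (hE : ∀ x, |⟪x, E x⟫| ≤ c * (1 + ‖x‖ ^ 2)) {w : Euc d → ℝ} (hw : Integrable w) :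
    Tendsto (fun n : ℕ => ∫ x, w x * adjOp E (cutR ((n : ℝ) + 1)) x) atTop (𝓝 0) := by
  obtain ⟨C, hC0, hC⟩ := exists_adjOp_cutR_bound hE
  have h := tendsto_integral_of_dominated_convergence (μ := volume)
    (F := fun (n : ℕ) x => w x * adjOp E (cutR ((n : ℝ) + 1)) x) (f := fun _ => 0)
    (fun x => |w x| * C)
    (fun n => hw.aestronglyMeasurable.mul
      (continuous_adjOp hEc (contDiff_cutR _)).aestronglyMeasurable) (hw.abs.mul_const C)
    (fun n => Eventually.of_forall fun x => by
      rw [norm_mul]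
      exact mul_le_mul_of_nonneg_left (hC _ (by linarith [n.cast_nonneg (α := ℝ)]) x)
        (norm_nonneg _))
    (Eventually.of_forall fun x => by
      refine tendsto_const_nhds.congr' ?_
      filter_upwards [eventually_ge_atTop (Nat.ceil (2 * ‖x‖))] with n hn
      have hn' : 2 * ‖x‖ ≤ n := (Nat.le_ceil _).trans (by exact_mod_cast hn)
      rw [adjOp_cutR_eq_zero E (by positivity) (by nlinarith [norm_nonneg x]), mul_zero])
  simpa using h

theorem cutR_eq_one {r : ℝ} (hr : 0 < r) {x : Euc d} (hx : ‖x‖ ^ 2 ≤ r ^ 2 / 2) :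
    cutR r x = 1 :=
  cut_eq_one (by rw [div_le_iff₀ (by positivity)]; linarith)

theorem DLip.inner_single {E : Euc d → Euc d} (hE : H0 E) (v : Euc d) :
    DLip fun x => ⟪E x, v⟫ := by
  have h : ∀ x, HasFDerivAt (fun x => ⟪E x, v⟫) ((innerSL ℝ v).comp (fderiv ℝ E x)) x := fun x => by
    have := (innerSL ℝ v).hasFDerivAt.comp x (hE.1 x).hasFDerivAt
    refine this.congr_of_eventuallyEq (Eventually.of_forall fun y => ?_)
    simp [real_inner_comm]
  refine ⟨fun x => (h x).differentiableAt, fun R => ?_⟩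
  obtain ⟨C, hC⟩ := hE.2 R
  refine ⟨‖v‖ * C, fun x hx => ?_⟩
  rw [(h x).fderiv]
  refine (ContinuousLinearMap.opNorm_comp_le _ _).trans ?_
  rw [innerSL_apply_norm]
  have := hC x hx
  have := norm_nonneg (E x)
  gcongr
  linarith

theorem fderiv_inner_const {E : Euc d → Euc d} {x : Euc d} (hE : DifferentiableAt ℝ E x)
    (v w : Euc d) : fderiv ℝ (fun x => ⟪E x, v⟫) x w = ⟪fderiv ℝ E x w, v⟫ := by
  rw [fderiv_inner_apply ℝ hE (differentiableAt_const v)]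
  simp

theorem clm_apply_eq_sum_single (A : Euc d →L[ℝ] ℝ) (v : Euc d) :
    A v = ∑ i, A (EuclideanSpace.single i 1) * ⟪v, EuclideanSpace.single i (1 : ℝ)⟫ := by
  have : v = ∑ i, ⟪v, EuclideanSpace.single i (1 : ℝ)⟫ • EuclideanSpace.single i (1 : ℝ) := by
    have := (EuclideanSpace.basisFun (Fin d) ℝ).sum_repr v
    simpa [EuclideanSpace.inner_single_right] using this.symm
  conv_lhs => rw [this]
  simp [mul_comm]

/-- Integration by parts of a transport term. -/
theorem integral_transport_eq {E : Euc d → Euc d} (hE : H0 E) {Q χ : Euc d → ℝ} (hQ : DLip Q)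
    (hχ : ContDiff ℝ ∞ χ) (hχs : HasCompactSupport χ) :
    Integrable (fun x => fderiv ℝ Q x (E x) * χ x) ∧
    Integrable (fun x => Q x * (χ x * dvg E x)) ∧
    Integrable (fun x => Q x * fderiv ℝ χ x (E x)) ∧
    ∫ x, fderiv ℝ Q x (E x) * χ x
      = - (∫ x, Q x * (χ x * dvg E x)) - ∫ x, Q x * fderiv ℝ χ x (E x) := by
  have hχd := DLip.of_contDiff hχ
  have hs : ∀ i : Fin d, HasCompactSupport
      fun x => χ x * ⟪E x, EuclideanSpace.single i (1 : ℝ)⟫ := fun i => hχs.mul_right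
  have hD : ∀ i : Fin d, DLip fun x => χ x * ⟪E x, EuclideanSpace.single i (1 : ℝ)⟫ := fun i =>
    hχd.mul (DLip.inner_single hE _)
  obtain ⟨C, hC0, hC⟩ := hQ.exists_bound_on_compact hχs.isCompact
  have key := fun i : Fin d => integral_fderiv_mul_eq hQ.1 (hD i) (hs i)
    (C := C) (fun x hx => hC x (tsupport_mul_subset_left hx)) (EuclideanSpace.single i 1)
  have e1 : (fun x => fderiv ℝ Q x (E x) * χ x) = fun x => ∑ i,
      fderiv ℝ Q x (EuclideanSpace.single i 1)
        * (χ x * ⟪E x, EuclideanSpace.single i (1 : ℝ)⟫) := by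
    funext x
    rw [clm_apply_eq_sum_single, Finset.sum_mul]
    exact Finset.sum_congr rfl fun i _ => by ring
  have e2 : ∀ x, ∑ i, Q x * fderiv ℝ (fun x => χ x * ⟪E x, EuclideanSpace.single i (1 : ℝ)⟫) x
      (EuclideanSpace.single i 1) = Q x * (χ x * dvg E x) + Q x * fderiv ℝ χ x (E x) := by
    intro x
    rw [clm_apply_eq_sum_single (fderiv ℝ χ x) (E x), dvg, Finset.mul_sum, Finset.mul_sum,
      Finset.mul_sum, ← Finset.sum_add_distrib]
    refine Finset.sum_congr rfl fun i _ => ?_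
    rw [fderiv_fun_mul (hχd.1 x) ((DLip.inner_single hE _).1 x)]
    simp only [add_apply, smul_apply, smul_eq_mul,
      fderiv_inner_const (hE.1 x)]
    ring
  have i3 : Integrable fun x => Q x * fderiv ℝ χ x (E x) := by
    refine Continuous.integrable_of_hasCompactSupport (hQ.1.continuous.mul
      ((hχ.continuous_fderiv (by simp)).clm_apply hE.1.continuous))
      (HasCompactSupport.mul_left (HasCompactSupport.intro hχs.isCompact fun x hx => ?_))
    rw [← inner_gradient_left, gradient_eq_zero_of_notMem_tsupport hx, inner_zero_left]
  have i12 := integrable_finsetSum Finset.univ fun i _ => (key i).2.1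
  have i2 : Integrable fun x => Q x * (χ x * dvg E x) := by
    refine (i12.sub i3).congr (Eventually.of_forall fun x => ?_)
    simp only [Pi.sub_apply, e2]
    ring
  refine ⟨?_, i2, i3, ?_⟩
  · rw [e1]
    exact integrable_finsetSum _ fun i _ => (key i).1
  · rw [e1, integral_finsetSum _ fun i _ => (key i).1, Finset.sum_congr rfl fun i _ => (key i).2.2,
      Finset.sum_neg_distrib, ← integral_finsetSum _ fun i _ => (key i).2.1]
    simp only [e2]
    rw [integral_add i2 i3]
    ring

/-- The points near which the derivative of `G` is bounded. -/
def bddFDerivSet (G : Euc d → ℝ) : Set (Euc d) :=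
  {x | ∃ C, ∀ᶠ y in 𝓝 x, ‖fderiv ℝ G y‖ ≤ C}

theorem isOpen_bddFDerivSet (G : Euc d → ℝ) : IsOpen (bddFDerivSet G) := by
  refine isOpen_iff_mem_nhds.2 fun x hx => ?_
  obtain ⟨C, hC⟩ := hx
  filter_upwards [hC.eventually_nhds] with y hy
  exact ⟨C, hy⟩

theorem exists_bound_of_subset_bddFDerivSet {G : Euc d → ℝ} {K : Set (Euc d)} (hK : IsCompact K)
    (h : K ⊆ bddFDerivSet G) : ∃ C, ∀ x ∈ K, ‖fderiv ℝ G x‖ ≤ C := by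
  refine hK.induction_on (p := fun s => ∃ C, ∀ x ∈ s, ‖fderiv ℝ G x‖ ≤ C) ⟨0, by simp⟩
    (fun s t hst ⟨C, hC⟩ => ⟨C, fun x hx => hC x (hst hx)⟩) ?_ ?_
  · rintro s t ⟨C, hC⟩ ⟨C', hC'⟩
    refine ⟨max C C', fun x hx => ?_⟩
    rcases hx with hx | hx
    · exact (hC x hx).trans (le_max_left _ _)
    · exact (hC' x hx).trans (le_max_right _ _)
  · intro x hx
    obtain ⟨C, hC⟩ := h hx
    exact ⟨_, mem_nhdsWithin_of_mem_nhds hC, C, fun y hy => hy⟩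

/-- The points at which `G` satisfies a Lipschitz estimate with constant `n` at scale
`1 / (n + 1)`. -/
def lipSet (G : Euc d → ℝ) (n : ℕ) : Set (Euc d) :=
  {x | ∀ v : Euc d, ‖v‖ < 1 / ((n : ℝ) + 1) → |G (x + v) - G x| ≤ n * ‖v‖}

theorem isClosed_lipSet {G : Euc d → ℝ} (hG : Continuous G) (n : ℕ) : IsClosed (lipSet G n) := by
  simp only [lipSet, Set.ofPred_forall]
  refine isClosed_iInter fun v => isClosed_iInter fun _ => isClosed_le ?_ continuous_const
  fun_prop

theorem exists_mem_lipSet {G : Euc d → ℝ} (hG : Differentiable ℝ G) (x : Euc d) :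
    ∃ n, x ∈ lipSet G n := by
  obtain ⟨C, hC⟩ := (hG x).isBigO_sub.bound
  rw [Metric.eventually_nhds_iff] at hC
  obtain ⟨ε, hε, h⟩ := hC
  obtain ⟨n, hn⟩ := exists_nat_ge (max C (1 / ε))
  refine ⟨n, fun v hv => ?_⟩
  have h1 : 1 / ((n : ℝ) + 1) < ε := by
    rw [div_lt_iff₀ (by positivity)]
    have : 1 / ε ≤ n := (le_max_right _ _).trans hn
    rw [div_le_iff₀ hε] at this
    nlinarith
  have := h (y := x + v) (by simpa [dist_eq_norm] using hv.trans h1)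
  rw [add_sub_cancel_left] at this
  exact this.trans (mul_le_mul_of_nonneg_right ((le_max_left _ _).trans hn) (norm_nonneg _))

/-- A differentiable weak solution has locally bounded derivative, even if the weak formulation
is only known with the convention that non-integrable functions have zero integral. -/
theorem dLip_of_weak (hd : 1 ≤ d) {E : Euc d → Euc d} (hE : H0 E) {G : Euc d → ℝ}
    (hG : Differentiable ℝ G)
    (hw : ∀ φ : Euc d → ℝ, ContDiff ℝ ∞ φ → HasCompactSupport φ →
      ∫ x, ⟪gradient G x + G x • E x, gradient φ x⟫ = 0) : DLip G := by
  have hEc : Continuous E := hE.1.continuous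
  suffices hU : bddFDerivSet G = univ by
    refine ⟨hG, fun R => ?_⟩
    obtain ⟨C, hC⟩ := exists_bound_of_subset_bddFDerivSet (G := G)
      (isCompact_closedBall (0 : Euc d) R) (by rw [hU]; exact subset_univ _)
    exact ⟨C, fun x hx => hC x (by simpa using hx)⟩
  by_contra hne
  set S := (bddFDerivSet G)ᶜ with hS
  have hSc : IsClosed S := (isOpen_bddFDerivSet G).isClosed_compl
  have hSne : S.Nonempty := nonempty_compl.2 hne
  have heq : ∀ φ : Euc d → ℝ, ContDiff ℝ ∞ φ → HasCompactSupport φ →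
      tsupport φ ⊆ bddFDerivSet G → ∫ x, G x * adjOp E φ x = 0 := fun φ h1 h2 h3 => by
    obtain ⟨C, hC⟩ := exists_bound_of_subset_bddFDerivSet h2.isCompact h3
    have := integral_weak_eq hEc hG h1 h2 hC
    rw [hw φ h1 h2] at this
    linarith
  obtain ⟨C, hC, key⟩ := exists_interior_lipschitz hd
  have : CompleteSpace S := hSc.completeSpace_coe
  have : Nonempty S := hSne.to_subtype
  obtain ⟨n, hn⟩ := nonempty_interior_of_iUnion_of_closed
    (f := fun n : ℕ => ((↑) : S → Euc d) ⁻¹' lipSet G n)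
    (fun n => (isClosed_lipSet hG.continuous n).preimage continuous_subtype_val)
    (eq_univ_of_forall fun x => mem_iUnion.2 (exists_mem_lipSet hG x))
  obtain ⟨⟨p, hpS⟩, hp⟩ := hn
  obtain ⟨ρ, hρ, hball⟩ := Metric.mem_nhds_iff.1 (mem_interior_iff_mem_nhds.1 hp)
  have hlip : ∀ s ∈ S, dist s p < ρ → s ∈ lipSet G n := fun s hs hsp => by
    have : (⟨s, hs⟩ : S) ∈ ball (⟨p, hpS⟩ : S) ρ := hsp
    exact hball this
  obtain ⟨M1, hM1, hEM⟩ := exists_norm_le_of_continuous hEc (‖p‖ + 2)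
  obtain ⟨L1, hL1, hEL⟩ := hE.lipBalls (‖p‖ + 2)
  obtain ⟨B', hB'⟩ := (isCompact_closedBall (0 : Euc d) (‖p‖ + 2)).exists_bound_of_continuousOn
    hG.continuous.continuousOn
  set B := max B' 0
  have hB : ∀ x : Euc d, ‖x‖ ≤ ‖p‖ + 2 → |G x| ≤ B := fun x hx =>
    (hB' x (by simpa using hx)).trans (le_max_left _ _)
  have hB0 : 0 ≤ B := le_max_right _ _
  set M := M1 + L1 + 1
  have hM : 0 < M := by positivity
  set δ : ℝ := 1 / ((n : ℝ) + 1) with hδ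
  have hδ0 : 0 < δ := by positivity
  set r := min (min (ρ / 2) (δ / 2)) (min 1 (1 / (C * M))) with hr
  have hr0 : 0 < r := by positivity
  have hrρ : r ≤ ρ / 2 := (min_le_left _ _).trans (min_le_left _ _)
  have hrδ : r ≤ δ / 2 := (min_le_left _ _).trans (min_le_right _ _)
  have hr1 : r ≤ 1 := (min_le_right _ _).trans (min_le_left _ _)
  have hrM : C * M * r ≤ 1 := by
    have : r ≤ 1 / (C * M) := (min_le_right _ _).trans (min_le_right _ _)
    calc C * M * r ≤ C * M * (1 / (C * M)) := by gcongr
      _ = 1 := by field_simp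
  refine hpS ⟨max n (C * (8 * n + M * B)), ?_⟩
  filter_upwards [ball_mem_nhds p hr0] with y hy
  have hyp : dist y p < r := hy
  by_cases hyS : y ∈ S
  · refine le_trans (norm_fderiv_le_of_lip' ℝ n.cast_nonneg ?_) (le_max_left _ _)
    filter_upwards [ball_mem_nhds y hδ0] with z hz
    have := hlip y hyS (by linarith) (z - y) (by rw [← dist_eq_norm]; exact hz)
    rwa [add_sub_cancel] at this
  · obtain ⟨s, hsS, hs⟩ := hSc.exists_infDist_eq_dist hSne y
    have hpos : 0 < dist y s := by
      refine dist_pos.2 fun h => hyS (h ▸ hsS)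
    have hle : dist y s ≤ dist y p := hs ▸ infDist_le_dist_of_mem hpS
    have hslip : s ∈ lipSet G n := hlip s hsS (by
      have := dist_triangle s y p
      rw [dist_comm s y] at this
      linarith)
    set r0 := dist y s / 4 with hr0'
    have hr0pos : 0 < r0 := by positivity
    have hr0r : r0 ≤ r := by linarith
    have hin : ∀ z ∈ ball y (2 * r0), ‖z‖ ≤ ‖p‖ + 2 := fun z hz => by
      have h1 : dist z p < 2 := by
        have := dist_triangle z y p
        have : dist z y < 2 * r0 := hz
        linarith
      rw [dist_eq_norm] at h1
      have := norm_add_le p (z - p)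
      rw [add_sub_cancel] at this
      linarith
    have hsub : ball y (2 * r0) ⊆ bddFDerivSet G := fun z hz => by
      by_contra hzS
      have h1 : dist y s ≤ dist y z := hs ▸ infDist_le_dist_of_mem (show z ∈ S from hzS)
      have h2 : dist z y < 2 * r0 := hz
      rw [dist_comm] at h2
      linarith
    have hη : ∀ z ∈ ball y (2 * r0), |G z - G s| ≤ 8 * n * r0 := fun z hz => by
      have h1 : dist z s ≤ 8 * r0 := by
        have := dist_triangle z y s
        have : dist z y < 2 * r0 := hz
        linarith
      have h2 : dist z s < δ := by
        have := dist_triangle z y s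
        have : dist z y < 2 * r0 := hz
        linarith
      rw [dist_eq_norm] at h1 h2
      have := hslip (z - s) h2
      rw [add_sub_cancel] at this
      refine this.trans ?_
      have := mul_le_mul_of_nonneg_left h1 (n.cast_nonneg (α := ℝ))
      linarith
    refine le_trans (norm_fderiv_le_of_lip' ℝ (by positivity) ?_) (le_max_right _ _)
    filter_upwards [ball_mem_nhds y hr0pos] with z hz
    have := key E G y M B (8 * n * r0) (G s) r0 hEc hG.continuous hM.le hB0 (by positivity)
      hr0pos (by linarith) (by
        refine le_trans ?_ hrM
        gcongr)
      (fun z hz => (hEM z (hin z hz)).trans (by simp only [M]; linarith))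
      (fun z hz z' hz' => (hEL z z' (hin z hz) (hin z' hz')).trans (by
        gcongr; simp only [M]; linarith))
      (fun z hz => hB z (hin z hz)) hη
      (fun φ h1 h2 h3 => heq φ h1 h2 (h3.trans hsub)) (z - y) (by simpa [dist_eq_norm] using hz)
    rw [add_sub_cancel] at this
    refine this.trans ?_
    rw [mul_div_cancel_right₀ _ hr0pos.ne']
    have h5 : r0 * M * B ≤ M * B := by
      have := mul_le_mul_of_nonneg_right (hr0r.trans hr1) (by positivity : 0 ≤ M * B)
      linarith
    calc C * ‖z - y‖ * (8 * n + r0 * M * B) ≤ C * ‖z - y‖ * (8 * n + M * B) := by gcongr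
      _ = _ := by ring

theorem eq_of_fderiv_ae_eq_zero {h : Euc d → ℝ} (hh : DLip h) (h0 : ∀ᵐ x, fderiv ℝ h x = 0)
    (x y : Euc d) : h x = h y := by
  set m := max ‖x‖ ‖y‖ with hm
  have hm0 : 0 ≤ m := (norm_nonneg x).trans (le_max_left _ _)
  set R := 2 * (m + 2) with hR
  have hR0 : 0 < R := by positivity
  set φ : Euc d → ℝ := fun z => h z * cutR R z with hφ
  have hφD : DLip φ := hh.mul (DLip.of_contDiff (contDiff_cutR R))
  have hφs : HasCompactSupport φ := (hasCompactSupport_cutR hR0).mul_left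
  have heq : ∀ z : Euc d, ‖z‖ < m + 2 → φ z = h z := fun z hz => by
    simp only [hφ]
    rw [cutR_eq_one hR0 (by nlinarith [norm_nonneg z]), mul_one]
  have heq' : ∀ z : Euc d, ‖z‖ < m + 2 → fderiv ℝ φ z = fderiv ℝ h z := fun z hz => by
    refine Filter.EventuallyEq.fderiv_eq ?_
    filter_upwards [(isOpen_lt continuous_norm continuous_const).mem_nhds hz] with w hw
    exact heq w hw
  obtain ⟨L, hL0, hL'⟩ := hφD.exists_bound_on_compact hφs.isCompact
  have hL : ∀ z, ‖fderiv ℝ φ z‖ ≤ L := fun z => by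
    by_cases hz : z ∈ tsupport φ
    · exact hL' z hz
    · rw [← norm_gradient, gradient_eq_zero_of_notMem_tsupport hz, norm_zero]; exact hL0
  let b : ℕ → ContDiffBump (0 : Euc d) := fun n =>
    ⟨1 / ((n : ℝ) + 1) / 2, 1 / ((n : ℝ) + 1), by positivity, half_lt_self (by positivity)⟩
  have hb1 : ∀ n, (b n).rOut ≤ 1 := fun n => by
    change 1 / ((n : ℝ) + 1) ≤ 1
    rw [div_le_one (by positivity)]; linarith [n.cast_nonneg (α := ℝ)]
  have hρz : ∀ n t, 1 ≤ ‖t‖ → (b n).normed volume t = 0 := fun n t ht => by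
    by_contra h
    have : t ∈ Function.support ((b n).normed volume) := h
    rw [(b n).support_normed_eq, mem_ball_zero_iff] at this
    linarith [hb1 n]
  have hlim : ∀ z : Euc d, Tendsto (fun n => ∫ t, (b n).normed volume t * φ (z - t)) atTop
      (𝓝 (φ z)) := fun z =>
    ContDiffBump.convolution_tendsto_right_of_continuous (φ := b)
      (tendsto_one_div_add_atTop_nhds_zero_nat (𝕜 := ℝ)) hφD.1.continuous z
  have hconst : ∀ n, ∫ t, (b n).normed volume t * φ (x - t)
      = ∫ t, (b n).normed volume t * φ (y - t) := fun n => by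
    have hder : ∀ z ∈ closedBall (0 : Euc d) m, HasFDerivWithinAt
        (fun z => ∫ t, (b n).normed volume t * φ (z - t)) (0 : Euc d →L[ℝ] ℝ)
        (closedBall 0 m) z := fun z hz => by
      have hz' : ‖z‖ ≤ m := by simpa using hz
      have := hasFDerivAt_convolution_of_dLip (ρ := (b n).normed volume)
        ((b n).contDiff_normed (n := (⊤ : ℕ∞))).continuous (b n).hasCompactSupport_normed hφD hL z
      refine (this.congr_fderiv ?_).hasFDerivWithinAt
      refine integral_eq_zero_of_ae ?_
      have hae : ∀ᵐ t, fderiv ℝ h (z - t) = 0 :=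
        (Measure.measurePreserving_sub_left volume z).quasiMeasurePreserving.ae h0
      filter_upwards [hae] with t ht
      rcases lt_or_ge ‖t‖ 1 with h1 | h1
      · rw [heq' _ (by linarith [norm_sub_le z t]), ht]; simp
      · rw [hρz n t h1]; simp
    have := (convex_closedBall (0 : Euc d) m).norm_image_sub_le_of_norm_hasFDerivWithin_le
      (C := 0) hder (fun z _ => by simp) (x := y) (y := x)
      (mem_closedBall_zero_iff.2 (le_max_right _ _)) (mem_closedBall_zero_iff.2 (le_max_left _ _))
    rw [zero_mul, norm_le_zero_iff, sub_eq_zero] at this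
    exact this
  have hx : ‖x‖ < m + 2 := by linarith [le_max_left ‖x‖ ‖y‖]
  have hy : ‖y‖ < m + 2 := by linarith [le_max_right ‖x‖ ‖y‖]
  rw [← heq x hx, ← heq y hy]
  exact tendsto_nhds_unique ((hlim x).congr hconst) (hlim y)

theorem integrable_inner_gradient {W : Euc d → Euc d} (hW : Measurable W)
    (hWb : ∀ R : ℝ, ∃ C, ∀ x, ‖x‖ ≤ R → ‖W x‖ ≤ C) {φ : Euc d → ℝ} (hφ : DLip φ)
    (hs : HasCompactSupport φ) : Integrable fun x => ⟪W x, gradient φ x⟫ := by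
  obtain ⟨R, hR⟩ := hs.isCompact.isBounded.subset_closedBall (0 : Euc d)
  obtain ⟨C, hC⟩ := hWb R
  obtain ⟨L, hL0, hL⟩ := hφ.exists_bound_on_compact hs.isCompact
  refine integrable_of_bounded_on_compact (hW.inner (measurable_gradient _)).aestronglyMeasurable
    hs.isCompact (fun x hx => ?_) (C := C * L) fun x hx => ?_
  · rw [gradient_eq_zero_of_notMem_tsupport hx, inner_zero_right]
  · have h1 := hC x (by simpa using hR hx)
    refine (norm_inner_le_norm _ _).trans (mul_le_mul h1 ?_ (norm_nonneg _)
      ((norm_nonneg _).trans h1))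
    rw [norm_gradient]; exact hL x hx

theorem DLip.flux_measurable {E : Euc d → Euc d} (hE : Continuous E) {G : Euc d → ℝ}
    (hG : DLip G) : Measurable fun x => gradient G x + G x • E x :=
  (measurable_gradient G).add (hG.1.continuous.smul hE).measurable

theorem DLip.flux_bounded {E : Euc d → Euc d} (hE : Continuous E) {G : Euc d → ℝ}
    (hG : DLip G) (R : ℝ) : ∃ C, ∀ x, ‖x‖ ≤ R → ‖gradient G x + G x • E x‖ ≤ C := by
  obtain ⟨C, hC⟩ := hG.2 R
  obtain ⟨B, hB⟩ := (isCompact_closedBall (0 : Euc d) R).exists_bound_of_continuousOn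
    (hG.1.continuous.smul hE).continuousOn
  refine ⟨C + B, fun x hx => (norm_add_le _ _).trans (add_le_add ?_ (hB x (by simpa using hx)))⟩
  rw [norm_gradient]; exact hC x hx

/-- The relative entropy dissipation identity for two positive stationary solutions. -/
theorem integral_dissipation_eq {E : Euc d → Euc d} (hE : Continuous E) {G h : Euc d → ℝ}
    (hG : DLip G) (hh : DLip h) (hpos : ∀ x, 0 < h x)
    (hw : ∀ φ : Euc d → ℝ, ContDiff ℝ ∞ φ → HasCompactSupport φ →
      ∫ x, ⟪gradient G x + G x • E x, gradient φ x⟫ = 0)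
    (hw2 : ∀ φ : Euc d → ℝ, ContDiff ℝ ∞ φ → HasCompactSupport φ →
      ∫ x, ⟪gradient (fun y => h y * G y) x + (h x * G x) • E x, gradient φ x⟫ = 0)
    {χ : Euc d → ℝ} (hχ : ContDiff ℝ ∞ χ) (hχs : HasCompactSupport χ) :
    Integrable (fun x => G x * (2 / (1 + h x) ^ 3 * (χ x * ‖gradient h x‖ ^ 2))) ∧
    ∫ x, G x * (2 / (1 + h x) ^ 3 * (χ x * ‖gradient h x‖ ^ 2))
      = - ∫ x, h x / (1 + h x) * G x * adjOp E χ x := by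
  have hχD := DLip.of_contDiff hχ
  have hB : ∀ t ∈ Ioi (0 : ℝ), HasDerivAt (fun s : ℝ => s / (1 + s)) (1 / (1 + t) ^ 2) t := by
    intro t ht
    have ht' : 1 + t ≠ 0 := by have := mem_Ioi.1 ht; positivity
    refine ((hasDerivAt_id t).div ((hasDerivAt_id t).const_add 1) ht').congr_deriv ?_
    simp
  have hB1 : ∀ t ∈ Ioi (0 : ℝ), HasDerivAt (fun s : ℝ => 1 / (1 + s) ^ 2) (-2 / (1 + t) ^ 3) t := by
    intro t ht
    have ht' : 1 + t ≠ 0 := by have := mem_Ioi.1 ht; positivity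
    refine ((hasDerivAt_const t (1 : ℝ)).div (((hasDerivAt_id t).const_add 1).pow 2)
      (pow_ne_zero 2 ht')).congr_deriv ?_
    simp
    field_simp
  have hc : ∀ (c : ℝ) (n : ℕ), ContinuousOn (fun t : ℝ => c / (1 + t) ^ n) (Ioi 0) := fun c n =>
    continuousOn_const.div (by fun_prop) fun t ht => by have := mem_Ioi.1 ht; positivity
  have hbD : DLip fun x => 1 / (1 + h x) ^ 2 := hh.comp (s := Ioi 0) hpos hB1 (hc _ _)
  have hBD : DLip fun x => h x / (1 + h x) := hh.comp (s := Ioi 0) hpos hB (hc _ _)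
  have hT1 : DLip fun x => 1 / (1 + h x) ^ 2 * χ x := hbD.mul hχD
  have hT2 : DLip fun x => h x * (1 / (1 + h x) ^ 2 * χ x) := hh.mul hT1
  have hT3 : DLip fun x => h x / (1 + h x) * χ x := hBD.mul hχD
  have hG2 : DLip fun x => h x * G x := hh.mul hG
  have hBG : DLip fun x => h x / (1 + h x) * G x := hBD.mul hG
  have m1 := hG.flux_measurable hE
  have b1 := hG.flux_bounded hE
  have m2 := hG2.flux_measurable hE
  have b2 := hG2.flux_bounded hE
  have z1 := integral_inner_gradient_eq_zero_of_dLip m2 b2 hw2 hT1 hχs.mul_left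
  have z2 := integral_inner_gradient_eq_zero_of_dLip m1 b1 hw hT2 hχs.mul_left.mul_left
  have z3 := integral_inner_gradient_eq_zero_of_dLip m1 b1 hw hT3 hχs.mul_left
  have i1 := integrable_inner_gradient m2 b2 hT1 hχs.mul_left
  have i2 := integrable_inner_gradient m1 b1 hT2 hχs.mul_left.mul_left
  have i3 := integrable_inner_gradient m1 b1 hT3 hχs.mul_left
  have i4 := integrable_inner_gradient (hBG.flux_measurable hE) (hBG.flux_bounded hE) hχD hχs
  obtain ⟨C, -, hC⟩ := hBG.exists_bound_on_compact hχs.isCompact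
  have z4 := integral_weak_eq hE hBG.1 hχ hχs hC
  have hpt : ∀ x, G x * (2 / (1 + h x) ^ 3 * (χ x * ‖gradient h x‖ ^ 2))
      = ⟪gradient (fun y => h y / (1 + h y) * G y) x + (h x / (1 + h x) * G x) • E x, gradient χ x⟫
        - ((⟪gradient (fun y => h y * G y) x + (h x * G x) • E x,
            gradient (fun y => 1 / (1 + h y) ^ 2 * χ y) x⟫
          - ⟪gradient G x + G x • E x, gradient (fun y => h y * (1 / (1 + h y) ^ 2 * χ y)) x⟫)
          + ⟪gradient G x + G x • E x, gradient (fun y => h y / (1 + h y) * χ y) x⟫) := by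
    intro x
    rw [gradient_mul_real (hh.1 x) (hT1.1 x), gradient_mul_real (hbD.1 x) (hχD.1 x),
      gradient_mul_real (hBD.1 x) (hχD.1 x), gradient_mul_real (hBD.1 x) (hG.1 x),
      gradient_mul_real (hh.1 x) (hG.1 x), gradient_comp_real (hh.1 x) (hB _ (hpos x)),
      gradient_comp_real (hh.1 x) (hB1 _ (hpos x)), ← real_inner_self_eq_norm_sq]
    simp only [inner_add_left, inner_add_right, real_inner_smul_left, real_inner_smul_right,
      smul_add]
    rw [real_inner_comm (gradient h x) (gradient G x)]
    ring
  have hfun := funext hpt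
  rw [hfun]
  have i5 := (i1.sub i2).add i3
  refine ⟨i4.sub i5, ?_⟩
  have e := integral_sub i4 i5
  have e2 := integral_add (i1.sub i2) i3
  have e3 := integral_sub i1 i2
  simp only [Pi.sub_apply, Pi.add_apply] at e e2 e3
  rw [e, e2, e3, z1, z2, z3, z4]
  ring

theorem cutR_mono {r r' : ℝ} (hr : 0 < r) (h : r ≤ r') (x : Euc d) : cutR r x ≤ cutR r' x :=
  antitone_cut (by gcongr)

theorem exists_eq_mul_of_weak {E : Euc d → Euc d} (hE : Continuous E) {c : ℝ}
    (hEg : ∀ x, |⟪x, E x⟫| ≤ c * (1 + ‖x‖ ^ 2)) {G1 G2 : Euc d → ℝ}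
    (hG1 : DLip G1) (hG2 : DLip G2) (hp1 : ∀ x, 0 < G1 x) (hp2 : ∀ x, 0 < G2 x)
    (hi : Integrable G1)
    (hw1 : ∀ φ : Euc d → ℝ, ContDiff ℝ ∞ φ → HasCompactSupport φ →
      ∫ x, ⟪gradient G1 x + G1 x • E x, gradient φ x⟫ = 0)
    (hw2 : ∀ φ : Euc d → ℝ, ContDiff ℝ ∞ φ → HasCompactSupport φ →
      ∫ x, ⟪gradient G2 x + G2 x • E x, gradient φ x⟫ = 0) :
    ∃ a : ℝ, ∀ x, G2 x = a * G1 x := by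
  have hinv : DLip fun x => (G1 x)⁻¹ := hG1.comp (s := Ioi 0) hp1 (g' := fun t => -(t ^ 2)⁻¹)
    (fun t ht => hasDerivAt_inv (ne_of_gt ht))
    (ContinuousOn.neg (ContinuousOn.inv₀ (by fun_prop) fun t ht => by
      have := mem_Ioi.1 ht; positivity))
  set h : Euc d → ℝ := fun x => G2 x * (G1 x)⁻¹ with hh
  have hhD : DLip h := hG2.mul hinv
  have hhp : ∀ x, 0 < h x := fun x => mul_pos (hp2 x) (inv_pos.2 (hp1 x))
  have hhG : ∀ x, h x * G1 x = G2 x := fun x => inv_mul_cancel_right₀ (hp1 x).ne' _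
  have hhG' : (fun x => h x * G1 x) = G2 := funext hhG
  have key := fun n : ℕ => integral_dissipation_eq hE hG1 hhD hhp hw1
    (by simpa only [hhG', hhG] using hw2) (contDiff_cutR ((n : ℝ) + 1))
    (hasCompactSupport_cutR (by positivity))
  have hBi : Integrable fun x => h x / (1 + h x) * G1 x := by
    refine hi.mono (hhD.1.continuous.div (by have := hhD.1.continuous; fun_prop) (fun x => by
      have := hhp x; positivity) |>.mul hG1.1.continuous).aestronglyMeasurable
      (Eventually.of_forall fun x => ?_)
    rw [norm_mul]
    refine mul_le_of_le_one_left (norm_nonneg _) ?_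
    have := hhp x
    rw [Real.norm_of_nonneg (by positivity), div_le_one (by positivity)]
    linarith
  have hlim := (tendsto_integral_mul_adjOp_cutR hE hEg hBi).neg
  rw [neg_zero] at hlim
  have hlim' := hlim.congr fun n => ((key n).2).symm
  have hnn : ∀ (n : ℕ) x, 0 ≤ G1 x * (2 / (1 + h x) ^ 3 *
      (cutR ((n : ℝ) + 1) x * ‖gradient h x‖ ^ 2)) := fun n x => by
    have := hhp x
    have := hp1 x
    have := cutR_nonneg ((n : ℝ) + 1) x
    positivity
  have hzero : ∀ m : ℕ, ∫ x, G1 x * (2 / (1 + h x) ^ 3 *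
      (cutR ((m : ℝ) + 1) x * ‖gradient h x‖ ^ 2)) = 0 := fun m => by
    refine le_antisymm ?_ (integral_nonneg (hnn m))
    refine ge_of_tendsto hlim' ?_
    filter_upwards [eventually_ge_atTop m] with n hn
    refine integral_mono (key m).1 (key n).1 fun x => ?_
    have := hhp x
    have := hp1 x
    have hcm : cutR ((m : ℝ) + 1) x ≤ cutR ((n : ℝ) + 1) x :=
      cutR_mono (by positivity) (by gcongr) x
    dsimp only
    gcongr
  have hae : ∀ᵐ x, fderiv ℝ h x = 0 := by
    have := ae_all_iff.2 fun m : ℕ => (integral_eq_zero_iff_of_nonneg (hnn m) (key m).1).1 (hzero m)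
    filter_upwards [this] with x hx
    obtain ⟨m, hm⟩ := exists_nat_ge (2 * ‖x‖)
    have h1 := hx m
    have hp := hhp x
    rw [cutR_eq_one (by positivity) (by nlinarith [norm_nonneg x]), one_mul] at h1
    have h2 : (2 : ℝ) / (1 + h x) ^ 3 ≠ 0 := by positivity
    have h3 := (mul_eq_zero.1 ((mul_eq_zero.1 h1).resolve_left (hp1 x).ne')).resolve_left h2
    rw [← norm_eq_zero, ← norm_gradient]
    exact pow_eq_zero_iff (two_ne_zero) |>.1 h3
  exact ⟨h 0, fun x => by rw [← hhG x, eq_of_fderiv_ae_eq_zero hhD hae x 0]⟩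

/-- Fatou's lemma for nonnegative integrable functions with bounded integrals. -/
theorem integrable_of_tendsto_of_integral_le {f : ℕ → Euc d → ℝ} {g : Euc d → ℝ} {C : ℝ}
    (hf : ∀ n, Integrable (f n)) (h0 : ∀ n x, 0 ≤ f n x)
    (hlim : ∀ x, Tendsto (fun n => f n x) atTop (𝓝 (g x))) (hC : ∀ n, ∫ x, f n x ≤ C) :
    Integrable g ∧ ∫ x, g x ≤ C := by
  have hg0 : ∀ x, 0 ≤ g x := fun x => ge_of_tendsto' (hlim x) fun n => h0 n x
  have hgm : AEStronglyMeasurable g volume :=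
    aestronglyMeasurable_of_tendsto_ae atTop (fun n => (hf n).aestronglyMeasurable)
      (Eventually.of_forall hlim)
  have hle : ∫⁻ x, ENNReal.ofReal (g x) ≤ ENNReal.ofReal C := by
    have h1 : ∀ x, ENNReal.ofReal (g x) = liminf (fun n => ENNReal.ofReal (f n x)) atTop :=
      fun x => ((ENNReal.continuous_ofReal.tendsto _).comp (hlim x)).liminf_eq.symm
    simp_rw [h1]
    refine (lintegral_liminf_le' fun n => (hf n).aestronglyMeasurable.aemeasurable.ennreal_ofReal).trans
      ?_
    refine liminf_le_of_le (by isBoundedDefault) fun b hb => ?_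
    obtain ⟨n, hn⟩ := hb.exists
    refine hn.trans ?_
    rw [← ofReal_integral_eq_lintegral_ofReal (hf n) (Eventually.of_forall (h0 n))]
    exact ENNReal.ofReal_le_ofReal (hC n)
  have hC0 : 0 ≤ C := (integral_nonneg (h0 0)).trans (hC 0)
  refine ⟨⟨hgm, ?_⟩, ?_⟩
  · rw [hasFiniteIntegral_iff_ofReal (Eventually.of_forall hg0)]
    exact hle.trans_lt ENNReal.ofReal_lt_top
  · rw [integral_eq_lintegral_of_nonneg_ae (Eventually.of_forall hg0) hgm]
    exact ENNReal.toReal_le_of_le_ofReal hC0 hle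

/-- The localized energy identity for a nonlinear function of a stationary solution. -/
theorem integral_energy_eq {E : Euc d → Euc d} (hE : H0 E) {G : Euc d → ℝ}
    (hG : DLip G) (hpos : ∀ x, 0 < G x)
    (hw : ∀ φ : Euc d → ℝ, ContDiff ℝ ∞ φ → HasCompactSupport φ →
      ∫ x, ⟪gradient G x + G x • E x, gradient φ x⟫ = 0)
    {ψ ψ' Q : ℝ → ℝ} (hψ : ∀ t ∈ Ioi (0 : ℝ), HasDerivAt ψ (ψ' t) t)
    (hQ : ∀ t ∈ Ioi (0 : ℝ), HasDerivAt Q (t * ψ' t) t) (hψ' : ContinuousOn ψ' (Ioi 0))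
    {χ : Euc d → ℝ} (hχ : ContDiff ℝ ∞ χ) (hχs : HasCompactSupport χ) :
    Integrable (fun x => χ x * (ψ' (G x) * ‖gradient G x‖ ^ 2)) ∧
    ∫ x, χ x * (ψ' (G x) * ‖gradient G x‖ ^ 2)
      = (∫ x, (G x * ψ (G x) - Q (G x)) * adjOp E χ x) + ∫ x, Q (G x) * (χ x * dvg E x) := by
  have hEc : Continuous E := hE.1.continuous
  have hχD := DLip.of_contDiff hχ
  have hP : ∀ t ∈ Ioi (0 : ℝ), HasDerivAt (fun t => t * ψ t - Q t) (ψ t) t := fun t ht => by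
    refine (((hasDerivAt_id t).mul (hψ t ht)).sub (hQ t ht)).congr_deriv ?_
    simp
  have hψc : ContinuousOn ψ (Ioi 0) := fun t ht => (hψ t ht).continuousAt.continuousWithinAt
  have hψD : DLip fun x => ψ (G x) := hG.comp hpos hψ hψ'
  have hQD : DLip fun x => Q (G x) := hG.comp hpos hQ (continuousOn_id.mul hψ')
  have hPD : DLip fun x => G x * ψ (G x) - Q (G x) := hG.comp hpos hP hψc
  have hT : DLip fun x => ψ (G x) * χ x := hψD.mul hχD
  have z1 := integral_inner_gradient_eq_zero_of_dLip (hG.flux_measurable hEc)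
    (hG.flux_bounded hEc) hw hT hχs.mul_left
  have i1 := integrable_inner_gradient (hG.flux_measurable hEc) (hG.flux_bounded hEc) hT
    hχs.mul_left
  have i2 := integrable_inner_gradient (hPD.flux_measurable hEc) (hPD.flux_bounded hEc) hχD hχs
  obtain ⟨C, -, hC⟩ := hPD.exists_bound_on_compact hχs.isCompact
  have z2 := integral_weak_eq hEc hPD.1 hχ hχs hC
  obtain ⟨i3, i4, i5, z3⟩ := integral_transport_eq hE hQD hχ hχs
  have hpt : ∀ x, χ x * (ψ' (G x) * ‖gradient G x‖ ^ 2)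
      = ⟪gradient G x + G x • E x, gradient (fun y => ψ (G y) * χ y) x⟫
        - fderiv ℝ (fun y => Q (G y)) x (E x) * χ x
        - ⟪gradient (fun y => G y * ψ (G y) - Q (G y)) x
            + (G x * ψ (G x) - Q (G x)) • E x, gradient χ x⟫
        - Q (G x) * fderiv ℝ χ x (E x) := fun x => by
    rw [gradient_mul_real (hψD.1 x) (hχD.1 x), gradient_comp_real (hG.1 x) (hψ _ (hpos x)),
      gradient_comp_real (g := fun t => t * ψ t - Q t) (hG.1 x) (hP _ (hpos x)),
      ← real_inner_gradient_right, ← real_inner_gradient_right,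
      gradient_comp_real (hG.1 x) (hQ _ (hpos x)), ← real_inner_self_eq_norm_sq]
    simp only [inner_add_left, inner_add_right, real_inner_smul_left, real_inner_smul_right]
    ring
  rw [funext hpt]
  refine ⟨((i1.sub i3).sub i2).sub i5, ?_⟩
  have e1 := integral_sub ((i1.sub i3).sub i2) i5
  have e2 := integral_sub (i1.sub i3) i2
  have e3 := integral_sub i1 i3
  simp only [Pi.sub_apply] at e1 e2 e3
  rw [e1, e2, e3, z1, z2, z3]
  ring

theorem integral_energy_le {E : Euc d → Euc d} (hE : H0 E) {c C : ℝ}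
    (hEg : ∀ x, |⟪x, E x⟫| ≤ c * (1 + ‖x‖ ^ 2)) (hC : ∀ x, dvg E x ≤ C) (hC0 : 0 ≤ C)
    {G : Euc d → ℝ} (hG : DLip G) (hpos : ∀ x, 0 < G x)
    (hw : ∀ φ : Euc d → ℝ, ContDiff ℝ ∞ φ → HasCompactSupport φ →
      ∫ x, ⟪gradient G x + G x • E x, gradient φ x⟫ = 0)
    {ψ ψ' Q : ℝ → ℝ} (hψ : ∀ t ∈ Ioi (0 : ℝ), HasDerivAt ψ (ψ' t) t)
    (hQ : ∀ t ∈ Ioi (0 : ℝ), HasDerivAt Q (t * ψ' t) t) (hψ' : ContinuousOn ψ' (Ioi 0))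
    (hψ'0 : ∀ t ∈ Ioi (0 : ℝ), 0 ≤ ψ' t) (hQ0 : ∀ t ∈ Ioi (0 : ℝ), 0 ≤ Q t)
    (hPi : Integrable fun x => G x * ψ (G x) - Q (G x)) (hQi : Integrable fun x => Q (G x)) :
    Integrable (fun x => ψ' (G x) * ‖gradient G x‖ ^ 2) ∧
    ∫ x, ψ' (G x) * ‖gradient G x‖ ^ 2 ≤ C * ∫ x, Q (G x) := by
  have key := fun n : ℕ => integral_energy_eq hE hG hpos hw hψ hQ hψ'
    (contDiff_cutR (d := d) ((n : ℝ) + 1)) (hasCompactSupport_cutR (by positivity))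
  have hlim := (tendsto_integral_mul_adjOp_cutR hE.1.continuous hEg hPi).add_const
    (C * ∫ x, Q (G x))
  rw [zero_add] at hlim
  have hnn : ∀ x, 0 ≤ ψ' (G x) * ‖gradient G x‖ ^ 2 := fun x =>
    mul_nonneg (hψ'0 _ (hpos x)) (sq_nonneg _)
  refine integrable_of_tendsto_of_integral_le (fun n => (key n).1)
    (fun n x => mul_nonneg (cutR_nonneg _ _) (hnn x)) (fun x => ?_) fun m => ?_
  · refine tendsto_const_nhds.congr' ?_
    obtain ⟨m, hm⟩ := exists_nat_ge (2 * ‖x‖)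
    filter_upwards [eventually_ge_atTop m] with n hn
    have hn' : (m : ℝ) ≤ n := by exact_mod_cast hn
    rw [cutR_eq_one (by positivity) (by nlinarith [norm_nonneg x]), one_mul]
  · refine ge_of_tendsto hlim ?_
    filter_upwards [eventually_ge_atTop m] with n hn
    refine (integral_mono (key m).1 (key n).1 fun x => ?_).trans ?_
    · exact mul_le_mul_of_nonneg_right (cutR_mono (by positivity) (by gcongr) x) (hnn x)
    · rw [(key n).2, ← integral_const_mul]
      refine add_le_add le_rfl ?_
      have hDLip : DLip fun x => Q (G x) := hG.comp hpos hQ (continuousOn_id.mul hψ')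
      refine integral_mono (integral_transport_eq hE hDLip (contDiff_cutR _)
        (hasCompactSupport_cutR (by positivity))).2.1 (hQi.const_mul C) fun x => ?_
      dsimp only
      rw [mul_comm C]
      refine mul_le_mul_of_nonneg_left ?_ (hQ0 _ (hpos x))
      have h1 := cutR_nonneg ((n : ℝ) + 1) x
      have h2 := cutR_le_one ((n : ℝ) + 1) x
      calc cutR ((n : ℝ) + 1) x * dvg E x ≤ cutR ((n : ℝ) + 1) x * C :=
            mul_le_mul_of_nonneg_left (hC x) h1
        _ ≤ C := mul_le_of_le_one_left hC0 h2

theorem sq_sub_le_lintegral_fderiv {u : Euc d → ℝ} (hu : DLip u) (x h : Euc d) :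
    ENNReal.ofReal ((u (x + h) - u x) ^ 2)
      ≤ ∫⁻ t in Ioc (0 : ℝ) 1, ENNReal.ofReal (‖h‖ ^ 2 * ‖gradient u (x + t • h)‖ ^ 2) := by
  obtain ⟨C, hC⟩ := hu.2 (‖x‖ + ‖h‖)
  have hpath : Measurable fun t : ℝ => x + t • h := by fun_prop
  have hgm : Measurable fun t : ℝ => fderiv ℝ u (x + t • h) h :=
    (measurable_fderiv_apply_const ℝ u h).comp hpath
  have hnm : Measurable fun t : ℝ => ‖h‖ ^ 2 * ‖gradient u (x + t • h)‖ ^ 2 :=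
    (((measurable_gradient u).comp hpath).norm.pow_const 2).const_mul _
  have hb : ∀ t ∈ Ioc (0 : ℝ) 1, ‖fderiv ℝ u (x + t • h)‖ ≤ C := fun t ht => by
    refine hC _ ((norm_add_le _ _).trans (add_le_add le_rfl ?_))
    rw [norm_smul, Real.norm_of_nonneg ht.1.le]
    exact mul_le_of_le_one_left (norm_nonneg _) ht.2
  have hbd : ∀ t ∈ Ioc (0 : ℝ) 1, ‖fderiv ℝ u (x + t • h) h‖ ≤ C * ‖h‖ := fun t ht =>
    (ContinuousLinearMap.le_opNorm _ _).trans (mul_le_mul_of_nonneg_right (hb t ht) (norm_nonneg _))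
  have hintg : IntegrableOn (fun t : ℝ => fderiv ℝ u (x + t • h) h) (Ioc 0 1) :=
    Measure.integrableOn_of_bounded (by simp) hgm.aestronglyMeasurable
      ((ae_restrict_iff' measurableSet_Ioc).2 (Eventually.of_forall hbd))
  have hintg2 : IntegrableOn (fun t : ℝ => (fderiv ℝ u (x + t • h) h) ^ 2) (Ioc 0 1) :=
    Measure.integrableOn_of_bounded (M := (C * ‖h‖) ^ 2) (by simp)
      (hgm.pow_const 2).aestronglyMeasurable
      ((ae_restrict_iff' measurableSet_Ioc).2 (Eventually.of_forall fun t ht => by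
        rw [norm_pow]; exact pow_le_pow_left₀ (norm_nonneg _) (hbd t ht) 2))
  have hintg3 : IntegrableOn (fun t : ℝ => ‖h‖ ^ 2 * ‖gradient u (x + t • h)‖ ^ 2) (Ioc 0 1) :=
    Measure.integrableOn_of_bounded (M := ‖h‖ ^ 2 * C ^ 2) (by simp) hnm.aestronglyMeasurable
      ((ae_restrict_iff' measurableSet_Ioc).2 (Eventually.of_forall fun t ht => by
        rw [Real.norm_of_nonneg (by positivity), norm_gradient]
        have := hb t ht
        gcongr))
  have hftc : ∫ t in Ioc (0 : ℝ) 1, fderiv ℝ u (x + t • h) h = u (x + h) - u x := by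
    rw [← intervalIntegral.integral_of_le zero_le_one]
    have := intervalIntegral.integral_eq_sub_of_hasDerivAt (a := 0) (b := 1)
      (f := fun t : ℝ => u (x + t • h)) (f' := fun t => fderiv ℝ u (x + t • h) h)
      (fun t _ => by
        have h1 : HasDerivAt (fun t : ℝ => x + t • h) h t := by
          simpa using ((hasDerivAt_id t).smul_const h).const_add x
        exact (hu.1 _).hasFDerivAt.comp_hasDerivAt t h1)
      ((intervalIntegrable_iff_integrableOn_Ioc_of_le zero_le_one).2 hintg)
    rw [this]; simp
  have hjen : (u (x + h) - u x) ^ 2 ≤ ∫ t in Ioc (0 : ℝ) 1, (fderiv ℝ u (x + t • h) h) ^ 2 := by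
    set m := u (x + h) - u x with hm
    have h0 : 0 ≤ ∫ t in Ioc (0 : ℝ) 1, ((fderiv ℝ u (x + t • h) h) ^ 2
        - 2 * m * fderiv ℝ u (x + t • h) h + m ^ 2) :=
      integral_nonneg fun t => by
        have := sq_nonneg (fderiv ℝ u (x + t • h) h - m)
        dsimp only [Pi.zero_apply]
        linarith
    have hc : IntegrableOn (fun _ : ℝ => m ^ 2) (Ioc 0 1) := integrableOn_const (by simp)
    have e1 := integral_add (hintg2.sub (hintg.const_mul (2 * m))) hc
    have e2 := integral_sub hintg2 (hintg.const_mul (2 * m))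
    simp only [Pi.sub_apply] at e1 e2
    rw [e1, e2, integral_const_mul, hftc, integral_const] at h0
    simp at h0
    linarith
  refine (ENNReal.ofReal_le_ofReal (hjen.trans (setIntegral_mono hintg2 hintg3 fun t => ?_))).trans ?_
  · dsimp only
    rw [norm_gradient, ← mul_pow, mul_comm, ← sq_abs, ← Real.norm_eq_abs]
    exact pow_le_pow_left₀ (norm_nonneg _) (ContinuousLinearMap.le_opNorm _ _) 2
  · rw [ofReal_integral_eq_lintegral_ofReal hintg3 (Eventually.of_forall fun t => by positivity)]

theorem lintegral_sq_translate_sub_le {u : Euc d → ℝ} (hu : DLip u) (h : Euc d) :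
    ∫⁻ x, ENNReal.ofReal ((u (x + h) - u x) ^ 2)
      ≤ ENNReal.ofReal (‖h‖ ^ 2) * ∫⁻ x, ENNReal.ofReal (‖gradient u x‖ ^ 2) := by
  have hm : Measurable fun x : Euc d => ENNReal.ofReal (‖gradient u x‖ ^ 2) :=
    ((measurable_gradient u).norm.pow_const 2).ennreal_ofReal
  refine (lintegral_mono fun x => sq_sub_le_lintegral_fderiv hu x h).trans ?_
  have hpm : Measurable fun p : Euc d × ℝ => p.1 + p.2 • h := by fun_prop
  rw [lintegral_lintegral_swap (by
    exact ((((measurable_gradient u).comp hpm).norm.pow_const 2).const_mul _).ennreal_ofReal.aemeasurable)]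
  have : ∀ t : ℝ, ∫⁻ x, ENNReal.ofReal (‖h‖ ^ 2 * ‖gradient u (x + t • h)‖ ^ 2)
      = ENNReal.ofReal (‖h‖ ^ 2) * ∫⁻ x, ENNReal.ofReal (‖gradient u x‖ ^ 2) := fun t => by
    simp_rw [ENNReal.ofReal_mul (sq_nonneg ‖h‖)]
    rw [lintegral_const_mul _ (show Measurable fun x => ENNReal.ofReal (‖gradient u (x + t • h)‖ ^ 2) from
        hm.comp (measurable_id.add_const (t • h))),
      lintegral_add_right_eq_self (fun x => ENNReal.ofReal (‖gradient u x‖ ^ 2))]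
  simp_rw [this]
  simp

/-- A Nash-type inequality on the whole space. -/
theorem exists_nash_const {ρ : ℝ} (hρ : 0 < ρ) : ∃ K : ℝ, 0 ≤ K ∧ ∀ u : Euc d → ℝ, DLip u →
    (∀ x, 0 ≤ u x) → Integrable u → Integrable (fun x => u x ^ 2) →
    Integrable (fun x => ‖gradient u x‖ ^ 2) →
    ∫ x, u x ^ 2 ≤ ρ ^ 2 * (∫ x, ‖gradient u x‖ ^ 2) + K * (∫ x, u x) ^ 2 := by
  set B := closedBall (0 : Euc d) ρ with hB
  set V : ℝ := (volume B).toReal with hV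
  have hBfin : volume B ≠ ⊤ := measure_closedBall_lt_top.ne
  have hV0 : 0 < V := ENNReal.toReal_pos (measure_closedBall_pos _ _ hρ).ne' hBfin
  refine ⟨2 / V, by positivity, fun u hu h0 hi hi2 hig => ?_⟩
  set X := ∫ x, u x ^ 2 with hX
  set D := ∫ x, ‖gradient u x‖ ^ 2 with hD
  have hX0 : 0 ≤ X := integral_nonneg fun x => sq_nonneg _
  have hD0 : 0 ≤ D := integral_nonneg fun x => sq_nonneg _
  have hm : Measurable u := hu.1.continuous.measurable
  have eX : ∫⁻ x, ENNReal.ofReal (u x ^ 2) = ENNReal.ofReal X :=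
    (ofReal_integral_eq_lintegral_ofReal hi2 (Eventually.of_forall fun x => sq_nonneg _)).symm
  have eD : ∫⁻ x, ENNReal.ofReal (‖gradient u x‖ ^ 2) = ENNReal.ofReal D :=
    (ofReal_integral_eq_lintegral_ofReal hig (Eventually.of_forall fun x => sq_nonneg _)).symm
  have eS : ∫⁻ x, ENNReal.ofReal (u x) = ENNReal.ofReal (∫ x, u x) :=
    (ofReal_integral_eq_lintegral_ofReal hi (Eventually.of_forall h0)).symm
  have hper : ∀ h ∈ B, ENNReal.ofReal X ≤ ENNReal.ofReal (ρ ^ 2 * D)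
      + ENNReal.ofReal 2 * ∫⁻ x, ENNReal.ofReal (u x) * ENNReal.ofReal (u (x + h)) := fun h hh => by
    have hh' : ‖h‖ ≤ ρ := by simpa [hB] using hh
    have hpt : ∀ x, ENNReal.ofReal (u x ^ 2) ≤ ENNReal.ofReal ((u (x + h) - u x) ^ 2)
        + ENNReal.ofReal 2 * (ENNReal.ofReal (u x) * ENNReal.ofReal (u (x + h))) := fun x => by
      rw [← ENNReal.ofReal_mul (h0 x), ← ENNReal.ofReal_mul (by norm_num),
        ← ENNReal.ofReal_add (sq_nonneg _) (by have := h0 x; have := h0 (x + h); positivity)]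
      refine ENNReal.ofReal_le_ofReal ?_
      nlinarith [sq_nonneg (u (x + h))]
    have hmp : Measurable fun x => ENNReal.ofReal (u x) * ENNReal.ofReal (u (x + h)) :=
      hm.ennreal_ofReal.mul (hm.comp (measurable_id.add_const h)).ennreal_ofReal
    calc ENNReal.ofReal X = ∫⁻ x, ENNReal.ofReal (u x ^ 2) := eX.symm
      _ ≤ _ := lintegral_mono hpt
      _ = (∫⁻ x, ENNReal.ofReal ((u (x + h) - u x) ^ 2))
          + ENNReal.ofReal 2 * ∫⁻ x, ENNReal.ofReal (u x) * ENNReal.ofReal (u (x + h)) := by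
        rw [lintegral_add_right _ (hmp.const_mul _), lintegral_const_mul _ hmp]
      _ ≤ _ := by
        refine add_le_add ((lintegral_sq_translate_sub_le hu h).trans ?_) le_rfl
        rw [eD, ← ENNReal.ofReal_mul (sq_nonneg _)]
        refine ENNReal.ofReal_le_ofReal ?_
        gcongr
  have hprod : Measurable fun p : Euc d × Euc d =>
      ENNReal.ofReal (u p.2) * ENNReal.ofReal (u (p.2 + p.1)) :=
    (hm.comp measurable_snd).ennreal_ofReal.mul
      (hm.comp (measurable_snd.add measurable_fst)).ennreal_ofReal
  have hJ : ∫⁻ h, ∫⁻ x, ENNReal.ofReal (u x) * ENNReal.ofReal (u (x + h))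
      = ENNReal.ofReal (∫ x, u x) * ENNReal.ofReal (∫ x, u x) := by
    rw [lintegral_lintegral_swap hprod.aemeasurable]
    have : ∀ x : Euc d, ∫⁻ h, ENNReal.ofReal (u x) * ENNReal.ofReal (u (x + h))
        = ENNReal.ofReal (u x) * ENNReal.ofReal (∫ x, u x) := fun x => by
      rw [lintegral_const_mul _ (show Measurable fun h => ENNReal.ofReal (u (x + h)) from
          (hm.comp (measurable_id.const_add x)).ennreal_ofReal),
        lintegral_add_left_eq_self (fun y => ENNReal.ofReal (u y)), eS]
    simp_rw [this]
    rw [lintegral_mul_const _ hm.ennreal_ofReal, eS]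
  have hS0 : 0 ≤ ∫ x, u x := integral_nonneg h0
  have hfin : ENNReal.ofReal (X * V) ≤ ENNReal.ofReal (ρ ^ 2 * D * V + 2 * (∫ x, u x) ^ 2) := by
    have h1 := setLIntegral_mono' (μ := volume) (s := B) measurableSet_closedBall hper
    have hmeas : Measurable fun h => ∫⁻ x, ENNReal.ofReal (u x) * ENNReal.ofReal (u (x + h)) :=
      hprod.lintegral_prod_right'
    rw [lintegral_add_left measurable_const, setLIntegral_const, setLIntegral_const,
      lintegral_const_mul _ hmeas] at h1
    have h2 := h1.trans (add_le_add le_rfl (mul_le_mul_right ((setLIntegral_le_lintegral B _).trans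
      hJ.le) _))
    rw [← ENNReal.ofReal_toReal hBfin, ← hV, ← ENNReal.ofReal_mul hX0,
      ← ENNReal.ofReal_mul (by positivity), ← ENNReal.ofReal_mul hS0, 
      ← ENNReal.ofReal_mul (by norm_num), ← ENNReal.ofReal_add (by positivity) (by positivity)] at h2
    rwa [sq (∫ x, u x)]
  rw [ENNReal.ofReal_le_ofReal_iff (by positivity)] at hfin
  have : X ≤ (ρ ^ 2 * D * V + 2 * (∫ x, u x) ^ 2) / V := (le_div_iff₀ hV0).2 hfin
  refine this.trans (le_of_eq ?_)
  field_simp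

theorem hasDerivAt_div_one_add_mul {a t : ℝ} (h : 1 + a * t ≠ 0) :
    HasDerivAt (fun t => t / (1 + a * t)) (1 / (1 + a * t) ^ 2) t := by
  refine ((hasDerivAt_id t).div (((hasDerivAt_id t).const_mul a).const_add 1) h).congr_deriv ?_
  simp
  ring

theorem integral_truncation_pow_four_le {E : Euc d → Euc d} (hE : H0 E) {c C : ℝ}
    (hEg : ∀ x, |⟪x, E x⟫| ≤ c * (1 + ‖x‖ ^ 2)) (hC : ∀ x, dvg E x ≤ C) (hC0 : 0 ≤ C)
    {G : Euc d → ℝ} (hG : DLip G) (hpos : ∀ x, 0 < G x) (hGi : Integrable G)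
    (hw : ∀ φ : Euc d → ℝ, ContDiff ℝ ∞ φ → HasCompactSupport φ →
      ∫ x, ⟪gradient G x + G x • E x, gradient φ x⟫ = 0) {a : ℝ} (ha : 0 < a) :
    DLip (fun x => (G x / (1 + a * G x)) ^ 2) ∧
    Integrable (fun x => (G x / (1 + a * G x)) ^ 2) ∧
    Integrable (fun x => (G x / (1 + a * G x)) ^ 4) ∧
    Integrable (fun x => ‖gradient (fun y => (G y / (1 + a * G y)) ^ 2) x‖ ^ 2) ∧
    ∫ x, ‖gradient (fun y => (G y / (1 + a * G y)) ^ 2) x‖ ^ 2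
      ≤ C * ∫ x, (G x / (1 + a * G x)) ^ 4 := by
  have hne : ∀ t ∈ Ioi (0 : ℝ), 0 < 1 + a * t := fun t ht => by
    have := mem_Ioi.1 ht; positivity
  have hT : ∀ t ∈ Ioi (0 : ℝ), HasDerivAt (fun t => t / (1 + a * t)) (1 / (1 + a * t) ^ 2) t :=
    fun t ht => hasDerivAt_div_one_add_mul (hne t ht).ne'
  set T : ℝ → ℝ := fun t => t / (1 + a * t) with hTdef
  set ψ : ℝ → ℝ := fun t => 4 * (T t ^ 3 / 3 - a * T t ^ 4 / 2 + a ^ 2 * T t ^ 5 / 5) with hψdef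
  set ψ' : ℝ → ℝ := fun t => (2 * T t * (1 / (1 + a * t) ^ 2)) ^ 2 with hψ'def
  set Q : ℝ → ℝ := fun t => T t ^ 4 - 4 / 5 * (a * T t ^ 5) with hQdef
  have hTc : ContinuousOn T (Ioi 0) := fun t ht => (hT t ht).continuousAt.continuousWithinAt
  have hden : ContinuousOn (fun t : ℝ => 1 / (1 + a * t) ^ 2) (Ioi 0) :=
    continuousOn_const.div (by fun_prop) fun t ht => pow_ne_zero 2 (hne t ht).ne'
  have hT0 : ∀ t ∈ Ioi (0 : ℝ), 0 < T t := fun t ht => div_pos ht (hne t ht)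
  have hTle : ∀ t ∈ Ioi (0 : ℝ), T t ≤ t := fun t ht =>
    div_le_self (le_of_lt ht) (by have := mem_Ioi.1 ht; nlinarith [mul_pos ha this])
  have haT : ∀ t ∈ Ioi (0 : ℝ), a * T t ≤ 1 := fun t ht => by
    simp only [hTdef]
    rw [← mul_div_assoc, div_le_one (hne t ht)]; linarith
  have hψ : ∀ t ∈ Ioi (0 : ℝ), HasDerivAt ψ (ψ' t) t := fun t ht => by
    have h := hT t ht
    refine (((((h.pow 3).div_const 3).sub (((h.pow 4).const_mul a).div_const 2)).add
      (((h.pow 5).const_mul (a ^ 2)).div_const 5)).const_mul 4).congr_deriv ?_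
    have := (hne t ht).ne'
    simp only [hψ'def, hTdef, Nat.cast_ofNat, Nat.add_one_sub_one]
    field_simp
    ring
  have hQ : ∀ t ∈ Ioi (0 : ℝ), HasDerivAt Q (t * ψ' t) t := fun t ht => by
    have h := hT t ht
    refine ((h.pow 4).sub (((h.pow 5).const_mul a).const_mul (4 / 5))).congr_deriv ?_
    have := (hne t ht).ne'
    simp only [hψ'def, hTdef, Nat.cast_ofNat, Nat.add_one_sub_one]
    field_simp
    ring
  have hψ'c : ContinuousOn ψ' (Ioi 0) := ((continuousOn_const.mul hTc).mul hden).pow 2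
  have hQ0 : ∀ t ∈ Ioi (0 : ℝ), 0 ≤ Q t := fun t ht => by
    have h1 := hT0 t ht
    have h2 := haT t ht
    have : Q t = T t ^ 4 * (1 - 4 / 5 * (a * T t)) := by simp only [hQdef]; ring
    rw [this]
    exact mul_nonneg (by positivity) (by linarith)
  have hQle : ∀ t ∈ Ioi (0 : ℝ), Q t ≤ T t ^ 4 := fun t ht => by
    have := hT0 t ht
    have : 0 ≤ 4 / 5 * (a * T t ^ 5) := by positivity
    simp only [hQdef]; linarith
  have hTinv : ∀ t ∈ Ioi (0 : ℝ), T t ≤ 1 / a := fun t ht => by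
    rw [le_div_iff₀ ha, mul_comm]; exact haT t ht
  -- integrability by comparison with a multiple of `G`
  have hcomp : ∀ {g : ℝ → ℝ} {K : ℝ}, ContinuousOn g (Ioi 0) →
      (∀ t ∈ Ioi (0 : ℝ), |g t| ≤ K * t) → Integrable fun x => g (G x) := fun {g K} hg hb => by
    refine (hGi.const_mul K).mono' (hg.comp_continuous hG.1.continuous hpos).aestronglyMeasurable
      (Eventually.of_forall fun x => hb _ (hpos x))
  have hTpow : ∀ n : ℕ, ∀ t ∈ Ioi (0 : ℝ), T t ^ (n + 1) ≤ (1 / a) ^ n * t := fun n t ht => by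
    rw [pow_succ]
    exact mul_le_mul (pow_le_pow_left₀ (hT0 t ht).le (hTinv t ht) n) (hTle t ht) (hT0 t ht).le
      (by positivity)
  have hi2 : Integrable fun x => T (G x) ^ 2 := hcomp (g := fun t => T t ^ 2) (hTc.pow 2)
    fun t ht => by rw [abs_of_nonneg (sq_nonneg _)]; exact hTpow 1 t ht
  have hi4 : Integrable fun x => T (G x) ^ 4 := hcomp (g := fun t => T t ^ 4) (hTc.pow 4)
    fun t ht => by rw [abs_of_nonneg (by positivity)]; exact hTpow 3 t ht
  have hQc : ContinuousOn Q (Ioi 0) := fun t ht => (hQ t ht).continuousAt.continuousWithinAt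
  have hψc : ContinuousOn ψ (Ioi 0) := fun t ht => (hψ t ht).continuousAt.continuousWithinAt
  have hQi : Integrable fun x => Q (G x) := hcomp hQc fun t ht => by
    rw [abs_of_nonneg (hQ0 t ht)]; exact (hQle t ht).trans (hTpow 3 t ht)
  have hψb : ∀ t ∈ Ioi (0 : ℝ), |ψ t| ≤ 8 * (1 / a) ^ 3 := fun t ht => by
    have h1 := hT0 t ht
    have h2 := haT t ht
    have h3 : T t ^ 3 ≤ (1 / a) ^ 3 := pow_le_pow_left₀ h1.le (hTinv t ht) 3
    have h4 : ψ t = T t ^ 3 * (4 / 3 - 2 * (a * T t) + 4 / 5 * (a * T t) ^ 2) := by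
      simp only [hψdef]; ring
    have h5 : 0 < a * T t := by positivity
    rw [h4, abs_mul, abs_of_nonneg (by positivity), mul_comm]
    refine mul_le_mul ?_ h3 (by positivity) (by norm_num)
    rw [abs_le]; constructor <;> nlinarith
  have hψi : Integrable fun x => G x * ψ (G x) := hcomp (g := fun t => t * ψ t)
    (continuousOn_id.mul hψc) fun t ht => by
      rw [abs_mul, abs_of_pos ht, mul_comm]
      exact mul_le_mul_of_nonneg_right (hψb t ht) (le_of_lt ht)
  obtain ⟨k1, k2⟩ := integral_energy_le hE hEg hC hC0 hG hpos hw hψ hQ hψ'c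
    (fun t _ => sq_nonneg _) hQ0 (hψi.sub hQi) hQi
  have hu : ∀ t ∈ Ioi (0 : ℝ), HasDerivAt (fun t => T t ^ 2) (2 * T t * (1 / (1 + a * t) ^ 2)) t :=
    fun t ht => ((hT t ht).pow 2).congr_deriv (by simp)
  have hgrad : ∀ x, ‖gradient (fun y => T (G y) ^ 2) x‖ ^ 2 = ψ' (G x) * ‖gradient G x‖ ^ 2 :=
    fun x => by
      rw [gradient_comp_real (g := fun t => T t ^ 2) (hG.1 x) (hu _ (hpos x)), norm_smul, mul_pow,
        Real.norm_eq_abs, sq_abs]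
  have hgrad' := funext hgrad
  refine ⟨hG.comp (g := fun t => T t ^ 2) hpos hu ((continuousOn_const.mul hTc).mul hden),
    hi2, hi4, ?_, ?_⟩
  · change Integrable fun x => ‖gradient (fun y => T (G y) ^ 2) x‖ ^ 2
    rw [hgrad']; exact k1
  · change ∫ x, ‖gradient (fun y => T (G y) ^ 2) x‖ ^ 2 ≤ C * ∫ x, T (G x) ^ 4
    rw [hgrad']
    exact k2.trans (mul_le_mul_of_nonneg_left (integral_mono hQi hi4 fun x => hQle _ (hpos x)) hC0)

theorem le_of_forall_interpolation {X K : ℝ} (hX : 0 ≤ X) (hK : 0 ≤ K)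
    (h : ∀ s : ℝ, 0 < s → X ≤ K * (s ^ 2 * X + 1 / s) ^ 2) : X ≤ (4 * K) ^ 3 := by
  rcases hX.eq_or_lt with h0 | h0
  · rw [← h0]; positivity
  set y := X ^ ((1 : ℝ) / 3) with hy
  have hy0 : 0 < y := rpow_pos_of_pos h0 _
  have hy3 : y ^ 3 = X := by
    rw [hy, ← rpow_natCast, ← rpow_mul hX]; norm_num
  have h1 := h (1 / y) (by positivity)
  have h2 : (1 / y) ^ 2 * X + 1 / (1 / y) = 2 * y := by
    rw [← hy3]; field_simp; norm_num
  rw [h2, ← hy3] at h1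
  have h3 : y ≤ 4 * K := by
    have : y ^ 2 * y ≤ y ^ 2 * (4 * K) := by nlinarith
    exact le_of_mul_le_mul_left this (by positivity)
  rw [← hy3]
  exact pow_le_pow_left₀ hy0.le h3 3

theorem integrable_pow_four {E : Euc d → Euc d} (hE : H0 E) {c C : ℝ}
    (hEg : ∀ x, |⟪x, E x⟫| ≤ c * (1 + ‖x‖ ^ 2)) (hC : ∀ x, dvg E x ≤ C) (hC0 : 0 < C)
    {G : Euc d → ℝ} (hG : DLip G) (hpos : ∀ x, 0 < G x) (hGi : Integrable G)
    (hG1 : ∫ x, G x = 1)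
    (hw : ∀ φ : Euc d → ℝ, ContDiff ℝ ∞ φ → HasCompactSupport φ →
      ∫ x, ⟪gradient G x + G x • E x, gradient φ x⟫ = 0) : Integrable fun x => G x ^ 4 := by
  set ρ := √(1 / (2 * C)) with hρ
  have hρ0 : 0 < ρ := by positivity
  have hρ2 : ρ ^ 2 = 1 / (2 * C) := sq_sqrt (by positivity)
  obtain ⟨K, hK0, hK⟩ := exists_nash_const (d := d) hρ0
  refine (integrable_of_tendsto_of_integral_le
    (f := fun (n : ℕ) x => (G x / (1 + 1 / ((n : ℝ) + 1) * G x)) ^ 4) (C := (4 * (2 * K)) ^ 3)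
    (fun n => ?_) (fun n x => by positivity) (fun x => ?_) fun n => ?_).1
  · exact (integral_truncation_pow_four_le hE hEg hC hC0.le hG hpos hGi hw
      (a := 1 / ((n : ℝ) + 1)) (by positivity)).2.2.1
  · have h1 := ((tendsto_one_div_add_atTop_nhds_zero_nat (𝕜 := ℝ)).mul_const (G x)).const_add 1
    rw [zero_mul, add_zero] at h1
    have h2 := ((tendsto_const_nhds (x := G x)).div h1 one_ne_zero).pow 4
    rwa [div_one] at h2
  · set a : ℝ := 1 / ((n : ℝ) + 1) with ha
    have ha0 : 0 < a := by positivity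
    obtain ⟨q1, q2, q3, q4, q5⟩ := integral_truncation_pow_four_le hE hEg hC hC0.le hG hpos hGi hw ha0
    set X := ∫ x, (G x / (1 + a * G x)) ^ 4 with hX
    have hX0 : 0 ≤ X := integral_nonneg fun x => by positivity
    have e4 : ∀ x, ((G x / (1 + a * G x)) ^ 2) ^ 2 = (G x / (1 + a * G x)) ^ 4 := fun x => by ring
    have hn := hK _ q1 (fun x => sq_nonneg _) q2 (by simpa only [e4] using q3) q4
    simp only [e4] at hn
    rw [← hX] at hn
    have hhalf : X ≤ 2 * K * (∫ x, (G x / (1 + a * G x)) ^ 2) ^ 2 := by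
      have : ρ ^ 2 * (∫ x, ‖gradient (fun y => (G y / (1 + a * G y)) ^ 2) x‖ ^ 2) ≤ X / 2 := by
        refine (mul_le_mul_of_nonneg_left q5 (sq_nonneg _)).trans (le_of_eq ?_)
        rw [hρ2]; field_simp
      linarith
    refine le_of_forall_interpolation hX0 (by positivity) fun s hs => hhalf.trans ?_
    have hintg : ∫ x, (G x / (1 + a * G x)) ^ 2 ≤ s ^ 2 * X + 1 / s := by
      have h1 : ∫ x, (s ^ 2 * (G x / (1 + a * G x)) ^ 4 + 1 / s * G x) = s ^ 2 * X + 1 / s := by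
        rw [integral_add (q3.const_mul _) (hGi.const_mul _), integral_const_mul, integral_const_mul,
          hG1, mul_one]
      rw [← h1]
      refine integral_mono q2 ((q3.const_mul _).add (hGi.const_mul _)) fun x => ?_
      have hx := hpos x
      have ht0 : 0 < G x / (1 + a * G x) := by positivity
      have htle : G x / (1 + a * G x) ≤ G x :=
        div_le_self hx.le (by nlinarith [mul_pos ha0 hx])
      dsimp only
      set t := G x / (1 + a * G x)
      rcases le_total (s * t) 1 with h | h
      · have h2 : t ^ 2 ≤ 1 / s * t := by
          rw [sq]
          refine mul_le_mul_of_nonneg_right ?_ ht0.le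
          rw [le_div_iff₀ hs]; linarith
        have h3 : 1 / s * t ≤ 1 / s * G x := by gcongr
        have : 0 ≤ s ^ 2 * t ^ 4 := by positivity
        linarith
      · have h2 : t ^ 2 * 1 ≤ t ^ 2 * (s * t) ^ 2 := by
          have := one_le_pow₀ (n := 2) h
          gcongr
        have : 0 ≤ 1 / s * G x := by positivity
        nlinarith
    have h0 : 0 ≤ ∫ x, (G x / (1 + a * G x)) ^ 2 := integral_nonneg fun x => sq_nonneg _
    gcongr

theorem integrable_sq_mul_jap {G : Euc d → ℝ} (hGc : Continuous G) (hpos : ∀ x, 0 < G x) {k : ℝ}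
    (hk : 0 ≤ k) {n : ℕ} (hn : k ≤ n) (h4 : Integrable fun x => G x ^ 4)
    (hm : Integrable fun x => G x * (1 + ‖x‖ ^ 2) ^ (n + 1)) :
    Integrable fun x => G x ^ 2 * jap k x := by
  refine (h4.add hm).mono' ?_ (Eventually.of_forall fun x => ?_)
  · refine ((hGc.pow 2).mul ?_).aestronglyMeasurable
    unfold jap
    exact Continuous.rpow_const (by fun_prop) fun x => Or.inl (by positivity)
  · have h1 : (1 : ℝ) ≤ 1 + ‖x‖ ^ 2 := by nlinarith [sq_nonneg ‖x‖]
    set b := 1 + ‖x‖ ^ 2 with hb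
    have hb0 : 0 < b := by linarith
    set v := b ^ (k / 4) with hv
    have hv0 : 0 < v := rpow_pos_of_pos hb0 _
    have hv2 : jap k x = v ^ 2 := by
      change b ^ (k / 2) = v ^ 2
      rw [hv, ← rpow_natCast (b ^ (k / 4)), ← rpow_mul hb0.le]
      congr 1
      push_cast
      ring
    have hv3 : v ^ 3 ≤ b ^ (n + 1) := by
      rw [hv, ← rpow_natCast, ← rpow_natCast, ← rpow_mul hb0.le]
      refine rpow_le_rpow_of_exponent_le h1 ?_
      push_cast
      linarith
    have hx := hpos x
    rw [hv2, Real.norm_of_nonneg (by positivity)]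
    simp only [Pi.add_apply]
    rcases le_total v (G x) with h | h
    · have e1 : G x ^ 2 * v ^ 2 ≤ G x ^ 2 * G x ^ 2 := by gcongr
      have e2 : 0 ≤ G x * b ^ (n + 1) := by positivity
      nlinarith
    · have e1 : G x * (G x * v ^ 2) ≤ G x * (v * v ^ 2) := by gcongr
      have e2 : G x * v ^ 3 ≤ G x * b ^ (n + 1) := by gcongr
      have e3 : 0 ≤ G x ^ 4 := by positivity
      nlinarith

theorem H1.coercive {E : Euc d → Euc d} (h : H1 E) (K : ℝ) :
    ∃ R : ℝ, ∀ x, R ≤ ‖x‖ → K ≤ ⟪x, E x⟫ := by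
  obtain ⟨α, α₂, β, β₂, γ, γ₂, hα, -, hγ, -, -, hb⟩ := h
  refine ⟨max 1 ((K + β) / α), fun x hx => ?_⟩
  have h1 : 1 ≤ ‖x‖ := (le_max_left _ _).trans hx
  have h2 : (K + β) / α ≤ ‖x‖ := (le_max_right _ _).trans hx
  have h3 : ‖x‖ ≤ ‖x‖ ^ γ := by
    simpa using rpow_le_rpow_of_exponent_le h1 hγ.le
  rw [div_le_iff₀ hα] at h2
  have := (hb x).1
  nlinarith

theorem H1.exists_growth {E : Euc d → Euc d} (h : H1 E) :
    ∃ c : ℝ, 0 ≤ c ∧ ∀ x, |⟪x, E x⟫| ≤ c * (1 + ‖x‖ ^ 2) := by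
  obtain ⟨α, α₂, β, β₂, γ, γ₂, hα, hα₂, hγ, hγγ, hγ2, hb⟩ := h
  refine ⟨α₂ + |β₂| + |β|, by positivity, fun x => ?_⟩
  have hx2 : 0 ≤ ‖x‖ ^ 2 := sq_nonneg _
  have h1 : ‖x‖ ^ γ₂ ≤ 1 + ‖x‖ ^ 2 := by
    rcases le_total ‖x‖ 1 with h | h
    · have := rpow_le_one (norm_nonneg x) h (by linarith : 0 ≤ γ₂)
      linarith
    · have := rpow_le_rpow_of_exponent_le h hγ2
      rw [rpow_two] at this
      linarith
  have h2 : 0 ≤ ‖x‖ ^ γ := rpow_nonneg (norm_nonneg _) _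
  obtain ⟨h3, h4⟩ := hb x
  have h5 : α₂ * ‖x‖ ^ γ₂ ≤ α₂ * (1 + ‖x‖ ^ 2) := by gcongr
  have h6 : |β₂| ≤ |β₂| * (1 + ‖x‖ ^ 2) := le_mul_of_one_le_right (abs_nonneg _) (by linarith)
  have h7 : |β| ≤ |β| * (1 + ‖x‖ ^ 2) := le_mul_of_one_le_right (abs_nonneg _) (by linarith)
  have h8 : 0 ≤ |β₂| * (1 + ‖x‖ ^ 2) := by positivity
  have h9 : 0 ≤ |β| * (1 + ‖x‖ ^ 2) := by positivity
  have h10 : 0 ≤ α₂ * (1 + ‖x‖ ^ 2) := by positivity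
  have h11 : 0 ≤ α * ‖x‖ ^ γ := by positivity
  have h12 := le_abs_self β₂
  have h13 := le_abs_self β
  rw [abs_le]
  constructor <;> linarith

theorem H2.exists_dvg_le {E : Euc d → Euc d} {k β₀ c : ℝ} (hk : 0 ≤ k) (h : H2 k β₀ E)
    (hc : ∀ x, |⟪x, E x⟫| ≤ c * (1 + ‖x‖ ^ 2)) : ∃ C, 0 < C ∧ ∀ x, dvg E x ≤ C := by
  have hc0 : 0 ≤ c := by simpa using (abs_nonneg _).trans (hc 0)
  refine ⟨|β₀| + k * c + 1, by positivity, fun x => ?_⟩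
  have h1 := h x
  have h2 : k * ⟪x, E x⟫ / (1 + ‖x‖ ^ 2) ≤ k * c := by
    rw [div_le_iff₀ (by positivity), mul_assoc]
    exact mul_le_mul_of_nonneg_left ((le_abs_self _).trans (hc x)) hk
  have h3 := neg_abs_le β₀
  linarith

theorem exists_stationary (hd : 1 ≤ d) {E : Euc d → Euc d} (hE : H0 E)
    (hco : ∀ K : ℝ, ∃ R : ℝ, ∀ x, R ≤ ‖x‖ → K ≤ ⟪x, E x⟫) (n : ℕ) :
    ∃ G : Euc d → ℝ, DLip G ∧ (∀ x, 0 < G x) ∧ Integrable G ∧ ∫ x, G x = 1 ∧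
      Integrable (fun x => G x * (1 + ‖x‖ ^ 2) ^ (n + 1)) ∧
      ∀ φ : Euc d → ℝ, ContDiff ℝ ∞ φ → HasCompactSupport φ →
        ∫ x, ⟪gradient G x + G x • E x, gradient φ x⟫ = 0 := by
  have hEc : Continuous E := hE.1.continuous
  obtain ⟨μ, hprob, hmom, hμ⟩ := exists_invariant_measure hd hEc hco n
  obtain ⟨f, hf, hf0, hμf⟩ := exists_continuous_density hd hEc hμ
  have hw : ∀ φ : Euc d → ℝ, ContDiff ℝ ∞ φ → HasCompactSupport φ →
      ∫ x, f x * adjOp E φ x = 0 := fun φ hφ hs => by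
    rw [← integral_withDensity_ofReal hf hf0, ← hμf]; exact hμ φ hφ hs
  have hmass : ∫ x, f x = 1 := by
    have := integral_withDensity_ofReal hf hf0 fun _ => (1 : ℝ)
    rw [← hμf] at this
    simpa using this.symm
  have hfi : Integrable f := by
    by_contra h
    rw [integral_undef h] at hmass
    exact zero_ne_one hmass
  have hlip : LipBalls f := lipBalls_of_weak hd hE.lipBalls hf hw
  have hDL : DLip f := ⟨differentiable_of_weak hd hE.lipBalls hE.1 hlip hw, fun R => by
    obtain ⟨L, hL, h⟩ := hlip (R + 1)
    exact ⟨L, fun x hx => LipBalls.norm_fderiv_le hL h (by linarith)⟩⟩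
  refine ⟨f, hDL, pos_of_integral_ne_zero hd hEc hf hf0 hw (by rw [hmass]; exact one_ne_zero),
    hfi, hmass, ?_, fun φ hφ hs => ?_⟩
  · rw [hμf, integrable_withDensity_iff_integrable_smul' (by fun_prop) (by simp)] at hmom
    simpa only [ENNReal.toReal_ofReal (hf0 _), smul_eq_mul] using hmom
  · obtain ⟨C, -, hC⟩ := hDL.exists_bound_on_compact hs.isCompact
    rw [integral_weak_eq hEc hDL.1 hφ hs hC, hw φ hφ hs, neg_zero]

end StationarySolution

/-- under (H0), (H1) and (H2) (with `p = 2`), there is a unique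
strictly positive stationary solution `G ∈ L²ₖ` of the Fokker–Planck equation
with unit mass: `div(∇G + EG) = 0` in the sense of distributions. -/
theorem stmt0 (d : ℕ) (hd : 1 ≤ d) (k : ℝ) (hk : 0 ≤ k)
    (E : EuclideanSpace ℝ (Fin d) → EuclideanSpace ℝ (Fin d))
    (hE0 : H0 E) (hE1 : H1 E) (hE2 : ∃ β₀ : ℝ, H2 k β₀ E) :
    ∃! G : EuclideanSpace ℝ (Fin d) → ℝ,
      Differentiable ℝ G ∧
      Integrable (fun x => G x ^ 2 * jap k x) ∧
      (∀ x, 0 < G x) ∧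
      Integrable G ∧
      (∫ x, G x) = 1 ∧
      ∀ φ : EuclideanSpace ℝ (Fin d) → ℝ,
        ContDiff ℝ (⊤ : ℕ∞) φ → HasCompactSupport φ →
          (∫ x, ⟪gradient G x + G x • E x, gradient φ x⟫) = 0 := by
  obtain ⟨c, -, hc⟩ := hE1.exists_growth
  obtain ⟨β₀, hβ⟩ := hE2
  obtain ⟨C, hC0, hC⟩ := hβ.exists_dvg_le hk hc
  obtain ⟨n, hn⟩ := exists_nat_ge k
  obtain ⟨G, hG, hpos, hGi, hG1, hmom, hw⟩ := exists_stationary hd hE0 hE1.coercive n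
  have h4 := integrable_pow_four hE0 hc hC hC0 hG hpos hGi hG1 hw
  refine ⟨G, ⟨hG.1, integrable_sq_mul_jap hG.1.continuous hpos hk hn h4 hmom, hpos, hGi, hG1, hw⟩, ?_⟩
  rintro F ⟨hFd, -, hFpos, -, hF1, hFw⟩
  obtain ⟨a, ha⟩ := exists_eq_mul_of_weak hE0.1.continuous hc hG (dLip_of_weak hd hE0 hFd hFw)
    hpos hFpos hGi hw hFw
  have h1 : a = 1 := by
    have h2 : ∫ x, F x = a * ∫ x, G x := by rw [← integral_const_mul]; simp_rw [ha]
    rw [hF1, hG1, mul_one] at h2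
    exact h2.symm
  funext x
  rw [ha x, h1, one_mul]
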